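/- Let d ≥ 2, λ ∈ (0,1] and N > 1. If u ∈ ℱ(N), then for every 0 < r ≤ 1/2, ℋ^{d−2}(S(u) ∩ B(0,r)) ≤ C(N) r^{d−2}, where S(u) = {x ∈ B_1 : u(x) = 0 and ∇u(x) = 0} is the singular set of u and C(N) depends only on d, λ and N. -/

import Mathlib

open MeasureTheory Metric Set
open scoped ENNReal NNReal

noncomputable section

/-- The bilinear form `⟨A ξ, η⟩ = ∑ i j, A i j * ξ j * η i`. -/
def bform {d : ℕ} (A : Matrix (Fin d) (Fin d) ℝ) (ξ η : EuclideanSpace ℝ (Fin d)) : ℝ :=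
  ∑ i, ∑ j, A i j * ξ j * η i

/-- The point of `ℝᵈ` (as `EuclideanSpace`) with integer coordinates `z`. -/
def perPt {d : ℕ} (z : Fin d → ℤ) : EuclideanSpace ℝ (Fin d) :=
  (WithLp.equiv 2 (Fin d → ℝ)).symm fun i => (z i : ℝ)

/-- The class `𝒜(λ, M)`: symmetric, elliptic, `ℤᵈ`-periodic, `M`-Lipschitz coefficients. -/
structure MemA (d : ℕ) (lam M : ℝ)
    (A : EuclideanSpace ℝ (Fin d) → Matrix (Fin d) (Fin d) ℝ) : Prop where
  symm : ∀ y, (A y).IsSymm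
  ellip_low : ∀ y ξ, lam * ‖ξ‖ ^ 2 ≤ bform (A y) ξ ξ
  ellip_high : ∀ y ξ, bform (A y) ξ ξ ≤ ‖ξ‖ ^ 2
  periodic : ∀ (y : EuclideanSpace ℝ (Fin d)) (z : Fin d → ℤ), A (y + perPt z) = A y
  lipschitz : ∀ x y i j, |A x i j - A y i j| ≤ M * ‖x - y‖

/-- `u` is a weak solution of `div (A ∇u) = 0` in the open set `Ω`:
`u` is `C¹` on `Ω` and the weak formulation holds against all test functions. -/
def IsWeakSol {d : ℕ} (A : EuclideanSpace ℝ (Fin d) → Matrix (Fin d) (Fin d) ℝ)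
    (Ω : Set (EuclideanSpace ℝ (Fin d))) (u : EuclideanSpace ℝ (Fin d) → ℝ) : Prop :=
  ContDiffOn ℝ 1 u Ω ∧
  ∀ ψ : EuclideanSpace ℝ (Fin d) → ℝ, ContDiff ℝ (⊤ : ℕ∞) ψ → HasCompactSupport ψ →
    tsupport ψ ⊆ Ω →
    ∫ x in Ω, bform (A x) (gradient u x) (gradient ψ x) = 0

/-- The unit cube `[0,1]^d`. -/
def unitCube (d : ℕ) : Set (EuclideanSpace ℝ (Fin d)) := {y | ∀ i, y i ∈ Set.Icc (0 : ℝ) 1}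

/-- `χ` is the corrector for the operator with coefficient matrix `A`. -/
def IsCorrector {d : ℕ} (A : EuclideanSpace ℝ (Fin d) → Matrix (Fin d) (Fin d) ℝ)
    (χ : Fin d → EuclideanSpace ℝ (Fin d) → ℝ) : Prop :=
  ∀ j, ContDiff ℝ 1 (χ j) ∧
    (∀ (y : EuclideanSpace ℝ (Fin d)) (z : Fin d → ℤ), χ j (y + perPt z) = χ j y) ∧
    (∫ y in unitCube d, χ j y) = 0 ∧
    (∀ ψ : EuclideanSpace ℝ (Fin d) → ℝ, ContDiff ℝ (⊤ : ℕ∞) ψ → HasCompactSupport ψ →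
      ∫ y, bform (A y) (gradient (χ j) y + EuclideanSpace.single j 1) (gradient ψ y) = 0)

/-- The homogenized matrix `Â`, `â_ij = ∫_{[0,1]^d} (a_ij + a_ik ∂χ_j/∂y_k) dy`. -/
def homMatrix {d : ℕ} (A : EuclideanSpace ℝ (Fin d) → Matrix (Fin d) (Fin d) ℝ)
    (χ : Fin d → EuclideanSpace ℝ (Fin d) → ℝ) : Matrix (Fin d) (Fin d) ℝ :=
  Matrix.of fun i j => ∫ y in unitCube d, (A y i j + ∑ k, A y i k * gradient (χ j) y k)

/-- The ellipsoid `E_r = {x : ⟨Â⁻¹ x, x⟩ < r²}` associated with a homogenized matrix `Â`. -/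
def ellipsoid {d : ℕ} (Ahat : Matrix (Fin d) (Fin d) ℝ) (r : ℝ) :
    Set (EuclideanSpace ℝ (Fin d)) := {x | bform Ahat⁻¹ x x < r ^ 2}

/-- The class `ℱ(N)` of normalized solutions of constant-coefficient equations in `B₁`
satisfying an `N`-doubling condition. -/
def MemF (d : ℕ) (lam N : ℝ) (u : EuclideanSpace ℝ (Fin d) → ℝ) : Prop :=
  (∃ A : Matrix (Fin d) (Fin d) ℝ, A.IsSymm ∧
      (∀ ξ : EuclideanSpace ℝ (Fin d), lam * ‖ξ‖ ^ 2 ≤ bform A ξ ξ ∧ bform A ξ ξ ≤ ‖ξ‖ ^ 2) ∧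
      IsWeakSol (fun _ => A) (ball 0 1) u) ∧
  (⨍ x in ball (0 : EuclideanSpace ℝ (Fin d)) 1, (u x) ^ 2) = 1 ∧
  (⨍ x in ball (0 : EuclideanSpace ℝ (Fin d)) 1, (u x) ^ 2) ≤
    N * ⨍ x in ball (0 : EuclideanSpace ℝ (Fin d)) (1 / 2), (u x) ^ 2

/-- `w` is harmonic on `Ω`: it is `C²` there and its Laplacian vanishes. -/
def IsHarmonicOn {d : ℕ} (w : EuclideanSpace ℝ (Fin d) → ℝ)
    (Ω : Set (EuclideanSpace ℝ (Fin d))) : Prop :=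
  ContDiffOn ℝ 2 w Ω ∧ ∀ x ∈ Ω, (∑ i, gradient (fun y => gradient w y i) x i) = 0

/-- `F_ε(y, r) = ℋ^{d-1}(Z(u) ∩ B(y,r)) / r^{d-1}` where `Z(u)` is the nodal set of `u` in `B₂`. -/
def nodalRatio {d : ℕ} (u : EuclideanSpace ℝ (Fin d) → ℝ)
    (y : EuclideanSpace ℝ (Fin d)) (r : ℝ) : ℝ≥0∞ :=
  μH[(d : ℝ) - 1] ({x ∈ ball (0 : EuclideanSpace ℝ (Fin d)) 2 | u x = 0} ∩ ball y r) /
    ENNReal.ofReal (r ^ (d - 1))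

namespace SSM

lemma cauchy_deriv_bound {f : ℂ → ℂ} {R B : ℝ} (hR : 0 < R) {c : ℂ}
    (hf : DifferentiableOn ℂ f (ball c R)) (hB : ∀ z ∈ ball c R, ‖f z‖ ≤ B) :
    ‖deriv f c‖ ≤ 2 * B / R := by
  have h := Complex.norm_deriv_le_of_forall_mem_sphere_norm_le (c := c) (R := R/2) (C := B)
    (f := f) (by positivity) ?_ ?_
  · refine h.trans (le_of_eq ?_); field_simp
  · refine DifferentiableOn.diffContOnCl ?_
    rw [closure_ball _ (by positivity)]
    exact hf.mono (closedBall_subset_ball (by linarith))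
  · intro z hz
    apply hB
    rw [mem_sphere] at hz
    rw [mem_ball, hz]; linarith

variable {W : Type*} [NormedAddCommGroup W] [NormedSpace ℂ W]

lemma cauchy_fderiv_bound {f : W → ℂ} {R B : ℝ} (hR : 0 < R) {c : W}
    (hf : DifferentiableOn ℂ f (ball c R)) (hB : ∀ z ∈ ball c R, ‖f z‖ ≤ B) :
    ‖fderiv ℂ f c‖ ≤ 2 * B / R := by
  have hB0 : 0 ≤ B := (norm_nonneg _).trans (hB c (mem_ball_self hR))
  refine ContinuousLinearMap.opNorm_le_bound _ (by positivity) ?_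
  intro w
  by_cases hw : w = 0
  · simp [hw]
  have hwn : 0 < ‖w‖ := norm_pos_iff.mpr hw
  have hmem : ∀ ζ ∈ ball (0:ℂ) (R/‖w‖), c + ζ • w ∈ ball c R := by
    intro ζ hζ
    rw [mem_ball_zero_iff] at hζ
    rw [mem_ball, dist_eq_norm, add_sub_cancel_left, norm_smul]
    rwa [lt_div_iff₀ hwn] at hζ
  have hda : DifferentiableAt ℂ f c := (hf c (mem_ball_self hR)).differentiableAt (ball_mem_nhds _ hR)
  have hder : HasDerivAt (fun ζ : ℂ => f (c + ζ • w)) (fderiv ℂ f c w) 0 := by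
    have h1 : HasDerivAt (fun ζ : ℂ => c + ζ • w) w 0 := by
      simpa using ((hasDerivAt_id (0:ℂ)).smul_const w).const_add c
    have h2 : HasFDerivAt f (fderiv ℂ f c) (c + (0:ℂ) • w) := by simpa using hda.hasFDerivAt
    exact h2.comp_hasDerivAt (0:ℂ) h1
  have h := cauchy_deriv_bound (f := fun ζ : ℂ => f (c + ζ • w)) (c := 0) (R := R/‖w‖) (B := B)
    (by positivity) ?_ ?_
  · rw [hder.deriv] at h
    refine h.trans (le_of_eq ?_); field_simp
  · refine hf.comp (by fun_prop) hmem
  · intro z hz; exact hB _ (hmem z hz)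

lemma par_diff [FiniteDimensional ℂ W] {α : Type*} [MeasurableSpace α] {μ : Measure α}
    {f : W → α → ℂ} {z0 : W} {R : ℝ} (hR : 0 < R) {bound : α → ℝ}
    (hbi : Integrable bound μ)
    (hf : ∀ᵐ y ∂μ, DifferentiableOn ℂ (fun z => f z y) (ball z0 R))
    (hb : ∀ᵐ y ∂μ, ∀ z ∈ ball z0 R, ‖f z y‖ ≤ bound y)
    (hm : ∀ z ∈ ball z0 R, AEStronglyMeasurable (f z) μ) :
    DifferentiableAt ℂ (fun z => ∫ y, f z y ∂μ) z0 := by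
  classical
  have hz0 : z0 ∈ ball z0 R := mem_ball_self hR
  have hmeas : AEStronglyMeasurable (fun y => fderiv ℂ (fun z => f z y) z0) μ := by
    let b := Module.finBasis ℂ W
    have hcomp : ∀ i, AEStronglyMeasurable (fun y => fderiv ℂ (fun z => f z y) z0 (b i)) μ := by
      intro i
      let t : ℕ → ℂ := fun n => ((R / (2 * (‖b i‖ + 1)) * (1 / ((n:ℝ) + 1)) : ℝ) : ℂ)
      have htn : ∀ n, ‖t n‖ = R / (2 * (‖b i‖ + 1)) * (1 / ((n:ℝ) + 1)) := by
        intro n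
        simp only [t]
        rw [Complex.norm_real, Real.norm_of_nonneg (by positivity)]
      have ht0 : ∀ n, t n ≠ 0 := by
        intro n; rw [← norm_pos_iff, htn]; positivity
      have htl : Filter.Tendsto t Filter.atTop (nhds 0) := by
        rw [tendsto_zero_iff_norm_tendsto_zero]
        simp_rw [htn]
        simpa using (tendsto_one_div_add_atTop_nhds_zero_nat (𝕜 := ℝ)).const_mul (R / (2 * (‖b i‖ + 1)))
      have hin : ∀ n, z0 + t n • b i ∈ ball z0 R := by
        intro n
        rw [mem_ball, dist_eq_norm, add_sub_cancel_left, norm_smul, htn]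
        have h1 : 1 / ((n:ℝ)+1) ≤ 1 := by
          rw [div_le_one (by positivity)]; linarith [Nat.cast_nonneg (α := ℝ) n]
        have h2 : R / (2 * (‖b i‖ + 1)) * ‖b i‖ < R := by
          rw [div_mul_eq_mul_div, div_lt_iff₀ (by positivity)]
          nlinarith [norm_nonneg (b i)]
        calc R / (2 * (‖b i‖ + 1)) * (1 / ((n:ℝ) + 1)) * ‖b i‖
            ≤ R / (2 * (‖b i‖ + 1)) * 1 * ‖b i‖ := by gcongr
          _ < R := by simpa using h2
      refine aestronglyMeasurable_of_tendsto_ae (u := Filter.atTop)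
        (f := fun n y => (t n)⁻¹ • (f (z0 + t n • b i) y - f z0 y)) ?_ ?_
      · intro n
        exact ((hm _ (hin n)).sub (hm _ hz0)).const_smul ((t n)⁻¹)
      · filter_upwards [hf] with y hy
        have hda : DifferentiableAt ℂ (fun z => f z y) z0 := (hy z0 hz0).differentiableAt (ball_mem_nhds _ hR)
        have hder : HasDerivAt (fun ζ : ℂ => f (z0 + ζ • b i) y) (fderiv ℂ (fun z => f z y) z0 (b i)) 0 := by
          have h1 : HasDerivAt (fun ζ : ℂ => z0 + ζ • b i) (b i) 0 := by
            simpa using ((hasDerivAt_id (0:ℂ)).smul_const (b i)).const_add z0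
          have h2 : HasFDerivAt (fun z => f z y) (fderiv ℂ (fun z => f z y) z0) (z0 + (0:ℂ) • b i) := by
            simpa using hda.hasFDerivAt
          exact h2.comp_hasDerivAt (0:ℂ) h1
        have h3 := hder.tendsto_slope_zero
        have h4 : Filter.Tendsto t Filter.atTop (nhdsWithin 0 {0}ᶜ) :=
          tendsto_nhdsWithin_iff.mpr ⟨htl, Filter.Eventually.of_forall ht0⟩
        simpa [Function.comp_def] using h3.comp h4
    have heq : (fun y => fderiv ℂ (fun z => f z y) z0) =
        fun y => ∑ i, (fderiv ℂ (fun z => f z y) z0 (b i)) • (LinearMap.toContinuousLinearMap (b.coord i)) := by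
      funext y
      ext w
      conv_lhs => rw [← b.sum_repr w, map_sum]
      simp [mul_comm]
    rw [heq]
    refine Finset.aestronglyMeasurable_fun_sum _ fun i _ => ?_
    exact (hcomp i).smul_const _
  refine (hasFDerivAt_integral_of_dominated_of_fderiv_le (F := f) (𝕜 := ℂ)
    (F' := fun z y => fderiv ℂ (fun z => f z y) z)
    (bound := fun y => 2 * bound y / (R/2)) (s := ball z0 (R/2)) (ball_mem_nhds _ (by positivity)) ?_ ?_ hmeas ?_ ?_ ?_).differentiableAt
  · filter_upwards [ball_mem_nhds z0 hR] with z hz using hm z hz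
  · refine hbi.mono' (hm z0 hz0) ?_
    filter_upwards [hb] with y hy using hy z0 hz0
  · filter_upwards [hf, hb] with y hy hyb z hz
    have hsub : ball z (R/2) ⊆ ball z0 R := by
      apply ball_subset_ball'
      rw [mem_ball] at hz; linarith
    exact cauchy_fderiv_bound (by positivity) (hy.mono hsub) fun w hw => hyb w (hsub hw)
  · exact (hbi.const_mul 2).div_const _
  · filter_upwards [hf] with y hy z hz
    exact ((hy z (ball_subset_ball (by linarith) hz)).differentiableAt
      (isOpen_ball.mem_nhds (ball_subset_ball (by linarith) hz))).hasFDerivAt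

/-- directional derivative of a holomorphic function is holomorphic -/
lemma diff_fderiv_apply [FiniteDimensional ℂ W] {U : W → ℂ} {Ω : Set W} (hΩ : IsOpen Ω)
    (hU : DifferentiableOn ℂ U Ω) (w : W) :
    DifferentiableOn ℂ (fun z => fderiv ℂ U z w) Ω := by
  intro z0 hz0
  obtain ⟨R, hR, hsub⟩ := Metric.isOpen_iff.mp hΩ z0 hz0
  obtain ⟨B, hB⟩ : ∃ B, ∀ z ∈ ball z0 (R/2), ‖U z‖ ≤ B := by
    have hc : ContinuousOn U (closedBall z0 (R/2)) :=
      (hU.mono ((closedBall_subset_ball (by linarith)).trans hsub)).continuousOn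
    have : FiniteDimensional ℝ W := FiniteDimensional.complexToReal W
    have : ProperSpace W := FiniteDimensional.proper ℝ W
    obtain ⟨B, hB⟩ := (isCompact_closedBall z0 (R/2)).exists_bound_of_continuousOn hc
    exact ⟨B, fun z hz => hB z (ball_subset_closedBall hz)⟩
  have hUd : DifferentiableOn ℂ U (ball z0 (R/2)) := hU.mono ((ball_subset_ball (by linarith)).trans hsub)
  -- ρ = R / (8 (‖w‖+1))
  set ρ : ℝ := R / (8 * (‖w‖ + 1)) with hρ
  have hρ0 : 0 < ρ := by positivity
  have hρw : ρ * ‖w‖ < R / 4 := by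
    rw [hρ, div_mul_eq_mul_div, div_lt_iff₀ (by positivity)]
    nlinarith [norm_nonneg w]
  have key : ∀ z ∈ ball z0 (R/4), ∀ ζ : ℂ, ‖ζ‖ ≤ ρ → z + ζ • w ∈ ball z0 (R/2) := by
    intro z hz ζ hζ
    rw [mem_ball, dist_eq_norm] at hz ⊢
    have : ‖ζ • w‖ ≤ ρ * ‖w‖ := by rw [norm_smul]; gcongr
    calc ‖z + ζ • w - z0‖ = ‖(z - z0) + ζ • w‖ := by congr 1; abel
      _ ≤ ‖z - z0‖ + ‖ζ • w‖ := norm_add_le _ _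
      _ < R/2 := by linarith
  have hform : ∀ z ∈ ball z0 (R/4), fderiv ℂ U z w =
      (2 * Real.pi * Complex.I : ℂ)⁻¹ • ∮ ζ in C(0, ρ), (ζ - 0)⁻¹ ^ 2 • U (z + ζ • w) := by
    intro z hz
    have hda : DifferentiableAt ℂ U z :=
      (hUd z (ball_subset_ball (by linarith) hz)).differentiableAt
        (isOpen_ball.mem_nhds (ball_subset_ball (by linarith) hz))
    have hder : HasDerivAt (fun ζ : ℂ => U (z + ζ • w)) (fderiv ℂ U z w) 0 := by
      have h1 : HasDerivAt (fun ζ : ℂ => z + ζ • w) w 0 := by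
        simpa using ((hasDerivAt_id (0:ℂ)).smul_const w).const_add z
      have h2 : HasFDerivAt U (fderiv ℂ U z) (z + (0:ℂ) • w) := by simpa using hda.hasFDerivAt
      exact h2.comp_hasDerivAt (0:ℂ) h1
    rw [← hder.deriv]
    have hd : DifferentiableOn ℂ (fun ζ : ℂ => U (z + ζ • w)) (closedBall 0 ρ) := by
      refine hUd.comp (by fun_prop) ?_
      intro ζ hζ
      exact key z hz ζ (by simpa using hζ)
    have hd' : DiffContOnCl ℂ (fun ζ : ℂ => U (z + ζ • w)) (ball 0 ρ) :=
      DifferentiableOn.diffContOnCl (by rwa [closure_ball _ hρ0.ne'])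
    have := hd'.deriv_eq_smul_circleIntegral hρ0
    rw [eq_inv_smul_iff₀ (by simp [Real.pi_ne_zero]), ← this]
    congr 1
    funext ζ
    simp
  have hd : DifferentiableAt ℂ (fun z => (2 * Real.pi * Complex.I : ℂ)⁻¹ • ∮ ζ in C(0, ρ), (ζ - 0)⁻¹ ^ 2 • U (z + ζ • w)) z0 := by
    refine DifferentiableAt.fun_const_smul ?_ _
    unfold circleIntegral
    simp_rw [intervalIntegral.integral_of_le Real.two_pi_pos.le]
    have hcm : ∀ θ, ‖circleMap 0 ρ θ‖ ≤ ρ := by intro θ; simp [abs_of_pos hρ0]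
    refine par_diff (R := R/4) (bound := fun _ => ρ * ((ρ⁻¹)^2 * B)) (by positivity) ?_ ?_ ?_ ?_
    · exact integrableOn_const (by rw [Real.volume_Ioc]; exact ENNReal.ofReal_ne_top)
    · refine Filter.Eventually.of_forall fun θ => ?_
      refine DifferentiableOn.fun_const_smul ?_ _
      refine DifferentiableOn.fun_const_smul ?_ _
      refine hUd.comp (by fun_prop) ?_
      intro z hz
      exact key z hz _ (hcm θ)
    · refine Filter.Eventually.of_forall fun θ z hz => ?_
      rw [norm_smul, norm_smul, deriv_circleMap]
      have h1 := hB _ (key z hz _ (hcm θ))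
      simp only [norm_mul, norm_circleMap_zero, Complex.norm_I, mul_one, abs_of_pos hρ0, sub_zero, norm_pow, norm_inv]
      gcongr
    · intro z hz
      refine Continuous.aestronglyMeasurable ?_
      have hc : Continuous fun θ => U (z + circleMap 0 ρ θ • w) := by
        refine hUd.continuousOn.comp_continuous (by fun_prop) ?_
        intro θ; exact key z hz _ (hcm θ)
      simp only [deriv_circleMap]
      have h3 : Continuous fun θ => (circleMap 0 ρ θ - 0)⁻¹ := by
        refine Continuous.inv₀ (by fun_prop) ?_
        intro θ; simpa using circleMap_ne_center (c := 0) (θ := θ) hρ0.ne'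
      exact (by fun_prop : Continuous fun θ => circleMap 0 ρ θ * Complex.I).smul ((h3.pow 2).smul hc)
  refine (hd.congr_of_eventuallyEq ?_).differentiableWithinAt
  filter_upwards [ball_mem_nhds z0 (show 0 < R/4 by positivity)] with z hz using hform z hz

end SSM

namespace SSM

/-! ### One variable lemmas -/

lemma dslope_fac {f : ℂ → ℂ} {U : Set ℂ} (hU : IsOpen U) (hf : DifferentiableOn ℂ f U) {z : ℂ}
    (hz : z ∈ U) (hfz : f z = 0) :
    DifferentiableOn ℂ (dslope f z) U ∧ ∀ t, f t = (t - z) * dslope f z t := by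
  refine ⟨(Complex.differentiableOn_dslope (hU.mem_nhds hz)).mpr hf, fun t => ?_⟩
  have := sub_smul_dslope f z t
  rw [hfz, sub_zero, smul_eq_mul] at this
  exact this.symm

lemma div_finset {U : Set ℂ} (hU : IsOpen U) (Z : Finset ℂ) : ∀ {f : ℂ → ℂ},
    DifferentiableOn ℂ f U → (∀ z ∈ Z, z ∈ U ∧ f z = 0) →
    ∃ h, DifferentiableOn ℂ h U ∧ ∀ t, f t = (∏ z ∈ Z, (t - z)) * h t := by
  classical
  induction Z using Finset.induction_on with
  | empty => intro f hf _; exact ⟨f, hf, by simp⟩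
  | insert a Z ha ih =>
    intro f hf hz
    obtain ⟨hd, hfac⟩ := dslope_fac hU hf (hz a (by simp)).1 (hz a (by simp)).2
    obtain ⟨h, hh, hh2⟩ := ih hd (by
      intro z hzZ
      refine ⟨(hz z (by simp [hzZ])).1, ?_⟩
      have h1 := (hz z (by simp [hzZ])).2
      rw [hfac] at h1
      rcases mul_eq_zero.mp h1 with h2 | h2
      · exfalso; rw [sub_eq_zero] at h2; rw [h2] at hzZ; exact ha hzZ
      · exact h2)
    refine ⟨h, hh, fun t => ?_⟩
    rw [hfac, hh2, Finset.prod_insert ha]; ring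

lemma zero_count {D : ℂ → ℂ} {M δ : ℝ} (hD : DifferentiableOn ℂ D (ball 0 1))
    (hM : ∀ z ∈ ball (0:ℂ) 1, ‖D z‖ ≤ M) (hδ : δ ≤ ‖D (1/8)‖) (Z : Finset ℂ)
    (hZ : ∀ z ∈ Z, ‖z‖ ≤ 1/8 ∧ D z = 0) : δ ≤ M * (2/5)^Z.card := by
  obtain ⟨h, hh, hfac⟩ := div_finset isOpen_ball Z hD (by
    intro z hz
    obtain ⟨h1, h2⟩ := hZ z hz
    refine ⟨?_, h2⟩
    rw [mem_ball_zero_iff]; linarith)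
  have hM0 : 0 ≤ M := (norm_nonneg _).trans (hM 0 (by simp))
  have hsub : closedBall (0:ℂ) (3/4) ⊆ ball 0 1 := closedBall_subset_ball (by norm_num)
  have hbd : ∀ z ∈ frontier (ball (0:ℂ) (3/4)), ‖h z‖ ≤ M / (5/8)^Z.card := by
    intro z hz
    rw [frontier_ball _ (by norm_num), mem_sphere_zero_iff_norm] at hz
    have h1 : (5/8:ℝ)^Z.card ≤ ‖∏ w ∈ Z, (z - w)‖ := by
      rw [norm_prod, ← Finset.prod_const]
      refine Finset.prod_le_prod (by intros; norm_num) ?_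
      intro w hw
      have := norm_sub_norm_le z w
      have := (hZ w hw).1
      linarith
    have h2 := hM z (hsub (by simp [hz]))
    rw [hfac, norm_mul] at h2
    rw [le_div_iff₀ (by positivity), mul_comm]
    exact (mul_le_mul_of_nonneg_right h1 (norm_nonneg _)).trans h2
  have hin : ‖h (1/8)‖ ≤ M / (5/8)^Z.card := by
    refine Complex.norm_le_of_forall_mem_frontier_norm_le isBounded_ball
      (DifferentiableOn.diffContOnCl (hh.mono ?_)) hbd ?_
    · rw [closure_ball _ (by norm_num)]; exact hsub
    · rw [closure_ball _ (by norm_num)]; simp; norm_num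
  have h3 : ‖∏ w ∈ Z, ((1/8:ℂ) - w)‖ ≤ (1/4:ℝ)^Z.card := by
    rw [norm_prod, ← Finset.prod_const]
    refine Finset.prod_le_prod (by intros; positivity) ?_
    intro w hw
    have h1 := norm_sub_le (1/8:ℂ) w
    have h2 := (hZ w hw).1
    have h3 : ‖(1/8:ℂ)‖ = 1/8 := by norm_num
    linarith
  calc δ ≤ ‖D (1/8)‖ := hδ
    _ = ‖∏ w ∈ Z, ((1/8:ℂ) - w)‖ * ‖h (1/8)‖ := by rw [hfac, norm_mul]
    _ ≤ (1/4:ℝ)^Z.card * (M / (5/8)^Z.card) := by gcongr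
    _ = M * (2/5)^Z.card := by
      rw [show (2/5:ℝ) = (1/4)/(5/8) by norm_num, div_pow ((1:ℝ)/4) (5/8)]; field_simp

lemma zero_count' {M δ : ℝ} (hδ : 0 < δ) : ∃ K : ℕ, ∀ D : ℂ → ℂ,
    DifferentiableOn ℂ D (ball 0 1) → (∀ z ∈ ball (0:ℂ) 1, ‖D z‖ ≤ M) → δ ≤ ‖D (1/8)‖ →
    ∀ Z : Finset ℂ, (∀ z ∈ Z, ‖z‖ ≤ 1/8 ∧ D z = 0) → Z.card ≤ K := by
  have hl : Filter.Tendsto (fun n : ℕ => M * (2/5:ℝ)^n) Filter.atTop (nhds 0) := by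
    simpa using (tendsto_pow_atTop_nhds_zero_of_lt_one (r := (2/5:ℝ)) (by norm_num) (by norm_num)).const_mul M
  obtain ⟨K, hK⟩ := Filter.eventually_atTop.mp (hl.eventually (gt_mem_nhds hδ))
  refine ⟨K, fun D h1 h2 h3 Z hZ => ?_⟩
  by_contra hc
  push Not at hc
  have := hK Z.card hc.le
  have := zero_count h1 h2 h3 Z hZ
  linarith

lemma single_zero {U : Set ℂ} (hU : IsOpen U) {z : ℂ} (hz : z ∈ U) (k : ℕ) : ∀ {f : ℂ → ℂ},
    DifferentiableOn ℂ f U → analyticOrderAt f z = k →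
    ∃ g, DifferentiableOn ℂ g U ∧ g z ≠ 0 ∧ ∀ t, f t = (t - z)^k * g t := by
  induction k with
  | zero =>
    intro f hf ho
    refine ⟨f, hf, ?_, by simp⟩
    have := (hf.analyticAt (hU.mem_nhds hz)).analyticOrderAt_eq_zero.mp (by simpa using ho)
    exact this
  | succ k ih =>
    intro f hf ho
    have ha := hf.analyticAt (hU.mem_nhds hz)
    have hfz : f z = 0 := by
      by_contra hc
      rw [ha.analyticOrderAt_eq_zero.mpr hc] at ho
      exact absurd ho.symm (by norm_cast)
    obtain ⟨hd, hfac⟩ := dslope_fac hU hf hz hfz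
    have ha' := hd.analyticAt (hU.mem_nhds hz)
    have heq : f = (fun t => t - z) * dslope f z := by funext t; exact hfac t
    have hlin : analyticOrderAt (fun t : ℂ => t - z) z = 1 := by
      have := (AnalyticAt.analyticOrderAt_eq_natCast (f := fun t : ℂ => t - z) (z₀ := z) (n := 1) (by fun_prop)).mpr
        ⟨fun _ => 1, by fun_prop, by simp, by simp⟩
      simpa using this
    have ho' : analyticOrderAt (dslope f z) z = k := by
      rw [heq, analyticOrderAt_mul (by fun_prop) ha', hlin] at ho
      push_cast at ho
      rw [add_comm] at ho
      exact (ENat.add_left_injective_of_ne_top (n := 1) (by simp)) (by simpa using ho)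
    obtain ⟨g, hg, hg0, hgf⟩ := ih hd ho'
    refine ⟨g, hg, hg0, fun t => ?_⟩
    rw [hfac, hgf]; ring

lemma zeros_finite {f : ℂ → ℂ} (hf : DifferentiableOn ℂ f (ball 0 2))
    (hs : ∀ z ∈ sphere (0:ℂ) 1, f z ≠ 0) : {z ∈ closedBall (0:ℂ) 1 | f z = 0}.Finite := by
  by_contra hc
  obtain ⟨x, hx, hacc⟩ := Set.Infinite.exists_accPt_of_subset_isCompact hc
    (isCompact_closedBall (0:ℂ) 1) (fun z hz => hz.1)
  have han := hf.analyticOnNhd isOpen_ball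
  have hfr : ∃ᶠ z in nhdsWithin x {x}ᶜ, f z = 0 := by
    rw [accPt_iff_frequently_nhdsNE] at hacc
    exact hacc.mono fun z hz => hz.2
  have := han.eqOn_zero_of_preconnected_of_frequently_eq_zero (convex_ball _ _).isPreconnected
    (closedBall_subset_ball (by norm_num) hx) hfr
  exact hs 1 (by simp) (this (by simp))

lemma factor_zeros (n : ℕ) : ∀ {f : ℂ → ℂ}, DifferentiableOn ℂ f (ball 0 2) →
    (∀ z ∈ sphere (0:ℂ) 1, f z ≠ 0) → {z ∈ closedBall (0:ℂ) 1 | f z = 0}.ncard = n →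
    ∃ (T : List ℂ) (h : ℂ → ℂ), DifferentiableOn ℂ h (ball 0 2) ∧
      (∀ z ∈ closedBall (0:ℂ) 1, h z ≠ 0) ∧ (∀ t ∈ T, ‖t‖ < 1) ∧
      ∀ t, f t = (T.map (fun w => t - w)).prod * h t := by
  induction n with
  | zero =>
    intro f hf hs hc
    rw [Set.ncard_eq_zero (zeros_finite hf hs)] at hc
    refine ⟨[], f, hf, fun z hz h0 => ?_, by simp, by simp⟩
    have : z ∈ {z ∈ closedBall (0:ℂ) 1 | f z = 0} := ⟨hz, h0⟩
    rw [hc] at this; exact this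
  | succ n ih =>
    intro f hf hs hc
    have hne : {z ∈ closedBall (0:ℂ) 1 | f z = 0}.Nonempty := by
      apply Set.nonempty_of_ncard_ne_zero; omega
    obtain ⟨z, hz, hfz⟩ := hne
    have hzU : z ∈ ball (0:ℂ) 2 := closedBall_subset_ball (by norm_num) hz
    have han := hf.analyticOnNhd isOpen_ball
    have hnt : analyticOrderAt f z ≠ ⊤ := by
      intro ht
      rw [analyticOrderAt_eq_top] at ht
      have := han.eqOn_zero_of_preconnected_of_eventuallyEq_zero (convex_ball _ _).isPreconnected hzU ht
      exact hs 1 (by simp) (this (by simp))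
    obtain ⟨k, hk⟩ := ENat.ne_top_iff_exists.mp hnt
    obtain ⟨g, hg, hg0, hfac⟩ := single_zero isOpen_ball hzU k hf hk.symm
    have hk0 : k ≠ 0 := by
      rintro rfl
      rw [hfac] at hfz; simp [hg0] at hfz
    have hgs : ∀ z ∈ sphere (0:ℂ) 1, g z ≠ 0 := by
      intro w hw h0; apply hs w hw; rw [hfac, h0, mul_zero]
    have hz1 : ‖z‖ < 1 := by
      have h1 : ‖z‖ ≤ 1 := by simpa using hz
      refine lt_of_le_of_ne h1 fun h => hs z (by simp [h]) hfz
    have hset : {w ∈ closedBall (0:ℂ) 1 | g w = 0} = {w ∈ closedBall (0:ℂ) 1 | f w = 0} \ {z} := by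
      ext w
      simp only [mem_ofPred_eq, mem_sdiff, mem_singleton_iff]
      constructor
      · rintro ⟨h1, h2⟩
        refine ⟨⟨h1, by rw [hfac, h2, mul_zero]⟩, ?_⟩
        rintro rfl; exact hg0 h2
      · rintro ⟨⟨h1, h2⟩, h3⟩
        refine ⟨h1, ?_⟩
        rw [hfac] at h2
        rcases mul_eq_zero.mp h2 with h4 | h4
        · exact absurd (sub_eq_zero.mp (pow_eq_zero_iff hk0 |>.mp h4)) h3
        · exact h4
    obtain ⟨T, h, hh, hh0, hT, hTf⟩ := ih hg hgs (by
      have hmem : z ∈ {w ∈ closedBall (0:ℂ) 1 | f w = 0} := ⟨hz, hfz⟩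
      rw [hset, Set.ncard_sdiff_singleton_of_mem hmem, hc]; rfl)
    refine ⟨List.replicate k z ++ T, h, hh, hh0, ?_, ?_⟩
    · intro t ht
      rcases List.mem_append.mp ht with h1 | h1
      · rw [List.eq_of_mem_replicate h1]; exact hz1
      · exact hT t h1
    · intro t
      rw [hfac, hTf]; simp [mul_assoc]

/-- power sums of zeros -/
def psum (k : ℕ) (f : ℂ → ℂ) : ℂ :=
  (2 * Real.pi * Complex.I : ℂ)⁻¹ • ∮ t in C(0, 1), t^k * (deriv f t / f t)

lemma psum_nonvanish (k : ℕ) {f : ℂ → ℂ} (hf : DifferentiableOn ℂ f (ball 0 2))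
    (h0 : ∀ z ∈ closedBall (0:ℂ) 1, f z ≠ 0) : psum k f = 0 := by
  unfold psum
  have hdd : DifferentiableOn ℂ (fun t => t^k * (deriv f t / f t)) (closedBall 0 1) := by
    have h1 : DifferentiableOn ℂ (deriv f) (ball 0 2) := hf.deriv isOpen_ball
    have hsub : closedBall (0:ℂ) 1 ⊆ ball 0 2 := closedBall_subset_ball (by norm_num)
    exact (by fun_prop : DifferentiableOn ℂ (fun t : ℂ => t^k) (closedBall 0 1)).mul
      ((h1.mono hsub).div (hf.mono hsub) h0)
  have : (∮ t in C(0, 1), t^k * (deriv f t / f t)) = 0 := by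
    refine Complex.circleIntegral_eq_zero_of_differentiable_on_off_countable (by norm_num)
      countable_empty hdd.continuousOn ?_
    intro z hz
    exact (hdd z (ball_subset_closedBall hz.1)).differentiableAt
      (closedBall_mem_nhds_of_mem hz.1)
  rw [this, smul_zero]

lemma psum_mul (k : ℕ) {f g : ℂ → ℂ} {z : ℂ} (hz : ‖z‖ < 1) (hg : DifferentiableOn ℂ g (ball 0 2))
    (hgs : ∀ t ∈ sphere (0:ℂ) 1, g t ≠ 0) (hfac : ∀ t, f t = (t - z) * g t) :
    psum k f = z^k + psum k g := by
  have hsub : sphere (0:ℂ) 1 ⊆ ball 0 2 := sphere_subset_closedBall.trans (closedBall_subset_ball (by norm_num))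
  have hne : ∀ t ∈ sphere (0:ℂ) 1, t - z ≠ 0 := by
    intro t ht h
    rw [sub_eq_zero] at h; rw [mem_sphere_zero_iff_norm, h] at ht; linarith
  have h1 : (∮ t in C(0, 1), t^k * (deriv f t / f t)) =
      ∮ t in C(0, 1), (t^k / (t - z) + t^k * (deriv g t / g t)) := by
    apply circleIntegral.integral_congr (by norm_num)
    intro t ht
    have hgd : DifferentiableAt ℂ g t := (hg t (hsub ht)).differentiableAt (isOpen_ball.mem_nhds (hsub ht))
    have hd : deriv f t = g t + (t - z) * deriv g t := by
      have : f = fun t => (t - z) * g t := funext hfac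
      rw [this, deriv_fun_mul (by fun_prop) hgd]; simp
    have hz' := hne t ht
    have hg' := hgs t ht
    simp only [hd, hfac t]
    field_simp
  have hgd : DifferentiableOn ℂ (deriv g) (ball 0 2) := hg.deriv isOpen_ball
  have hc1 : CircleIntegrable (fun t => t^k / (t - z)) 0 1 := by
    apply ContinuousOn.circleIntegrable (by norm_num)
    exact ContinuousOn.div (by fun_prop) (by fun_prop) hne
  have hc2 : CircleIntegrable (fun t => t^k * (deriv g t / g t)) 0 1 := by
    apply ContinuousOn.circleIntegrable (by norm_num)
    exact ContinuousOn.mul (by fun_prop) (ContinuousOn.div (hgd.continuousOn.mono hsub) (hg.continuousOn.mono hsub) hgs)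
  have h2 : (∮ t in C(0, 1), t^k / (t - z)) = 2 * Real.pi * Complex.I * z^k :=
    Complex.circleIntegral_div_sub_of_differentiable_on_off_countable countable_empty
      (by simpa using hz) (by fun_prop) (by intro t _; fun_prop)
  unfold psum
  rw [h1, circleIntegral.integral_add hc1 hc2, h2, smul_add]
  congr 1
  rw [smul_eq_mul, ← mul_assoc, inv_mul_cancel₀ (by simp [Real.pi_ne_zero]), one_mul]

lemma list_prod_ne {T : List ℂ} {t : ℂ} (h : t ∉ T) : (T.map (fun w => t - w)).prod ≠ 0 := by
  rw [Ne, List.prod_eq_zero_iff]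
  intro hc
  obtain ⟨w, hw, h0⟩ := List.mem_map.mp hc
  rw [sub_eq_zero] at h0; exact h (h0 ▸ hw)

lemma psum_list (k : ℕ) (T : List ℂ) : ∀ {f h : ℂ → ℂ}, DifferentiableOn ℂ h (ball 0 2) →
      (∀ z ∈ closedBall (0:ℂ) 1, h z ≠ 0) → (∀ t ∈ T, ‖t‖ < 1) →
      (∀ t, f t = (T.map (fun w => t - w)).prod * h t) → psum k f = (T.map (· ^ k)).sum := by
  induction T with
  | nil =>
    intro f h hh h0 _ hf
    have : f = h := by funext t; simp [hf t]
    rw [this, psum_nonvanish k hh h0]; simp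
  | cons a T ih =>
    intro f h hh h0 hT hf
    have hg : DifferentiableOn ℂ (fun t => (T.map (fun w => t - w)).prod * h t) (ball 0 2) := by
      refine DifferentiableOn.mul ?_ hh
      clear ih hf hT
      induction T with
      | nil => simp
      | cons b T ihT =>
        simp only [List.map_cons, List.prod_cons]
        exact DifferentiableOn.mul (by fun_prop) ihT
    rw [psum_mul k (g := fun t => (T.map (fun w => t - w)).prod * h t) (z := a) (hT a (by simp)) hg]
    · rw [ih hh h0 (fun t ht => hT t (by simp [ht])) (fun t => rfl)]; simp
    · intro t ht
      refine mul_ne_zero (list_prod_ne ?_) (h0 t (sphere_subset_closedBall ht))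
      intro hmem
      have := hT t (by simp [hmem])
      rw [mem_sphere_zero_iff_norm] at ht; linarith
    · intro t; rw [hf]; simp [mul_assoc]

lemma double_zero {f h : ℂ → ℂ} {T : List ℂ} (hh : DifferentiableOn ℂ h (ball 0 2))
    (h0 : ∀ z ∈ closedBall (0:ℂ) 1, h z ≠ 0) (hT : T.Nodup)
    (hf : ∀ t, f t = (T.map (fun w => t - w)).prod * h t) {z : ℂ} (hz : ‖z‖ < 1) (hfz : f z = 0) :
    z ∈ T ∧ deriv f z ≠ 0 := by
  classical
  have hzT : z ∈ T := by
    by_contra hc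
    rw [hf] at hfz
    exact mul_ne_zero (list_prod_ne hc) (h0 z (by simpa using hz.le)) hfz
  refine ⟨hzT, ?_⟩
  have hperm := List.perm_cons_erase hzT
  set T' := T.erase z with hT'
  have hnd : z ∉ T' := by
    have := hperm.nodup_iff.mp hT
    exact (List.nodup_cons.mp this).1
  have hfe : f = fun t => (t - z) * ((T'.map (fun w => t - w)).prod * h t) := by
    funext t
    rw [hf, (hperm.map _).prod_eq]; simp [mul_assoc]
  have hzU : z ∈ ball (0:ℂ) 2 := by simp; linarith
  have hg : DifferentiableAt ℂ (fun t => (T'.map (fun w => t - w)).prod * h t) z := by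
    refine DifferentiableAt.mul ?_ ((hh z hzU).differentiableAt (isOpen_ball.mem_nhds hzU))
    clear hfe hnd hperm hT'
    induction T' with
    | nil => simp
    | cons b T ihT =>
      simp only [List.map_cons, List.prod_cons]
      exact DifferentiableAt.mul (by fun_prop) ihT
  rw [hfe, deriv_fun_mul (by fun_prop) hg]
  simp only [deriv_sub_const_fun, deriv_id'', one_mul, sub_self, zero_mul, add_zero]
  exact mul_ne_zero (list_prod_ne hnd) (h0 z (by simpa using hz.le))

/-- Hankel determinant of power sums vanishes iff there are repeated entries. -/
lemma hankel_det {m : ℕ} (t : Fin m → ℂ) :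
    (Matrix.of fun i j : Fin m => ∑ r, t r ^ ((i:ℕ) + (j:ℕ))).det = (Matrix.vandermonde t).det ^ 2 := by
  have : (Matrix.of fun i j : Fin m => ∑ r, t r ^ ((i:ℕ) + (j:ℕ))) =
      (Matrix.vandermonde t).transpose * Matrix.vandermonde t := by
    ext i j
    simp [Matrix.mul_apply, Matrix.vandermonde_apply, pow_add]
  rw [this, Matrix.det_mul, Matrix.det_transpose, sq]

end SSM

namespace SSM

lemma psum_close (k : ℕ) {f p : ℂ → ℂ} {ε M β : ℝ} (hf : DifferentiableOn ℂ f (ball 0 2))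
    (hp : DifferentiableOn ℂ p (ball 0 2)) (hε : 0 ≤ ε) (hβ : 0 < β) (hεβ : ε ≤ β)
    (hfp : ∀ t ∈ ball (0:ℂ) 2, ‖f t - p t‖ ≤ ε) (hM : ∀ t ∈ ball (0:ℂ) 2, ‖p t‖ ≤ M)
    (hlow : ∀ t ∈ sphere (0:ℂ) 1, 2 * β ≤ ‖p t‖) :
    ‖psum k f - psum k p‖ ≤ 2 * M * ε / β^2 := by
  have hsub : sphere (0:ℂ) 1 ⊆ ball 0 2 := sphere_subset_closedBall.trans (closedBall_subset_ball (by norm_num))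
  have hM0 : 0 ≤ M := (norm_nonneg _).trans (hM 0 (by simp))
  have hflow : ∀ t ∈ sphere (0:ℂ) 1, β ≤ ‖f t‖ := by
    intro t ht
    have h1 := hlow t ht
    have h2 := hfp t (hsub ht)
    have h3 := norm_sub_norm_le (p t) (f t)
    rw [norm_sub_rev] at h2
    linarith
  have hfs : ∀ t ∈ sphere (0:ℂ) 1, f t ≠ 0 := by
    intro t ht h; have := hflow t ht; rw [h, norm_zero] at this; linarith
  have hps : ∀ t ∈ sphere (0:ℂ) 1, p t ≠ 0 := by
    intro t ht h; have := hlow t ht; rw [h, norm_zero] at this; linarith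
  have hc : ∀ {g : ℂ → ℂ}, DifferentiableOn ℂ g (ball 0 2) → (∀ t ∈ sphere (0:ℂ) 1, g t ≠ 0) →
      CircleIntegrable (fun t => t^k * (deriv g t / g t)) 0 1 := by
    intro g hg hgs
    have hgd : DifferentiableOn ℂ (deriv g) (ball 0 2) := hg.deriv isOpen_ball
    apply ContinuousOn.circleIntegrable (by norm_num)
    exact ContinuousOn.mul (by fun_prop) (ContinuousOn.div (hgd.continuousOn.mono hsub) (hg.continuousOn.mono hsub) hgs)
  unfold psum
  rw [← smul_sub, ← circleIntegral.integral_sub (hc hf hfs) (hc hp hps)]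
  refine (circleIntegral.norm_two_pi_i_inv_smul_integral_le_of_norm_le_const (C := 2 * M * ε / β^2) (by norm_num) ?_).trans
    (by simp)
  intro t ht
  have ht1 : ‖t‖ = 1 := by simpa using ht
  have hbs : ball t 1 ⊆ ball 0 2 := by
    apply ball_subset_ball'; rw [dist_zero_right, ht1]; norm_num
  have hda : ∀ {g : ℂ → ℂ}, DifferentiableOn ℂ g (ball 0 2) → DifferentiableAt ℂ g t := fun hg =>
    (hg t (hsub ht)).differentiableAt (isOpen_ball.mem_nhds (hsub ht))
  have h1 : ‖deriv f t - deriv p t‖ ≤ 2 * ε := by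
    rw [← deriv_fun_sub (hda hf) (hda hp)]
    have := cauchy_deriv_bound (f := fun t => f t - p t) (R := 1) (B := ε) (c := t) (by norm_num)
      ((hf.sub hp).mono hbs) (fun z hz => hfp z (hbs hz))
    simpa using this
  have h2 : ‖deriv p t‖ ≤ 2 * M := by
    have := cauchy_deriv_bound (f := p) (R := 1) (B := M) (c := t) (by norm_num)
      (hp.mono hbs) (fun z hz => hM z (hbs hz))
    simpa using this
  have h3 : deriv f t / f t - deriv p t / p t =
      ((deriv f t - deriv p t) * p t - deriv p t * (f t - p t)) / (f t * p t) := by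
    have := hfs t ht
    have := hps t ht
    field_simp
    ring
  rw [← mul_sub, norm_mul, norm_pow, ht1, one_pow, one_mul, h3, norm_div, norm_mul]
  have h4 : ‖(deriv f t - deriv p t) * p t - deriv p t * (f t - p t)‖ ≤ 2 * ε * M + 2 * M * ε := by
    refine (norm_sub_le _ _).trans ?_
    rw [norm_mul, norm_mul]
    have := hM t (hsub ht)
    have := hfp t (hsub ht)
    gcongr
  have h5 : 2 * β^2 ≤ ‖f t‖ * ‖p t‖ := by
    have := hflow t ht
    have := hlow t ht
    nlinarith [norm_nonneg (f t)]
  rw [div_le_div_iff₀ (by nlinarith [sq_pos_of_pos hβ]) (by positivity)]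
  calc _ ≤ (2 * ε * M + 2 * M * ε) * β^2 := by gcongr
    _ = 2 * M * ε * (2 * β^2) := by ring
    _ ≤ _ := by gcongr

lemma deriv_slice {F : ℂ × ℂ → ℂ} (hF : DifferentiableOn ℂ F (ball 0 2)) {z : ℂ × ℂ}
    (hz : z ∈ ball (0 : ℂ × ℂ) 2) : deriv (fun t => F (z.1, t)) z.2 = fderiv ℂ F z (0, 1) := by
  have hda : DifferentiableAt ℂ F z := (hF z hz).differentiableAt (isOpen_ball.mem_nhds hz)
  have h1 : HasDerivAt (fun t : ℂ => (z.1, t)) ((0:ℂ), (1:ℂ)) z.2 :=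
    (hasDerivAt_const _ _).prodMk (hasDerivAt_id _)
  exact (HasFDerivAt.comp_hasDerivAt (x := z.2) (f := fun t : ℂ => (z.1, t)) hda.hasFDerivAt h1).deriv

lemma mem_ball2 {s t : ℂ} (hs : ‖s‖ < 2) (ht : ‖t‖ < 2) : (s, t) ∈ ball (0 : ℂ × ℂ) 2 := by
  rw [mem_ball_zero_iff, Prod.norm_def]; exact max_lt hs ht

lemma slice_diff {F : ℂ × ℂ → ℂ} (hF : DifferentiableOn ℂ F (ball 0 2)) {s : ℂ} (hs : ‖s‖ < 2) :
    DifferentiableOn ℂ (fun t => F (s, t)) (ball 0 2) := by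
  refine hF.comp (by fun_prop) ?_
  intro t ht
  exact mem_ball2 hs (by simpa using ht)

lemma psum_holo (k : ℕ) {F : ℂ × ℂ → ℂ} {M β : ℝ} (hβ : 0 < β) (hF : DifferentiableOn ℂ F (ball 0 2))
    (hM : ∀ z ∈ ball (0:ℂ × ℂ) 2, ‖F z‖ ≤ M) (hlow : ∀ s t : ℂ, ‖s‖ < 1 → ‖t‖ = 1 → β ≤ ‖F (s, t)‖) :
    DifferentiableOn ℂ (fun s => psum k (fun t => F (s, t))) (ball 0 1) := by
  intro s0 hs0
  refine DifferentiableAt.differentiableWithinAt ?_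
  have hs0' : ‖s0‖ < 1 := by simpa using hs0
  have hM0 : 0 ≤ M := (norm_nonneg _).trans (hM 0 (by simp))
  have hcm : ∀ θ, ‖circleMap 0 1 θ‖ = 1 := by intro θ; simp
  have hbs : ∀ s ∈ ball s0 (1 - ‖s0‖), ‖s‖ < 1 := by
    intro s hs
    rw [mem_ball, dist_eq_norm] at hs
    have := norm_sub_norm_le s s0
    linarith
  have hFt : DifferentiableOn ℂ (fun z => fderiv ℂ F z (0, 1)) (ball 0 2) :=
    diff_fderiv_apply isOpen_ball hF _
  have hder : ∀ s t : ℂ, ‖s‖ < 1 → ‖t‖ = 1 → deriv (fun t => F (s, t)) t = fderiv ℂ F (s, t) (0, 1) := by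
    intro s t hs ht
    exact deriv_slice (z := (s, t)) hF (mem_ball2 (by linarith) (by linarith))
  unfold psum
  refine DifferentiableAt.fun_const_smul ?_ _
  unfold circleIntegral
  simp_rw [intervalIntegral.integral_of_le Real.two_pi_pos.le]
  have hcongr : ∀ s : ℂ, ‖s‖ < 1 → ∀ θ : ℝ, deriv (circleMap 0 1) θ • (circleMap 0 1 θ ^ k *
      (deriv (fun t => F (s, t)) (circleMap 0 1 θ) / F (s, circleMap 0 1 θ))) =
      deriv (circleMap 0 1) θ • (circleMap 0 1 θ ^ k *
      (fderiv ℂ F (s, circleMap 0 1 θ) (0, 1) / F (s, circleMap 0 1 θ))) := by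
    intro s hs θ
    rw [hder s _ hs (hcm θ)]
  have hne : ∀ s : ℂ, ‖s‖ < 1 → ∀ θ, F (s, circleMap 0 1 θ) ≠ 0 := by
    intro s hs θ h
    have := hlow s _ hs (hcm θ)
    rw [h, norm_zero] at this; linarith
  refine par_diff (R := 1 - ‖s0‖) (bound := fun _ => 2 * M / β) (by linarith) ?_ ?_ ?_ ?_
  · exact integrableOn_const (by rw [Real.volume_Ioc]; exact ENNReal.ofReal_ne_top)
  · refine Filter.Eventually.of_forall fun θ => ?_
    have hmaps : MapsTo (fun s : ℂ => (s, circleMap 0 1 θ)) (ball s0 (1 - ‖s0‖)) (ball 0 2) := by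
      intro s hs
      exact mem_ball2 (by linarith [hbs s hs]) (by rw [hcm]; norm_num)
    refine DifferentiableOn.congr (f := fun s => deriv (circleMap 0 1) θ • (circleMap 0 1 θ ^ k *
      (fderiv ℂ F (s, circleMap 0 1 θ) (0, 1) / F (s, circleMap 0 1 θ)))) ?_ (fun s hs => hcongr s (hbs s hs) θ)
    refine DifferentiableOn.fun_const_smul ?_ _
    refine DifferentiableOn.const_mul ?_ _
    refine DifferentiableOn.fun_div ?_ ?_ ?_
    · exact hFt.comp (t := ball 0 2) (f := fun s : ℂ => (s, circleMap 0 1 θ)) (by fun_prop) hmaps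
    · exact hF.comp (f := fun s : ℂ => (s, circleMap 0 1 θ)) (by fun_prop) hmaps
    · intro s hs; exact hne s (hbs s hs) θ
  · refine Filter.Eventually.of_forall fun θ s hs => ?_
    have h1 := hlow s _ (hbs s hs) (hcm θ)
    have h2 : ‖deriv (fun t => F (s, t)) (circleMap 0 1 θ)‖ ≤ 2 * M := by
      have hsb : ball (circleMap 0 1 θ) 1 ⊆ ball 0 2 := by
        apply ball_subset_ball'; rw [dist_zero_right, hcm]; norm_num
      have := cauchy_deriv_bound (f := fun t => F (s, t)) (R := 1) (B := M) (c := circleMap 0 1 θ) (by norm_num)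
        ((slice_diff hF (by linarith [hbs s hs])).mono hsb) (fun z hz => hM _ (mem_ball2 (by linarith [hbs s hs]) (by simpa using hsb hz)))
      simpa using this
    rw [norm_smul, norm_mul, norm_pow, hcm, deriv_circleMap, norm_mul, hcm, Complex.norm_I, norm_div]
    simp only [one_pow, one_mul]
    gcongr
  · intro s hs
    refine Continuous.aestronglyMeasurable ?_
    have hs1 := hbs s hs
    have hmem : ∀ θ, (s, circleMap 0 1 θ) ∈ ball (0:ℂ × ℂ) 2 := fun θ => mem_ball2 (by linarith) (by rw [hcm]; norm_num)
    simp_rw [hcongr s hs1]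
    have hc1 : Continuous fun θ => fderiv ℂ F (s, circleMap 0 1 θ) (0, 1) :=
      hFt.continuousOn.comp_continuous (by fun_prop) hmem
    have hc2 : Continuous fun θ => F (s, circleMap 0 1 θ) :=
      hF.continuousOn.comp_continuous (by fun_prop) hmem
    simp only [deriv_circleMap]
    exact (by fun_prop : Continuous fun θ => circleMap 0 1 θ * Complex.I).smul
      ((by fun_prop : Continuous fun θ => circleMap 0 1 θ ^ k).mul (hc1.div hc2 (hne s hs1)))

theorem two_var_count {m : ℕ} (a : Fin m → ℂ) (ha : Function.Injective a) (ha2 : ∀ r, ‖a r‖ ≤ 1/2)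
    (c : ℂ) (hc : c ≠ 0) : ∃ ε : ℝ, 0 < ε ∧ ∃ K : ℕ, ∀ F : ℂ × ℂ → ℂ, DifferentiableOn ℂ F (ball 0 2) →
      (∀ z ∈ ball (0 : ℂ × ℂ) 2, ‖F z - c * ∏ r, (z.2 - a r * z.1)‖ ≤ ε) →
      ∀ Z : Finset (ℂ × ℂ), (∀ z ∈ Z, ‖z.1‖ ≤ 1/8 ∧ ‖z.2‖ < 1 ∧ F z = 0 ∧
        deriv (fun t => F (z.1, t)) z.2 = 0) → Z.card ≤ K := by
  classical
  set P : ℂ × ℂ → ℂ := fun z => c * ∏ r, (z.2 - a r * z.1) with hP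
  set M : ℝ := ‖c‖ * 3^m with hMdef
  set β : ℝ := ‖c‖ * (1/2)^m / 2 with hβdef
  have hc0 : 0 < ‖c‖ := norm_pos_iff.mpr hc
  have hβ : 0 < β := by positivity
  have hM0 : 0 < M := by positivity
  have hPM : ∀ z ∈ ball (0:ℂ × ℂ) 2, ‖P z‖ ≤ M := by
    intro z hz
    rw [mem_ball_zero_iff, Prod.norm_def, max_lt_iff] at hz
    simp only [hP, hMdef, norm_mul, norm_prod]
    gcongr
    refine (Finset.prod_le_prod (g := fun _ => (3:ℝ)) (by intros; positivity) ?_).trans (by simp)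
    intro r _
    calc ‖z.2 - a r * z.1‖ ≤ ‖z.2‖ + ‖a r‖ * ‖z.1‖ := by rw [← norm_mul]; exact norm_sub_le _ _
      _ ≤ 2 + 1/2 * 2 := by gcongr; exacts [hz.2.le, ha2 r, hz.1.le]
      _ = 3 := by norm_num
  have hPlow : ∀ s t : ℂ, ‖s‖ < 1 → ‖t‖ = 1 → 2 * β ≤ ‖P (s, t)‖ := by
    intro s t hs ht
    simp only [hP, hβdef, norm_mul, norm_prod]
    rw [mul_div_cancel₀ _ (by norm_num : (2:ℝ) ≠ 0)]
    gcongr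
    refine le_trans (by simp) (Finset.prod_le_prod (f := fun _ => (1/2:ℝ)) (by intros; positivity) ?_)
    intro r _
    have h1 := norm_sub_norm_le t (a r * s)
    rw [norm_mul] at h1
    have : ‖a r‖ * ‖s‖ ≤ 1/2 * 1 := by gcongr; exact ha2 r
    linarith
  have hPd : Differentiable ℂ P := by
    simp only [hP]; fun_prop
  have hPs : ∀ k, ∀ s : ℂ, ‖s‖ < 1 → psum k (fun t => P (s, t)) = ∑ r, (a r * s)^k := by
    intro k s hs
    rw [psum_list k (List.ofFn fun r => a r * s) (f := fun t => P (s, t)) (h := fun _ => c) (by fun_prop)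
      (fun _ _ => hc)]
    · simp [List.map_ofFn, List.sum_ofFn]
    · intro t ht
      obtain ⟨r, rfl⟩ := (List.mem_ofFn' _ _).mp ht
      simp only [norm_mul]
      have : ‖a r‖ * ‖s‖ ≤ 1/2 * 1 := by gcongr; exact ha2 r
      linarith
    · intro t
      simp [hP, List.map_ofFn, List.prod_ofFn, mul_comm]
  -- continuity of the determinant
  set H0 : Matrix (Fin m) (Fin m) ℂ := Matrix.of fun i j => ∑ r, (a r * (1/8:ℂ)) ^ ((i:ℕ) + (j:ℕ)) with hH0
  have hH0det : H0.det ≠ 0 := by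
    rw [hH0, hankel_det (fun r => a r * (1/8:ℂ))]
    refine pow_ne_zero _ (Matrix.det_vandermonde_ne_zero_iff.mpr ?_)
    intro r r' h
    exact ha (mul_right_cancel₀ (by norm_num) h)
  obtain ⟨ε1, hε1, hdet⟩ : ∃ ε1 > 0, ∀ H : Matrix (Fin m) (Fin m) ℂ, (∀ i j, ‖H i j - H0 i j‖ ≤ ε1) →
      ‖H0.det‖ / 2 ≤ ‖H.det‖ := by
    have hcont : Continuous fun H : Fin m → Fin m → ℂ => ‖(Matrix.of H).det‖ :=
      (Continuous.matrix_det (by exact continuous_id)).norm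
    have hlt : ‖H0.det‖ / 2 < ‖H0.det‖ := half_lt_self (norm_pos_iff.mpr hH0det)
    have hev := (hcont.tendsto (fun i j => H0 i j)).eventually (lt_mem_nhds (a := ‖H0.det‖/2) (by exact hlt))
    obtain ⟨ε1, hε1, hb⟩ := Metric.eventually_nhds_iff.mp hev
    refine ⟨ε1/2, by positivity, fun H hH => (hb (y := fun i j => H i j) ?_).le⟩
    refine lt_of_le_of_lt ?_ (half_lt_self hε1)
    rw [dist_pi_le_iff (by positivity)]
    intro i
    rw [dist_pi_le_iff (by positivity)]
    intro j
    rw [dist_eq_norm]; exact hH i j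
  obtain ⟨K, hK⟩ := zero_count' (M := (m.factorial : ℝ) * ((m:ℝ) + 1)^m) (δ := ‖H0.det‖ / 2) (by positivity)
  set ε : ℝ := min β (min (β^2 * (1/2) / (2 * M)) (β^2 * ε1 / (2 * M))) with hεdef
  have hε : 0 < ε := by rw [hεdef]; positivity
  refine ⟨ε, hε, m * K, fun F hF hFP Z hZ => ?_⟩
  have hεβ : ε ≤ β := min_le_left _ _
  have hclose : ∀ k, ∀ s : ℂ, ‖s‖ < 1 → ‖psum k (fun t => F (s, t)) - ∑ r, (a r * s)^k‖ ≤ min (1/2) ε1 := by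
    intro k s hs
    rw [← hPs k s hs]
    have h1 := psum_close k (f := fun t => F (s, t)) (p := fun t => P (s, t)) (slice_diff hF (by linarith))
      (slice_diff hPd.differentiableOn (by linarith)) hε.le hβ hεβ
      (fun t ht => hFP _ (mem_ball2 (by linarith) (by simpa using ht)))
      (fun t ht => hPM _ (mem_ball2 (by linarith) (by simpa using ht)))
      (fun t ht => hPlow s t hs (by simpa using ht))
    refine h1.trans (le_min ?_ ?_)
    · have : ε ≤ β^2 * (1/2) / (2 * M) := (min_le_right _ _).trans (min_le_left _ _)
      rw [div_le_iff₀ (by positivity)]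
      rw [le_div_iff₀ (by positivity)] at this
      linarith
    · have : ε ≤ β^2 * ε1 / (2 * M) := (min_le_right _ _).trans (min_le_right _ _)
      rw [div_le_iff₀ (by positivity)]
      rw [le_div_iff₀ (by positivity)] at this
      linarith
  have hFlow : ∀ s t : ℂ, ‖s‖ < 1 → ‖t‖ = 1 → β ≤ ‖F (s, t)‖ := by
    intro s t hs ht
    have h1 := hPlow s t hs ht
    have h2 := hFP (s, t) (mem_ball2 (by linarith) (by linarith))
    have h3 := norm_sub_norm_le (P (s, t)) (F (s, t))
    rw [norm_sub_rev] at h3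
    simp only [hP] at h1 h3 h2
    linarith
  have hFM : ∀ z ∈ ball (0:ℂ × ℂ) 2, ‖F z‖ ≤ M + ε := by
    intro z hz
    have h1 := hPM z hz
    have h2 := hFP z hz
    have h3 := norm_sub_norm_le (F z) (P z)
    simp only [hP] at h1 h3
    linarith
  set D : ℂ → ℂ := fun s => (Matrix.of fun i j : Fin m => psum ((i:ℕ) + (j:ℕ)) (fun t => F (s, t))).det with hD
  have hDd : DifferentiableOn ℂ D (ball 0 1) := by
    simp only [hD, Matrix.det_apply]
    refine DifferentiableOn.fun_sum fun σ _ => ?_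
    refine DifferentiableOn.fun_const_smul ?_ _
    refine DifferentiableOn.fun_finsetProd fun i _ => ?_
    exact psum_holo _ hβ hF hFM hFlow
  have hDM : ∀ z ∈ ball (0:ℂ) 1, ‖D z‖ ≤ (m.factorial : ℝ) * ((m:ℝ) + 1)^m := by
    intro s hs
    have hs' : ‖s‖ < 1 := by simpa using hs
    have := Matrix.det_le (A := (Matrix.of fun i j : Fin m => psum ((i:ℕ) + (j:ℕ)) (fun t => F (s, t))))
      (abv := IsAbsoluteValue.toAbsoluteValue (norm : ℂ → ℝ)) (x := (m:ℝ)+1) ?_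
    · simpa using! this
    · intro i j
      change ‖psum ((i:ℕ) + (j:ℕ)) (fun t => F (s, t))‖ ≤ _
      have h1 := (hclose ((i:ℕ) + (j:ℕ)) s hs').trans (min_le_left _ _)
      have h2 : ‖∑ r, (a r * s)^((i:ℕ) + (j:ℕ))‖ ≤ m := by
        refine (norm_sum_le _ _).trans ((Finset.sum_le_sum (g := fun _ => (1:ℝ)) ?_).trans (by simp))
        intro r _
        rw [norm_pow]
        refine pow_le_one₀ (norm_nonneg _) ?_
        rw [norm_mul]
        have : ‖a r‖ * ‖s‖ ≤ 1/2 * 1 := by gcongr; exact ha2 r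
        linarith
      have h3 := norm_sub_norm_le (psum ((i:ℕ) + (j:ℕ)) (fun t => F (s, t))) (∑ r, (a r * s)^((i:ℕ) + (j:ℕ)))
      linarith
  have hDδ : ‖H0.det‖ / 2 ≤ ‖D (1/8)‖ := by
    refine hdet _ fun i j => ?_
    exact (hclose ((i:ℕ) + (j:ℕ)) (1/8) (by norm_num)).trans (min_le_right _ _)
  -- structure of zeros in a slice
  have hslice : ∀ s : ℂ, ‖s‖ < 1 → ∃ T : List ℂ, T.length = m ∧ (∀ k, psum k (fun t => F (s, t)) = (T.map (· ^ k)).sum) ∧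
      (∀ t, ‖t‖ < 1 → F (s, t) = 0 → t ∈ T) ∧
      (T.Nodup → ∀ t, ‖t‖ < 1 → F (s, t) = 0 → deriv (fun t => F (s, t)) t ≠ 0) := by
    intro s hs
    have hfd := slice_diff hF (s := s) (by linarith)
    obtain ⟨T, h, hh, hh0, hT, hTf⟩ := factor_zeros _ hfd (fun t ht h0 => by
      have := hFlow s t hs (by simpa using ht)
      rw [h0, norm_zero] at this; linarith) rfl
    have hps := fun k => psum_list k T hh hh0 hT hTf
    refine ⟨T, ?_, hps, ?_, fun hnd t ht ht0 => (double_zero hh hh0 hnd hTf ht ht0).2⟩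
    · have h1 := (hclose 0 s hs).trans (min_le_left _ _)
      rw [hps 0] at h1
      simp only [pow_zero, List.map_const', List.sum_replicate, Finset.sum_const, Finset.card_univ,
        Fintype.card_fin, nsmul_eq_mul, mul_one] at h1
      have h2 : ‖(((T.length : ℤ) - (m:ℤ) : ℤ) : ℂ)‖ ≤ 1/2 := by push_cast; exact h1
      rw [Complex.norm_intCast] at h2
      have h3 : |((T.length : ℤ) - (m:ℤ) : ℤ)| < 1 := by
        have : (|((T.length : ℤ) - (m:ℤ) : ℤ)| : ℝ) < 1 := lt_of_le_of_lt h2 (by norm_num)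
        exact_mod_cast this
      rw [Int.abs_lt_one_iff] at h3
      omega
    · intro t ht ht0
      by_contra hcon
      rw [hTf] at ht0
      exact mul_ne_zero (list_prod_ne hcon) (hh0 t (by simpa using ht.le)) ht0
  have hDz : ∀ z ∈ Z, D z.1 = 0 := by
    intro z hz
    obtain ⟨h1, h2, h3, h4⟩ := hZ z hz
    obtain ⟨T, hTl, hTp, -, hTd⟩ := hslice z.1 (by linarith)
    have hnn : ¬ T.Nodup := fun hnd => hTd hnd z.2 h2 h3 h4
    subst hTl
    have hDe : D z.1 = (Matrix.vandermonde T.get).det ^ 2 := by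
      rw [← hankel_det]
      simp only [hD]
      congr 2
      funext i j
      rw [hTp]
      have hofn : T.map (· ^ ((i:ℕ) + (j:ℕ))) = List.ofFn (fun r => T.get r ^ ((i:ℕ) + (j:ℕ))) := by
        rw [List.ofFn_comp' T.get (fun t : ℂ => t ^ ((i:ℕ) + (j:ℕ))), List.ofFn_get]
      rw [hofn, List.sum_ofFn]
    rw [hDe, sq_eq_zero_iff]
    by_contra hcon
    exact hnn (List.nodup_iff_injective_get.mpr (Matrix.det_vandermonde_ne_zero_iff.mp hcon))
  refine (Finset.card_le_mul_card_image (f := Prod.fst) Z m ?_).trans ?_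
  · intro s hs
    obtain ⟨z0, hz0, rfl⟩ := Finset.mem_image.mp hs
    obtain ⟨T, hTl, -, hTm, -⟩ := hslice z0.1 (by linarith [(hZ z0 hz0).1])
    have : (Z.filter (fun z => z.1 = z0.1)).card ≤ T.toFinset.card := by
      refine Finset.card_le_card_of_injOn Prod.snd ?_ ?_
      · intro z hz
        simp only [Finset.coe_filter, mem_ofPred_eq] at hz
        obtain ⟨h1, h2, h3, h4⟩ := hZ z hz.1
        simp only [List.coe_toFinset, mem_ofPred_eq]
        refine hTm _ h2 ?_
        rw [← hz.2]; exact h3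
      · intro z hz w hw h
        simp only [Finset.coe_filter, mem_ofPred_eq] at hz hw
        exact Prod.ext (hz.2.trans hw.2.symm) h
    exact this.trans ((List.toFinset_card_le T).trans hTl.le)
  · refine Nat.mul_le_mul_left _ (hK D hDd hDM hDδ _ ?_)
    intro s hs
    obtain ⟨z, hz, rfl⟩ := Finset.mem_image.mp hs
    exact ⟨(hZ z hz).1, hDz z hz⟩

end SSM

namespace SSM

section Orth
variable {d : ℕ}

def ev (P : MvPolynomial (Fin d) ℝ) (x : EuclideanSpace ℝ (Fin d)) : ℝ :=
  MvPolynomial.eval (fun i => x i) P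

lemma ev_add (P Q : MvPolynomial (Fin d) ℝ) (x) : ev (P + Q) x = ev P x + ev Q x := by simp [ev]
lemma ev_mul (P Q : MvPolynomial (Fin d) ℝ) (x) : ev (P * Q) x = ev P x * ev Q x := by simp [ev]
lemma ev_C (r : ℝ) (x) : ev (MvPolynomial.C r : MvPolynomial (Fin d) ℝ) x = r := by simp [ev]
lemma ev_X (i) (x) : ev (MvPolynomial.X i : MvPolynomial (Fin d) ℝ) x = x i := by simp [ev]

lemma ev_hasFDerivAt (P : MvPolynomial (Fin d) ℝ) (x : EuclideanSpace ℝ (Fin d)) :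
    HasFDerivAt (ev P) (∑ i, (ev (MvPolynomial.pderiv i P) x) •
      (EuclideanSpace.proj i : EuclideanSpace ℝ (Fin d) →L[ℝ] ℝ)) x := by
  induction P using MvPolynomial.induction_on with
  | C a =>
    have : ev (MvPolynomial.C a : MvPolynomial (Fin d) ℝ) = fun _ => a := by
      ext y; simp [ev_C]
    rw [this]
    refine (hasFDerivAt_const a x).congr_fderiv ?_
    simp [ev]
  | add p q hp hq =>
    have : ev (p + q) = fun y => ev p y + ev q y := by ext y; simp [ev_add]
    rw [this]
    refine (hp.add hq).congr_fderiv ?_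
    symm
    rw [← Finset.sum_add_distrib]
    refine Finset.sum_congr rfl fun i _ => ?_
    rw [map_add, ev_add, add_smul]
  | mul_X p k hp =>
    have : ev (p * MvPolynomial.X k) = fun y => ev p y * (EuclideanSpace.proj k : EuclideanSpace ℝ (Fin d) →L[ℝ] ℝ) y := by
      ext y; simp [ev_mul, ev_X]
    rw [this]
    refine (hp.mul (EuclideanSpace.proj k : EuclideanSpace ℝ (Fin d) →L[ℝ] ℝ).hasFDerivAt).congr_fderiv ?_
    symm
    rw [Finset.smul_sum]
    have h1 : ∀ i : Fin d, ev (MvPolynomial.pderiv i (p * MvPolynomial.X k)) x •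
        (EuclideanSpace.proj i : EuclideanSpace ℝ (Fin d) →L[ℝ] ℝ)
        = (if i = k then ev p x • (EuclideanSpace.proj i : EuclideanSpace ℝ (Fin d) →L[ℝ] ℝ) else 0)
          + (EuclideanSpace.proj k : EuclideanSpace ℝ (Fin d) →L[ℝ] ℝ) x • ev (MvPolynomial.pderiv i p) x •
        (EuclideanSpace.proj i : EuclideanSpace ℝ (Fin d) →L[ℝ] ℝ) := by
      intro i
      rw [MvPolynomial.pderiv_mul, ev_add, ev_mul, ev_mul, ev_X, MvPolynomial.pderiv_X]
      by_cases hik : i = k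
      · subst hik
        simp only [Pi.single_eq_same, if_true]
        rw [add_smul, add_comm]
        simp [ev, smul_smul, mul_comm]
      · rw [Pi.single_eq_of_ne' hik, if_neg hik]
        simp [ev, smul_smul, mul_comm]
    rw [Finset.sum_congr rfl fun i _ => h1 i, Finset.sum_add_distrib]
    simp

lemma ev_contDiff (P : MvPolynomial (Fin d) ℝ) : ContDiff ℝ 1 (ev P) := by
  induction P using MvPolynomial.induction_on with
  | C a =>
    have : ev (MvPolynomial.C a : MvPolynomial (Fin d) ℝ) = fun _ => a := by
      ext y; simp [ev_C]
    rw [this]; exact contDiff_const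
  | add p q hp hq =>
    have : ev (p + q) = fun y => ev p y + ev q y := by ext y; simp [ev_add]
    rw [this]; exact hp.add hq
  | mul_X p k hp =>
    have : ev (p * MvPolynomial.X k) = fun y => ev p y * (EuclideanSpace.proj k : EuclideanSpace ℝ (Fin d) →L[ℝ] ℝ) y := by
      ext y; simp [ev_mul, ev_X]
    rw [this]; exact hp.mul (ContinuousLinearMap.contDiff _)

lemma ev_cont (P : MvPolynomial (Fin d) ℝ) : Continuous (ev P) := (ev_contDiff P).continuous

/-- integral of a directional derivative of a compactly supported function vanishes -/
lemma ibp0 {w : EuclideanSpace ℝ (Fin d) → ℝ} (hw : ContDiff ℝ 1 w) (hc : HasCompactSupport w)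
    (v : EuclideanSpace ℝ (Fin d)) : ∫ x, fderiv ℝ w x v = 0 := by
  have hcont : Continuous fun x => fderiv ℝ w x v :=
    (hw.continuous_fderiv (by norm_num)).clm_apply continuous_const
  have hcs : HasCompactSupport fun x => fderiv ℝ w x v := by
    refine (hc.fderiv (𝕜 := ℝ)).mono' ?_
    intro x hx
    apply subset_closure
    intro h0
    apply hx
    simp [h0]
  have := integral_mul_fderiv_eq_neg_fderiv_mul_of_integrable (μ := volume) (𝕜 := ℝ)
    (f := fun _ : EuclideanSpace ℝ (Fin d) => (1:ℝ)) (g := w) (v := v)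
    (by simp) (by simpa using hcont.integrable_of_hasCompactSupport hcs)
    (by simpa using hw.continuous.integrable_of_hasCompactSupport hc)
    (fun x _ => by fun_prop) (fun x _ => (hw.differentiable (by norm_num)) x)
  simpa using this

variable (Qp : MvPolynomial (Fin d) ℝ) {c : ℝ}

lemma phi_cs (hc : 0 < c) (hQ : ∀ x, c * ‖x‖^2 ≤ ev Qp x) {φ : ℝ → ℝ}
    (h1 : ∀ q, 1 ≤ q → φ q = 0) (R : MvPolynomial (Fin d) ℝ) :
    HasCompactSupport fun x => ev R x * φ (ev Qp x) := by
  refine HasCompactSupport.intro (isCompact_closedBall (0 : EuclideanSpace ℝ (Fin d)) (1 + 1/c)) ?_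
  intro x hx
  rw [h1, mul_zero]
  refine le_trans ?_ (hQ x)
  have hx' : 1 + 1/c < ‖x‖ := by simpa using hx
  have h2 : 1/c < ‖x‖ ^2 := by
    have : 0 < 1/c := by positivity
    nlinarith
  rw [div_lt_iff₀ hc] at h2
  linarith

lemma phi_int (hc : 0 < c) (hQ : ∀ x, c * ‖x‖^2 ≤ ev Qp x) {φ : ℝ → ℝ} (hφ : Continuous φ)
    (h1 : ∀ q, 1 ≤ q → φ q = 0) (R : MvPolynomial (Fin d) ℝ) :
    Integrable fun x => ev R x * φ (ev Qp x) :=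
  ((ev_cont R).mul (hφ.comp (ev_cont Qp))).integrable_of_hasCompactSupport (phi_cs Qp hc hQ h1 R)

lemma stokes (hc : 0 < c) (hQ : ∀ x, c * ‖x‖^2 ≤ ev Qp x) {φ Φ : ℝ → ℝ} (hφ : Continuous φ)
    (hΦ : ∀ q, HasDerivAt Φ (φ q) q)
    (h1 : ∀ q, 1 ≤ q → φ q = 0) (h2 : ∀ q, 1 ≤ q → Φ q = 0) (R : MvPolynomial (Fin d) ℝ) (j : Fin d) :
    ∫ x, ev (MvPolynomial.pderiv j R) x * Φ (ev Qp x)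
      = - ∫ x, ev (R * MvPolynomial.pderiv j Qp) x * φ (ev Qp x) := by
  have hΦ1 : ContDiff ℝ 1 Φ := by
    rw [contDiff_one_iff_deriv]
    refine ⟨fun q => (hΦ q).differentiableAt, ?_⟩
    have : deriv Φ = φ := funext fun q => (hΦ q).deriv
    rwa [this]
  have hw : ContDiff ℝ 1 fun x => ev R x * Φ (ev Qp x) := (ev_contDiff R).mul (hΦ1.comp (ev_contDiff Qp))
  have key := ibp0 hw (phi_cs Qp hc hQ h2 R) (EuclideanSpace.single j 1)
  have hd : ∀ x, fderiv ℝ (fun x => ev R x * Φ (ev Qp x)) x (EuclideanSpace.single j 1)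
      = ev (MvPolynomial.pderiv j R) x * Φ (ev Qp x) + ev (R * MvPolynomial.pderiv j Qp) x * φ (ev Qp x) := by
    intro x
    have hD := (ev_hasFDerivAt R x).mul ((hΦ (ev Qp x)).comp_hasFDerivAt x (ev_hasFDerivAt Qp x))
    have : fderiv ℝ (fun x => ev R x * Φ (ev Qp x)) x = _ := hD.fderiv
    rw [this]
    simp [ev_mul, Function.comp]
    ring
  simp_rw [hd] at key
  rw [integral_add] at key
  · linarith
  · exact phi_int Qp hc hQ (continuous_iff_continuousAt.2 fun q => (hΦ q).continuousAt) h2 _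
  · exact phi_int Qp hc hQ hφ h1 _

lemma exists_Phi {φ : ℝ → ℝ} (hφ : Continuous φ) (h1 : ∀ q, 1 ≤ q → φ q = 0) :
    ∃ Φ : ℝ → ℝ, (∀ q, HasDerivAt Φ (φ q) q) ∧ ∀ q, 1 ≤ q → Φ q = 0 := by
  refine ⟨fun q => ∫ t in (1:ℝ)..q, φ t, fun q => (hφ.integral_hasStrictDerivAt 1 q).hasDerivAt, ?_⟩
  intro q hq
  show ∫ t in (1:ℝ)..q, φ t = 0
  rw [intervalIntegral.integral_congr (g := fun _ => 0)]
  · simp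
  · intro t ht
    rw [uIcc_of_le hq] at ht
    exact h1 t ht.1

lemma ev_sum {ι : Type*} (s : Finset ι) (f : ι → MvPolynomial (Fin d) ℝ) (x) :
    ev (∑ i ∈ s, f i) x = ∑ i ∈ s, ev (f i) x := by simp [ev]

lemma orth_sum (hc : 0 < c) (hQ : ∀ x, c * ‖x‖^2 ≤ ev Qp x) {φ : ℝ → ℝ} (hφ : Continuous φ)
    (h1 : ∀ q, 1 ≤ q → φ q = 0) {ι : Type*} (s : Finset ι) (f : ι → MvPolynomial (Fin d) ℝ) :
    ∫ x, ev (∑ i ∈ s, f i) x * φ (ev Qp x) = ∑ i ∈ s, ∫ x, ev (f i) x * φ (ev Qp x) := by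
  rw [← integral_finsetSum]
  · simp_rw [ev_sum, Finset.sum_mul]
  · intro i _
    exact phi_int Qp hc hQ hφ h1 _

lemma orth_C (r : ℝ) (φ : ℝ → ℝ) (f : MvPolynomial (Fin d) ℝ) :
    ∫ x, ev (MvPolynomial.C r * f) x * φ (ev Qp x) = r * ∫ x, ev f x * φ (ev Qp x) := by
  rw [← integral_const_mul]
  simp_rw [ev_mul, ev_C, mul_assoc]

lemma pd_comm (i j : Fin d) (P : MvPolynomial (Fin d) ℝ) :
    MvPolynomial.pderiv i (MvPolynomial.pderiv j P) = MvPolynomial.pderiv j (MvPolynomial.pderiv i P) := by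
  have : ⁅MvPolynomial.pderiv (R := ℝ) i, MvPolynomial.pderiv (R := ℝ) j⁆ = 0 := by
    apply MvPolynomial.derivation_ext
    intro k
    simp only [Derivation.commutator_apply, MvPolynomial.pderiv_X, Derivation.zero_apply]
    by_cases h1 : j = k <;> by_cases h2 : i = k <;> simp [Pi.single_apply, h1, h2, eq_comm]
  have h := congrArg (fun D => D P) this
  simp only [Derivation.commutator_apply, Derivation.zero_apply] at h
  exact sub_eq_zero.1 h

open MvPolynomial in
theorem orth (a : Matrix (Fin d) (Fin d) ℝ) (hc : 0 < c) (hQ : ∀ x, c * ‖x‖^2 ≤ ev Qp x)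
    (haQ : ∀ i, ∑ j, C (a i j) * pderiv j Qp = 2 * X i) (m : ℕ) :
    ∀ (P h : MvPolynomial (Fin d) ℝ) (k : ℕ), P.IsHomogeneous m → h.IsHomogeneous k → k < m →
      (∑ i, ∑ j, C (a i j) * pderiv j (pderiv i P) = 0) →
      ∀ φ : ℝ → ℝ, Continuous φ → (∀ q, 1 ≤ q → φ q = 0) →
        ∫ x, ev (P * h) x * φ (ev Qp x) = 0 := by
  induction m with
  | zero => intro P h k _ _ hk; omega
  | succ m ih =>
    intro P h k hP hh hk hL φ hφ h1
    obtain ⟨Φ, hΦ, h2⟩ := exists_Phi hφ h1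
    have hΦc : Continuous Φ := continuous_iff_continuousAt.2 fun q => (hΦ q).continuousAt
    -- the second order term
    have hz : ∀ i j, ∫ x, ev (pderiv i P * pderiv j h) x * Φ (ev Qp x) = 0 := by
      intro i j
      rcases Nat.eq_zero_or_pos k with hk0 | hk0
      · have : pderiv j h = 0 := by
          rw [hk0] at hh
          rw [(totalDegree_eq_zero_iff_eq_C (p := h)).1 (Nat.le_zero.1 hh.totalDegree_le)]; simp
        rw [this]; simp [ev]
      · refine ih (pderiv i P) (pderiv j h) (k-1) ?_ ?_ (by omega) ?_ Φ hΦc h2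
        · simpa using hP.pderiv (i := i)
        · exact hh.pderiv
        · have := congrArg (pderiv i) hL
          simp only [map_sum, map_zero, Derivation.leibniz, pderiv_C, smul_zero, add_zero, smul_eq_mul] at this
          rw [← this]
          refine Finset.sum_congr rfl fun p _ => Finset.sum_congr rfl fun q _ => ?_
          rw [pd_comm p i P, pd_comm q i]
          simp
    have e1 : ∑ i, ∑ j, C (a i j) * pderiv j (pderiv i P * h)
        = ∑ i, ∑ j, C (a i j) * (pderiv i P * pderiv j h) := by
      have : ∑ i, ∑ j, C (a i j) * pderiv j (pderiv i P * h)
        = ∑ i, ∑ j, C (a i j) * (pderiv i P * pderiv j h) +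
          (∑ i, ∑ j, C (a i j) * pderiv j (pderiv i P)) * h := by
        simp_rw [Finset.sum_mul, ← Finset.sum_add_distrib]
        refine Finset.sum_congr rfl fun p _ => Finset.sum_congr rfl fun q _ => ?_
        rw [pderiv_mul]; ring
      rw [this, hL, zero_mul, add_zero]
    have e2 : ∑ i, ∑ j, C (a i j) * ((pderiv i P * h) * pderiv j Qp) = C (2 * (m+1:ℝ)) * (P * h) := by
      have h3 : ∀ i, ∑ j, C (a i j) * ((pderiv i P * h) * pderiv j Qp) = (pderiv i P * h) * (2 * X i) := by
        intro i
        rw [← haQ i, Finset.mul_sum]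
        refine Finset.sum_congr rfl fun q _ => ?_
        ring
      rw [Finset.sum_congr rfl fun i _ => h3 i]
      have h4 := hP.sum_X_mul_pderiv
      have h5 : ∑ i, pderiv i P * h * (2 * X i) = 2 * h * ∑ i, X i * pderiv i P := by
        rw [Finset.mul_sum]
        refine Finset.sum_congr rfl fun q _ => ?_
        ring
      rw [h5, h4]
      have h6 : (C 2 : MvPolynomial (Fin d) ℝ) = 2 := map_ofNat C 2
      simp only [nsmul_eq_mul, map_mul, map_add, map_one, map_natCast, h6]
      push_cast
      ring
    have e3 : ∑ i, ∑ j, a i j * ∫ x, ev (pderiv j (pderiv i P * h)) x * Φ (ev Qp x) = 0 := by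
      have : ∫ x, ev (∑ i, ∑ j, C (a i j) * pderiv j (pderiv i P * h)) x * Φ (ev Qp x) = 0 := by
        rw [e1]
        simp_rw [orth_sum Qp hc hQ hΦc h2, orth_C, hz]
        simp
      simp_rw [orth_sum Qp hc hQ hΦc h2, orth_C] at this
      exact this
    simp_rw [stokes Qp hc hQ hφ hΦ h1 h2] at e3
    have e4 := congrArg (fun R => ∫ x, ev R x * φ (ev Qp x)) e2
    simp_rw [orth_sum Qp hc hQ hφ h1, orth_C] at e4
    simp only [mul_neg, Finset.sum_neg_distrib, neg_eq_zero] at e3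
    rw [e3] at e4
    have : (2 * (m+1:ℝ)) ≠ 0 := by positivity
    have := mul_eq_zero.1 e4.symm
    tauto

end Orth
end SSM

namespace SSM

section Sep
variable {d : ℕ}

lemma hom_scale {S K : Type*} [CommRing K] [CommRing S] [Algebra K S] {P : MvPolynomial (Fin d) K} {m : ℕ}
    (hP : P.IsHomogeneous m) (t : S) (g : Fin d → S) :
    MvPolynomial.aeval (fun i => t * g i) P = t^m * MvPolynomial.aeval g P := by
  rw [MvPolynomial.aeval_def, MvPolynomial.aeval_def, MvPolynomial.eval₂_eq', MvPolynomial.eval₂_eq',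
    Finset.mul_sum]
  refine Finset.sum_congr rfl fun s hs => ?_
  have : ∑ i, s i = m := by
    have := hP (MvPolynomial.mem_support_iff.1 hs)
    rw [Finsupp.weight_apply, Finsupp.sum_fintype _ _ (by simp)] at this
    simpa using this
  simp_rw [mul_pow]
  rw [Finset.prod_mul_distrib, Finset.prod_pow_eq_pow_sum, this]
  ring

lemma ev_smul {P : MvPolynomial (Fin d) ℝ} {m : ℕ}
    (hP : P.IsHomogeneous m) (t : ℝ) (x : EuclideanSpace ℝ (Fin d)) : ev P (t • x) = t^m * ev P x := by
  have := hom_scale hP t (fun i => x i)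
  exact this

lemma eq_zero_of_near {P : MvPolynomial (Fin d) ℝ} {m : ℕ}
    (hP : P.IsHomogeneous m) (h : ∀ᶠ x in nhds (0 : EuclideanSpace ℝ (Fin d)), ev P x = 0) : P = 0 := by
  apply MvPolynomial.funext
  intro y
  obtain ⟨δ, hδ, hball⟩ := Metric.eventually_nhds_iff.1 h
  set x : EuclideanSpace ℝ (Fin d) := WithLp.toLp 2 y
  have ht : 0 < δ / (2 * (‖x‖ + 1)) := by positivity
  have h1 := hball (y := (δ / (2 * (‖x‖ + 1))) • x) (by
    rw [dist_zero_right, norm_smul, Real.norm_of_nonneg ht.le, div_mul_eq_mul_div, div_lt_iff₀ (by positivity)]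
    nlinarith [norm_nonneg x])
  rw [ev_smul hP] at h1
  have h2 := (mul_eq_zero.1 h1).resolve_left (pow_ne_zero _ ht.ne')
  simpa [ev, x] using h2

open MvPolynomial in
theorem no_sq (Qp : MvPolynomial (Fin d) ℝ) {c : ℝ} (a : Matrix (Fin d) (Fin d) ℝ) (hc : 0 < c)
    (hQ : ∀ x, c * ‖x‖^2 ≤ ev Qp x) (hQ0 : ev Qp 0 = 0)
    (haQ : ∀ i, ∑ j, C (a i j) * pderiv j Qp = 2 * X i) {m : ℕ} {P q h : MvPolynomial (Fin d) ℝ}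
    (hP : P.IsHomogeneous m) (hL : ∑ i, ∑ j, C (a i j) * pderiv j (pderiv i P) = 0)
    {b : ℝ} (hf : P = C b * (q * q * h)) (hq : constantCoeff q = 0) : P = 0 := by
  by_contra hP0
  have hb : b ≠ 0 := by rintro rfl; simp at hf; exact hP0 hf
  have hq0 : q ≠ 0 := by rintro rfl; simp at hf; exact hP0 hf
  have hh0 : h ≠ 0 := by rintro rfl; simp at hf; exact hP0 hf
  have hqd : 0 < q.totalDegree := by
    rw [Nat.pos_iff_ne_zero]
    intro h0
    have := (totalDegree_eq_zero_iff_eq_C (p := q)).1 h0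
    rw [constantCoeff_eq] at hq
    rw [hq, C_0] at this
    exact hq0 this
  have hdeg : h.totalDegree < m := by
    have h1 := hP.totalDegree hP0
    have h2 : (C b : MvPolynomial (Fin d) ℝ) ≠ 0 := by simpa using hb
    rw [hf, totalDegree_mul_of_isDomain h2 (mul_ne_zero (mul_ne_zero hq0 hq0) hh0),
      totalDegree_mul_of_isDomain (mul_ne_zero hq0 hq0) hh0, totalDegree_mul_of_isDomain hq0 hq0] at h1
    omega
  set φ : ℝ → ℝ := fun t => max (1 - t) 0 with hφdef
  have hφ : Continuous φ := by fun_prop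
  have h1 : ∀ t, 1 ≤ t → φ t = 0 := fun t ht => by simp [φ, ht]
  have key : ∫ x, ev (P * h) x * φ (ev Qp x) = 0 := by
    have hs : P * h = ∑ i ∈ Finset.range (h.totalDegree + 1), P * homogeneousComponent i h := by
      rw [← Finset.mul_sum, sum_homogeneousComponent]
    rw [hs, orth_sum Qp hc hQ hφ h1]
    refine Finset.sum_eq_zero fun i hi => ?_
    refine orth Qp a hc hQ haQ m P _ i hP (homogeneousComponent_isHomogeneous i h) ?_ hL φ hφ h1
    have := Finset.mem_range.1 hi
    omega
  have hPh : P * h = C b * ((q * h) * (q * h)) := by rw [hf]; ring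
  rw [hPh, orth_C] at key
  have key2 := (mul_eq_zero.1 key).resolve_left hb
  have hz : ∀ x, ev ((q * h) * (q * h)) x * φ (ev Qp x) = 0 := by
    by_contra hne
    push Not at hne
    obtain ⟨x, hx⟩ := hne
    have := Continuous.integral_pos_of_hasCompactSupport_nonneg_nonzero (μ := volume)
      (f := fun x => ev ((q * h) * (q * h)) x * φ (ev Qp x))
      ((ev_cont _).mul (hφ.comp (ev_cont Qp))) (phi_cs Qp hc hQ h1 _) (by
        intro x
        simp only [Pi.zero_apply]
        rw [ev_mul]
        exact mul_nonneg (mul_self_nonneg _) (le_max_right _ _)) hx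
    rw [key2] at this
    exact lt_irrefl _ this
  apply hP0
  apply eq_zero_of_near hP
  have hn : ∀ᶠ x in nhds (0 : EuclideanSpace ℝ (Fin d)), ev Qp x < 1 :=
    (ev_cont Qp).continuousAt.eventually_lt continuousAt_const (by rw [hQ0]; norm_num)
  filter_upwards [hn] with x hx
  have h2 : φ (ev Qp x) ≠ 0 := by
    have : 0 < φ (ev Qp x) := lt_of_lt_of_le (by linarith) (le_max_left _ _)
    exact this.ne'
  have h3 := (mul_eq_zero.1 (hz x)).resolve_right h2
  rw [ev_mul] at h3
  have h4 : ev (q * h) x = 0 := by simpa using h3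
  have h5 : P = C b * q * (q * h) := by rw [hf]; ring
  rw [h5, ev_mul, h4, mul_zero]

/-- restriction to a line -/
def pl {R : Type*} [CommRing R] [Algebra ℝ R] (P : MvPolynomial (Fin d) ℝ) (f : Fin d → R) (e : Fin d → ℝ) :
    Polynomial R :=
  MvPolynomial.aeval (fun i => Polynomial.C (f i) + Polynomial.C (algebraMap ℝ R (e i)) * Polynomial.X) P

lemma coeff_prod_deg {ι R : Type*} [CommRing R] (s : Finset ι) (g : ι → Polynomial R) (n : ι → ℕ)
    (h : ∀ i ∈ s, (g i).natDegree ≤ n i) :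
    (∏ i ∈ s, g i).natDegree ≤ ∑ i ∈ s, n i ∧
      (∏ i ∈ s, g i).coeff (∑ i ∈ s, n i) = ∏ i ∈ s, (g i).coeff (n i) := by
  classical
  induction s using Finset.induction_on with
  | empty => simp
  | insert i s hi ih =>
    obtain ⟨h1, h2⟩ := ih fun j hj => h j (Finset.mem_insert_of_mem hj)
    have h3 := h i (Finset.mem_insert_self _ _)
    rw [Finset.prod_insert hi, Finset.sum_insert hi, Finset.prod_insert hi]
    refine ⟨Polynomial.natDegree_mul_le_of_le h3 h1, ?_⟩
    rw [Polynomial.coeff_mul_add_eq_of_natDegree_le h3 h1, h2]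

lemma pl_deg {R : Type*} [CommRing R] [Algebra ℝ R] {P : MvPolynomial (Fin d) ℝ} {m : ℕ}
    (hP : P.IsHomogeneous m) (f : Fin d → R) (e : Fin d → ℝ) :
    (pl P f e).natDegree ≤ m ∧ (pl P f e).coeff m = algebraMap ℝ R (MvPolynomial.eval e P) := by
  have hterm : ∀ s ∈ P.support,
      (algebraMap ℝ (Polynomial R) (P.coeff s) * ∏ i, (Polynomial.C (f i) + Polynomial.C (algebraMap ℝ R (e i)) * Polynomial.X)^(s i)).natDegree ≤ m ∧
      (algebraMap ℝ (Polynomial R) (P.coeff s) * ∏ i, (Polynomial.C (f i) + Polynomial.C (algebraMap ℝ R (e i)) * Polynomial.X)^(s i)).coeff m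
       = algebraMap ℝ R (P.coeff s * ∏ i, e i ^ s i) := by
    intro s hs
    have hsm : ∑ i, s i = m := by
      have := hP (MvPolynomial.mem_support_iff.1 hs)
      rw [Finsupp.weight_apply, Finsupp.sum_fintype _ _ (by simp)] at this
      simpa using this
    have hlin : ∀ i, (Polynomial.C (f i) + Polynomial.C (algebraMap ℝ R (e i)) * Polynomial.X).natDegree ≤ 1 := by
      intro i
      rw [add_comm]
      exact Polynomial.natDegree_linear_le
    have := coeff_prod_deg Finset.univ (fun i => (Polynomial.C (f i) + Polynomial.C (algebraMap ℝ R (e i)) * Polynomial.X)^(s i)) s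
      (fun i _ => by simpa using Polynomial.natDegree_pow_le_of_le (s i) (hlin i))
    rw [hsm] at this
    rw [Polynomial.algebraMap_apply]
    refine ⟨(Polynomial.natDegree_C_mul_le _ _).trans this.1, ?_⟩
    rw [Polynomial.coeff_C_mul, this.2, map_mul, map_prod]
    congr 1
    refine Finset.prod_congr rfl fun i _ => ?_
    have h2 := Polynomial.coeff_pow_of_natDegree_le (m := s i) (hlin i)
    rw [mul_one] at h2
    rw [h2]
    simp
  unfold pl
  rw [MvPolynomial.aeval_def, MvPolynomial.eval₂_eq']
  refine ⟨Polynomial.natDegree_sum_le_of_forall_le _ _ fun s hs => (hterm s hs).1, ?_⟩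
  rw [Polynomial.finsetSum_coeff, Finset.sum_congr rfl fun s hs => (hterm s hs).2, ← map_sum,
    MvPolynomial.eval_eq']

lemma pl_map {R S : Type*} [CommRing R] [Algebra ℝ R] [CommRing S] [Algebra ℝ S] (ψ : R →ₐ[ℝ] S)
    (P : MvPolynomial (Fin d) ℝ) (f : Fin d → R) (e : Fin d → ℝ) :
    (pl P f e).map ψ.toRingHom = pl P (fun i => ψ (f i)) e := by
  unfold pl
  have := MvPolynomial.comp_aeval_apply (R := ℝ) (fun i => Polynomial.C (f i) + Polynomial.C (algebraMap ℝ R (e i)) * Polynomial.X) (Polynomial.mapAlgHom ψ) P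
  simpa using! this

open MvPolynomial in
theorem sep_generic (Qp : MvPolynomial (Fin d) ℝ) {c : ℝ} (a : Matrix (Fin d) (Fin d) ℝ) (hc : 0 < c)
    (hQ : ∀ x, c * ‖x‖^2 ≤ ev Qp x) (hQ0 : ev Qp 0 = 0)
    (haQ : ∀ i, ∑ j, C (a i j) * pderiv j Qp = 2 * X i) {m : ℕ} {P : MvPolynomial (Fin d) ℝ}
    (hP : P.IsHomogeneous m) (hL : ∑ i, ∑ j, C (a i j) * pderiv j (pderiv i P) = 0)
    (e : Fin d → ℝ) (he : eval e P ≠ 0) :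
    ∃ D : MvPolynomial (Fin d) ℝ, D ≠ 0 ∧ ∀ f : Fin d → ℝ, eval f D ≠ 0 → (pl P f e).Separable := by
  have hP0 : P ≠ 0 := by rintro rfl; simp at he
  rcases Nat.eq_zero_or_pos m with hm | hm
  · refine ⟨1, one_ne_zero, fun f _ => ?_⟩
    subst hm
    have h1 := pl_deg hP f e
    rw [Polynomial.eq_C_of_natDegree_le_zero h1.1, h1.2]
    rw [Polynomial.separable_C]
    simpa using he
  let R := MvPolynomial (Fin d) ℝ
  let K := FractionRing R
  let p : Polynomial R := Polynomial.C (C (eval e P)⁻¹) * pl P (X : Fin d → R) e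
  have hpd : p.natDegree ≤ m := (Polynomial.natDegree_C_mul_le _ _).trans (pl_deg hP _ e).1
  have hpc : p.coeff m = 1 := by
    simp only [p, Polynomial.coeff_C_mul, (pl_deg hP _ e).2]
    rw [MvPolynomial.algebraMap_eq, ← C_mul, inv_mul_cancel₀ he, C_1]
  have hpm : p.Monic := Polynomial.monic_of_natDegree_le_of_coeff_eq_one m hpd hpc
  have hpn : p.natDegree = m := le_antisymm hpd (Polynomial.le_natDegree_of_ne_zero (by rw [hpc]; exact one_ne_zero))
  have hsep : (p.map (algebraMap R K)).Separable := by
    rw [PerfectField.separable_iff_squarefree]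
    intro q hqq
    by_contra hqu
    have hqd : q ∣ p.map (algebraMap R K) := (dvd_mul_right q q).trans hqq
    have hpK : (p.map (algebraMap R K)) ≠ 0 := (hpm.map _).ne_zero
    have hq0 : q ≠ 0 := fun h => hpK (by rw [h] at hqd; exact zero_dvd_iff.1 hqd)
    obtain ⟨g, hg⟩ := IsIntegrallyClosed.eq_map_mul_C_of_dvd K hpm hqd
    have hlc : q.leadingCoeff ≠ 0 := Polynomial.leadingCoeff_ne_zero.2 hq0
    have hgm : g.Monic := by
      have h1 := congrArg Polynomial.leadingCoeff hg
      rw [Polynomial.leadingCoeff_mul, Polynomial.leadingCoeff_C] at h1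
      have h2 : (g.map (algebraMap R K)).leadingCoeff = 1 := by
        exact (mul_eq_right₀ hlc).1 h1
      rw [Polynomial.leadingCoeff_map_of_injective (IsFractionRing.injective R K)] at h2
      exact (IsFractionRing.injective R K) (by rw [h2, map_one])
    have hgd : g.natDegree ≠ 0 := by
      intro h0
      apply hqu
      have h1 : g = 1 := by
        rw [← hgm.natDegree_eq_zero]; exact h0
      rw [← hg, h1]
      simp only [Polynomial.map_one, one_mul, Polynomial.isUnit_C]
      exact hlc.isUnit
    have hgg : g * g ∣ p := by
      rw [← Polynomial.map_dvd_map (algebraMap R K) (IsFractionRing.injective R K) (hgm.mul hgm)]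
      refine dvd_trans ?_ hqq
      rw [Polynomial.map_mul]
      have : g.map (algebraMap R K) ∣ q := ⟨_, hg.symm⟩
      exact mul_dvd_mul this this
    obtain ⟨h, hh⟩ := hgg
    -- T = 0
    have hT : C (eval e P)⁻¹ * P = g.coeff 0 * g.coeff 0 * h.coeff 0 := by
      have h1 := congrArg (fun r => Polynomial.coeff r 0) hh
      simp only [Polynomial.mul_coeff_zero, p, Polynomial.coeff_C_zero] at h1
      rw [← h1]
      congr 1
      unfold pl
      have h7 : (aeval fun i => (X i : R)) P = P := by
        have := aeval_X_left_apply (R := ℝ) P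
        exact this
      have := MvPolynomial.comp_aeval_apply (R := ℝ) (fun i => Polynomial.C (X i : R) + Polynomial.C (algebraMap ℝ R (e i)) * Polynomial.X) (Polynomial.aeval (R := R) (0:R)|>.restrictScalars ℝ) P
      simp [Polynomial.aeval_def] at this
      rw [h7] at this
      exact this.symm
    have hX : constantCoeff (g.coeff 0) = 0 := by
      have h1 := congrArg (Polynomial.map (constantCoeff : R →+* ℝ)) hh
      have h2 : p.map (constantCoeff : R →+* ℝ) = Polynomial.X ^ m := by
        have h3 := pl_map (aeval (fun _ => (0:ℝ)) : R →ₐ[ℝ] ℝ) P (X : Fin d → R) e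
        have h4 : (aeval (fun _ => (0:ℝ)) : R →ₐ[ℝ] ℝ).toRingHom = constantCoeff := by
          ext <;> simp
        rw [h4] at h3
        simp only [p, Polynomial.map_mul, h3, Polynomial.map_C, constantCoeff_C]
        unfold pl
        have h5 := hom_scale hP (Polynomial.X : Polynomial ℝ) (fun i => Polynomial.C (e i))
        have h6 : aeval (fun i => Polynomial.C (e i)) P = Polynomial.C (eval e P) := by
          have := MvPolynomial.comp_aeval_apply (R := ℝ) e (Algebra.ofId ℝ (Polynomial ℝ)) P
          simpa using! this.symm
        rw [h6] at h5
        simp only [aeval_X, Polynomial.C_0, zero_add, Algebra.algebraMap_self, RingHom.id_apply]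
        simp_rw [mul_comm _ Polynomial.X]
        rw [h5, mul_left_comm, ← Polynomial.C_mul, inv_mul_cancel₀ he, Polynomial.C_1, mul_one]
      rw [h2, Polynomial.map_mul, Polynomial.map_mul] at h1
      have h3 : g.map (constantCoeff : R →+* ℝ) ∣ Polynomial.X ^ m := ⟨_, by rw [h1, mul_assoc]⟩
      obtain ⟨i, hi, hass⟩ := (dvd_prime_pow Polynomial.prime_X m).1 h3
      have hi0 : i ≠ 0 := by
        rintro rfl
        rw [pow_zero, associated_one_iff_isUnit] at hass
        have := Polynomial.natDegree_eq_zero_of_isUnit hass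
        rw [hgm.natDegree_map] at this
        exact hgd this
      have h4 : Polynomial.X ∣ g.map (constantCoeff : R →+* ℝ) := (dvd_pow_self _ hi0).trans hass.symm.dvd
      rw [Polynomial.X_dvd_iff, Polynomial.coeff_map] at h4
      exact h4
    apply hP0
    refine no_sq Qp a hc hQ hQ0 haQ hP hL (b := eval e P) (q := g.coeff 0) (h := h.coeff 0) ?_ hX
    rw [← hT, ← mul_assoc, ← C_mul, mul_inv_cancel₀ he, C_1, one_mul]
  -- resultant
  have hres : p.resultant (Polynomial.derivative p) p.natDegree (Polynomial.derivative p).natDegree ≠ 0 := by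
    intro h0
    have h1 := Polynomial.resultant_ne_zero _ _ hsep
    rw [Polynomial.derivative_map, Polynomial.natDegree_map_eq_of_injective (IsFractionRing.injective R K),
     Polynomial.natDegree_map_eq_of_injective (IsFractionRing.injective R K), Polynomial.resultant_map_map, h0, map_zero] at h1
    exact h1 rfl
  refine ⟨_, hres, fun f hf => ?_⟩
  obtain ⟨r, s, -, -, hrs⟩ := Polynomial.exists_mul_add_mul_eq_C_resultant p (Polynomial.derivative p) le_rfl le_rfl
    (Or.inl (by rw [hpn]; omega))
  have h1 := congrArg (Polynomial.map (eval f)) hrs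
  have h2 : p.map (eval f) = Polynomial.C (eval e P)⁻¹ * pl P f e := by
    have h3 := pl_map (aeval f : R →ₐ[ℝ] ℝ) P (X : Fin d → R) e
    have h4 : (aeval f : R →ₐ[ℝ] ℝ).toRingHom = eval f := by
      ext <;> simp
    rw [h4] at h3
    simp [p, h3]
  rw [Polynomial.map_add, Polynomial.map_mul (p := p) (q := r), Polynomial.map_mul (p := Polynomial.derivative p), ← Polynomial.derivative_map, Polynomial.map_C, h2] at h1
  have h5 : (Polynomial.C (eval e P)⁻¹ * pl P f e).Separable := by
    refine ⟨Polynomial.C (eval f (p.resultant (Polynomial.derivative p) p.natDegree (Polynomial.derivative p).natDegree))⁻¹ * r.map (eval f),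
      Polynomial.C (eval f (p.resultant (Polynomial.derivative p) p.natDegree (Polynomial.derivative p).natDegree))⁻¹ * s.map (eval f), ?_⟩
    rw [mul_assoc, mul_assoc, ← mul_add, mul_comm (r.map _), mul_comm (s.map _), h1, ← Polynomial.C_mul, inv_mul_cancel₀ hf, Polynomial.C_1]
  exact h5.of_mul_right

end Sep
end SSM

namespace SSM

section Basis
variable {d : ℕ}

lemma nonvan {D : MvPolynomial (Fin d) ℝ} (hD : D ≠ 0) : ∃ f, MvPolynomial.eval f D ≠ 0 := by
  by_contra h
  push Not at h
  exact hD (MvPolynomial.funext fun f => by simp [h f])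

lemma exists_basis {P : MvPolynomial (Fin d) ℝ} (hP0 : P ≠ 0)
    (hsep : ∀ e : Fin d → ℝ, MvPolynomial.eval e P ≠ 0 →
      ∃ D : MvPolynomial (Fin d) ℝ, D ≠ 0 ∧ ∀ f : Fin d → ℝ, MvPolynomial.eval f D ≠ 0 → (pl P f e).Separable)
    (n : ℕ) (hn : n ≤ d) : ∃ b : Fin n → (Fin d → ℝ), LinearIndependent ℝ b ∧
      (∀ k, MvPolynomial.eval (b k) P ≠ 0) ∧ ∀ i j, i < j → (pl P (b j) (b i)).Separable := by
  induction n with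
  | zero => exact ⟨fun i => i.elim0, linearIndependent_empty_type, fun i => i.elim0, fun i => i.elim0⟩
  | succ n ih =>
    obtain ⟨b, hb, hbP, hbs⟩ := ih (by omega)
    choose D hD0 hD using fun k => hsep (b k) (hbP k)
    -- functional
    have hlt : Submodule.span ℝ (range b) < ⊤ := by
      apply lt_top_iff_ne_top.2
      intro h
      have h1 := finrank_span_eq_card hb
      rw [h, finrank_top] at h1
      simp at h1
      omega
    obtain ⟨ℓ, hℓ, hker⟩ := Submodule.exists_le_ker_of_lt_top _ hlt
    let Lp : MvPolynomial (Fin d) ℝ := ∑ k, MvPolynomial.C (ℓ (Pi.single k 1)) * MvPolynomial.X k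
    have hLe : ∀ f, MvPolynomial.eval f Lp = ℓ f := by
      intro f
      have : f = ∑ k, f k • (Pi.single k 1 : Fin d → ℝ) := by
        ext q; simp [Finset.sum_apply, Pi.single_apply]
      conv_rhs => rw [this, map_sum]
      simp [Lp, mul_comm]
    have hL0 : Lp ≠ 0 := by
      intro h
      apply hℓ
      ext k
      have := hLe (Pi.single k 1)
      rw [h] at this
      simpa using this.symm
    obtain ⟨f, hf⟩ := nonvan (D := Lp * P * ∏ k, D k)
      (mul_ne_zero (mul_ne_zero hL0 hP0) (Finset.prod_ne_zero_iff.2 fun k _ => hD0 k))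
    rw [map_mul, map_mul, map_prod] at hf
    have hf1 := left_ne_zero_of_mul (left_ne_zero_of_mul hf)
    have hf2 := right_ne_zero_of_mul (left_ne_zero_of_mul hf)
    have hf3 : ∀ k, MvPolynomial.eval f (D k) ≠ 0 := fun k =>
      Finset.prod_ne_zero_iff.1 (right_ne_zero_of_mul hf) k (Finset.mem_univ k)
    refine ⟨Fin.snoc b f, ?_, ?_, ?_⟩
    · rw [linearIndependent_finSnoc]
      refine ⟨hb, fun hmem => ?_⟩
      have := hker hmem
      rw [LinearMap.mem_ker] at this
      rw [hLe] at hf1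
      exact hf1 this
    · intro k
      refine Fin.lastCases ?_ (fun k => ?_) k
      · simpa using hf2
      · simpa using hbP k
    · intro i j hij
      induction j using Fin.lastCases with
      | last =>
        induction i using Fin.lastCases with
        | last => exact absurd hij (lt_irrefl _)
        | cast i => simpa using hD i f (hf3 i)
      | cast j =>
        induction i using Fin.lastCases with
        | last => exact absurd hij (not_lt.2 (Fin.le_last _))
        | cast i => simpa using hbs i j (by simpa using hij)

lemma sep_roots (p : Polynomial ℂ) (hp : p.Separable) {m : ℕ} (hm : p.natDegree = m) :
    ∃ a : Fin m → ℂ, Function.Injective a ∧ ∀ z, p.eval z = p.leadingCoeff * ∏ r, (z - a r) := by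
  have hs := IsAlgClosed.splits p
  have hnd := Polynomial.nodup_roots hp
  have hcard : p.roots.card = m := by rw [← hm, hs.natDegree_eq_card_roots]
  have hlen : p.roots.toList.length = m := by simpa using hcard
  subst hlen
  refine ⟨p.roots.toList.get, ?_, fun z => ?_⟩
  · exact List.nodup_iff_injective_get.1 (by rw [← Multiset.coe_nodup]; simpa using hnd)
  · conv_lhs => rw [hs.eq_prod_roots]
    rw [Polynomial.eval_mul, Polynomial.eval_C, Polynomial.eval_multiset_prod, Multiset.map_map]
    congr 1
    conv_lhs => rw [← Multiset.coe_toList p.roots, Multiset.map_coe, Multiset.prod_coe]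
    rw [← Fin.prod_univ_fun_getElem]
    simp

lemma line_roots {P : MvPolynomial (Fin d) ℝ} {m : ℕ} (hP : P.IsHomogeneous m) (f e : Fin d → ℝ)
    (he : MvPolynomial.eval e P ≠ 0) (hs : (pl P f e).Separable) :
    ∃ κ : ℝ, 0 < κ ∧ κ ≤ 1 ∧ ∃ a : Fin m → ℂ, Function.Injective a ∧ (∀ r, ‖a r‖ ≤ 1/2) ∧
      ∀ s t : ℂ, MvPolynomial.aeval (fun k => (κ:ℂ) * s * (f k : ℂ) + t * (e k : ℂ)) P
        = ((MvPolynomial.eval e P : ℝ) : ℂ) * ∏ r, (t - a r * s) := by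
  set p : Polynomial ℂ := (pl P f e).map (algebraMap ℝ ℂ) with hp
  have hdeg := pl_deg hP f e
  have hn : (pl P f e).natDegree = m :=
    le_antisymm hdeg.1 (Polynomial.le_natDegree_of_ne_zero (by rw [hdeg.2]; simpa using he))
  have hpn : p.natDegree = m := by rw [hp, Polynomial.natDegree_map, hn]
  have hpl : p.leadingCoeff = ((MvPolynomial.eval e P : ℝ) : ℂ) := by
    rw [hp, Polynomial.leadingCoeff_map, Polynomial.leadingCoeff, hn, hdeg.2]
    simp
  obtain ⟨a', ha', hprod⟩ := sep_roots p (hs.map) hpn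
  have hpe : ∀ z : ℂ, p.eval z = MvPolynomial.aeval (fun k => (f k : ℂ) + z * (e k:ℂ)) P := by
    intro z
    have h1 := pl_map (Complex.ofRealAm) P f e
    have h2 : p = pl P (fun i => Complex.ofRealAm (f i)) e := h1
    rw [h2]
    unfold pl
    have := MvPolynomial.comp_aeval_apply (R := ℝ) (fun i => Polynomial.C (Complex.ofRealAm (f i)) + Polynomial.C (algebraMap ℝ ℂ (e i)) * Polynomial.X)
      ((Polynomial.aeval (R := ℂ) z).restrictScalars ℝ) P
    have h3 : ∀ q : Polynomial ℂ, (Polynomial.aeval (R := ℂ) z).restrictScalars ℝ q = q.eval z := by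
      intro q
      simp [Polynomial.aeval_def, Polynomial.eval₂_eq_eval_map]
    rw [h3] at this
    rw [this]
    congr 2
    ext i
    rw [h3]
    simp only [Polynomial.eval_add, Polynomial.eval_C, Polynomial.eval_mul, Polynomial.eval_X]
    rw [mul_comm]; rfl
  -- scale
  set M : ℝ := ∑ r, ‖a' r‖ with hM
  have hM0 : 0 ≤ M := Finset.sum_nonneg fun r _ => norm_nonneg _
  set κ : ℝ := 1 / (2 * (M + 1)) with hκ
  have hκ0 : 0 < κ := by positivity
  refine ⟨κ, hκ0, ?_, fun r => κ * a' r, ?_, ?_, ?_⟩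
  · rw [hκ, div_le_one (by positivity)]; linarith
  · intro r s hrs
    apply ha'
    have : (κ:ℂ) ≠ 0 := by exact_mod_cast hκ0.ne'
    exact mul_left_cancel₀ this hrs
  · intro r
    rw [norm_mul, Complex.norm_real, Real.norm_of_nonneg hκ0.le, hκ]
    have : ‖a' r‖ ≤ M := Finset.single_le_sum (f := fun r => ‖a' r‖) (fun r _ => norm_nonneg _) (Finset.mem_univ r)
    rw [div_mul_eq_mul_div, div_le_div_iff₀ (by positivity) (by norm_num)]
    nlinarith
  · intro s t
    by_cases hs0 : s = 0
    · subst hs0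
      have h6 : MvPolynomial.aeval (fun i => ((e i:ℝ):ℂ)) P = ((MvPolynomial.eval e P : ℝ) : ℂ) := by
        have := MvPolynomial.comp_aeval_apply (R := ℝ) e Complex.ofRealAm P
        simpa using! this.symm
      have := hom_scale hP t (fun k => ((e k : ℝ):ℂ))
      rw [h6] at this
      simp [this, mul_comm]
    · have hκc : (κ:ℂ) ≠ 0 := by exact_mod_cast hκ0.ne'
      have hks : (κ:ℂ) * s ≠ 0 := mul_ne_zero hκc hs0
      have h1 := hom_scale hP (κ * s : ℂ) (fun k => (f k : ℂ) + (t / (κ * s)) * (e k:ℂ))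
      have h2 : (fun k => (κ:ℂ) * s * (f k : ℂ) + t * (e k : ℂ)) =
          fun k => (κ * s : ℂ) * ((f k : ℂ) + (t / (κ * s)) * (e k:ℂ)) := by
        ext k; field_simp
      rw [h2, h1, ← hpe, hprod, hpl]
      have h3 : (κ * s : ℂ)^m = ∏ _r : Fin m, (κ * s : ℂ) := by simp
      rw [h3, mul_left_comm, ← Finset.prod_mul_distrib]
      congr 1
      refine Finset.prod_congr rfl fun r _ => ?_
      field_simp

end Basis
end SSM

namespace SSM

section LA
variable {d : ℕ}

structure Ell (d : ℕ) (lam : ℝ) (A B : Matrix (Fin d) (Fin d) ℝ) : Prop where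
  aS : ∀ i j, A i j = A j i
  bS : ∀ i j, B i j = B j i
  ab : ∀ i k, ∑ j, A i j * B j k = if i = k then 1 else 0
  qlo : ∀ x : EuclideanSpace ℝ (Fin d), ‖x‖^2 ≤ bform B x x
  qhi : ∀ x : EuclideanSpace ℝ (Fin d), bform B x x ≤ 1 / lam * ‖x‖^2
  aB : ∀ i j, |A i j| ≤ 1
  bB : ∀ i j, |B i j| ≤ 1 / lam
  low : ∀ x : EuclideanSpace ℝ (Fin d), lam * ‖x‖^2 ≤ bform A x x

lemma bform_symm {M : Matrix (Fin d) (Fin d) ℝ} (hM : ∀ i j, M i j = M j i) (x y) : bform M x y = bform M y x := by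
  unfold bform
  rw [Finset.sum_comm]
  refine Finset.sum_congr rfl fun i _ => Finset.sum_congr rfl fun j _ => ?_
  rw [hM j i]; ring

lemma bform_add_smul {M : Matrix (Fin d) (Fin d) ℝ} (hM : ∀ i j, M i j = M j i)
    (x y : EuclideanSpace ℝ (Fin d)) (t : ℝ) :
    bform M (x + t • y) (x + t • y) = bform M x x + 2 * t * bform M x y + t^2 * bform M y y := by
  have h : bform M (x + t • y) (x + t • y) = bform M x x + t * bform M x y + t * bform M y x + t^2 * bform M y y := by
    unfold bform
    simp only [Finset.mul_sum, ← Finset.sum_add_distrib]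
    refine Finset.sum_congr rfl fun i _ => Finset.sum_congr rfl fun j _ => ?_
    simp only [PiLp.add_apply, PiLp.smul_apply, smul_eq_mul]
    ring
  rw [h, bform_symm hM y x]; ring

lemma bform_single (M : Matrix (Fin d) (Fin d) ℝ) (i j : Fin d) :
    bform M (EuclideanSpace.single j 1) (EuclideanSpace.single i 1) = M i j := by
  unfold bform
  simp [PiLp.single_apply]

lemma polar {M : Matrix (Fin d) (Fin d) ℝ} (hM : ∀ i j, M i j = M j i) {K : ℝ} (hK : 0 ≤ K)
    (h0 : ∀ x, 0 ≤ bform M x x) (h1 : ∀ x, bform M x x ≤ K * ‖x‖^2) (i j : Fin d) : |M i j| ≤ K := by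
  have key : ∀ t : ℝ, |t| = 1 → bform M (EuclideanSpace.single j 1 + t • EuclideanSpace.single i 1) (EuclideanSpace.single j 1 + t • EuclideanSpace.single i 1) ≤ K * 4 := by
    intro t ht
    refine (h1 _).trans (mul_le_mul_of_nonneg_left ?_ hK)
    have : ‖(EuclideanSpace.single j (1:ℝ) : EuclideanSpace ℝ (Fin d)) + t • EuclideanSpace.single i 1‖ ≤ 2 := by
      refine (norm_add_le _ _).trans ?_
      rw [norm_smul, Real.norm_eq_abs, ht]
      simp; norm_num
    nlinarith [norm_nonneg ((EuclideanSpace.single j (1:ℝ) : EuclideanSpace ℝ (Fin d)) + t • EuclideanSpace.single i 1)]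
  have k1 := key 1 (by simp)
  have k2 := key (-1) (by simp)
  have p1 := h0 (EuclideanSpace.single j 1 + (1:ℝ) • EuclideanSpace.single i 1)
  have p2 := h0 (EuclideanSpace.single j 1 + (-1:ℝ) • EuclideanSpace.single i 1)
  rw [bform_add_smul hM, bform_single M i j] at k1 k2 p1 p2
  rw [abs_le]
  constructor <;> linarith

lemma bform_mulVec (M : Matrix (Fin d) (Fin d) ℝ) (x y : EuclideanSpace ℝ (Fin d)) :
    bform M x y = ∑ i, (∑ j, M i j * x j) * y i := by
  unfold bform
  simp_rw [Finset.sum_mul]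

theorem ell_exists {lam : ℝ} (hl : 0 < lam) {A : Matrix (Fin d) (Fin d) ℝ} (hA : A.IsSymm)
    (h : ∀ ξ : EuclideanSpace ℝ (Fin d), lam * ‖ξ‖ ^ 2 ≤ bform A ξ ξ ∧ bform A ξ ξ ≤ ‖ξ‖ ^ 2) :
    ∃ B, Ell d lam A B := by
  have aS : ∀ i j, A i j = A j i := fun i j => hA.apply j i
  have hdet : A.det ≠ 0 := by
    intro h0
    obtain ⟨v, hv, hv0⟩ := Matrix.exists_mulVec_eq_zero_iff.2 h0
    have h1 := (h (WithLp.toLp 2 v)).1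
    rw [bform_mulVec] at h1
    have h2 : ∀ i, ∑ j, A i j * (WithLp.toLp 2 v : EuclideanSpace ℝ (Fin d)) j = 0 := fun i => by
      have := congrFun hv0 i
      simpa [Matrix.mulVec, dotProduct] using this
    simp_rw [h2] at h1
    simp only [zero_mul, Finset.sum_const_zero] at h1
    have h3 : ‖(WithLp.toLp 2 v : EuclideanSpace ℝ (Fin d))‖ ≠ 0 := by
      rw [norm_ne_zero_iff]; simpa using hv
    have : 0 < ‖(WithLp.toLp 2 v : EuclideanSpace ℝ (Fin d))‖^2 := by positivity
    nlinarith
  have hu : IsUnit A.det := hdet.isUnit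
  have bS : ∀ i j, A⁻¹ i j = A⁻¹ j i := fun i j => by
    have : (A⁻¹).IsSymm := by
      unfold Matrix.IsSymm
      rw [Matrix.transpose_nonsing_inv, hA.eq]
    exact this.apply j i
  have ab : ∀ i k, ∑ j, A i j * A⁻¹ j k = if i = k then 1 else 0 := by
    intro i k
    have := congrFun (congrFun (Matrix.mul_nonsing_inv A hu) i) k
    rw [Matrix.mul_apply, Matrix.one_apply] at this
    exact this
  -- y = B x
  let y : EuclideanSpace ℝ (Fin d) → EuclideanSpace ℝ (Fin d) := fun x => WithLp.toLp 2 (fun i => ∑ j, A⁻¹ i j * x j)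
  have hAy : ∀ x i, ∑ j, A i j * y x j = x i := by
    intro x i
    simp only [y, Finset.mul_sum]
    rw [Finset.sum_comm]
    simp_rw [← mul_assoc, ← Finset.sum_mul, ab]
    simp
  have hAyz : ∀ x z, bform A (y x) z = ∑ i, x i * z i := by
    intro x z
    rw [bform_mulVec]
    simp_rw [hAy]
  have hB : ∀ x, bform A⁻¹ x x = ∑ i, y x i * x i := fun x => bform_mulVec _ _ _
  have hBA : ∀ x, bform A (y x) (y x) = bform A⁻¹ x x := fun x => by
    rw [hAyz, hB]
    exact Finset.sum_congr rfl fun i _ => mul_comm _ _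
  have hnorm : ∀ x : EuclideanSpace ℝ (Fin d), ∑ i, x i * x i = ‖x‖^2 := fun x => by
    rw [EuclideanSpace.norm_sq_eq]
    exact Finset.sum_congr rfl fun i _ => by rw [Real.norm_eq_abs, sq_abs]; ring
  have qlo : ∀ x, ‖x‖^2 ≤ bform A⁻¹ x x := by
    intro x
    have h1 := (h (y x + (-1:ℝ) • x)).1
    have h2 : 0 ≤ bform A (y x + (-1:ℝ) • x) (y x + (-1:ℝ) • x) := le_trans (by positivity) h1
    rw [bform_add_smul aS, hBA, hAyz, hnorm] at h2
    have := (h x).2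
    linarith
  have qhi : ∀ x, bform A⁻¹ x x ≤ 1 / lam * ‖x‖^2 := by
    intro x
    have h1 := (h (x + (-lam) • y x)).1
    have h1 := (h (y x)).1
    rw [hBA] at h1
    have h2 : 2 * bform A⁻¹ x x ≤ lam * ‖y x‖^2 + 1/lam * ‖x‖^2 := by
      rw [hB, ← hnorm, ← hnorm, Finset.mul_sum, Finset.mul_sum, Finset.mul_sum, ← Finset.sum_add_distrib]
      refine Finset.sum_le_sum fun i _ => ?_
      have h3 : lam * (y x i * y x i) + 1/lam * (x i * x i) - 2 * (y x i * x i) = 1/lam * (lam * y x i - x i)^2 := by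
        field_simp; ring
      have : 0 ≤ 1/lam * (lam * y x i - x i)^2 := by positivity
      linarith
    linarith
  exact ⟨A⁻¹, aS, bS, ab, qlo, qhi,
    polar aS zero_le_one (fun x => le_trans (by positivity) (h x).1) (fun x => by simpa using (h x).2),
    polar bS (by positivity) (fun x => le_trans (by positivity) (qlo x)) qhi, fun x => (h x).1⟩

end LA
end SSM

namespace SSM

section VW
variable {d : ℕ}

def pd (i : Fin d) (f : EuclideanSpace ℝ (Fin d) → ℝ) (y : EuclideanSpace ℝ (Fin d)) : ℝ :=
  fderiv ℝ f y (EuclideanSpace.single i 1)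

lemma grad_coord (f : EuclideanSpace ℝ (Fin d) → ℝ) (x : EuclideanSpace ℝ (Fin d)) (i : Fin d) :
    gradient f x i = pd i f x := by
  unfold gradient pd
  rw [← InnerProductSpace.toDual_symm_apply (𝕜 := ℝ), EuclideanSpace.inner_single_right]
  simp

lemma pd_zero_of_notMem {f : EuclideanSpace ℝ (Fin d) → ℝ} {x} (i : Fin d) (h : x ∉ tsupport f) : pd i f x = 0 := by
  unfold pd
  rw [notMem_tsupport_iff_eventuallyEq] at h
  rw [h.fderiv_eq]
  simp

lemma tsupport_pd (i : Fin d) (f : EuclideanSpace ℝ (Fin d) → ℝ) : tsupport (pd i f) ⊆ tsupport f := by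
  apply closure_minimal _ (isClosed_tsupport f)
  intro x hx
  by_contra h
  exact hx (pd_zero_of_notMem i h)

lemma pd_contDiff {n : ℕ∞} {f : EuclideanSpace ℝ (Fin d) → ℝ} (hf : ContDiff ℝ (n + 1 : ℕ∞) f) (i : Fin d) :
    ContDiff ℝ n (pd i f) := by
  unfold pd
  exact (hf.fderiv_right (m := n) (by norm_cast)).clm_apply contDiff_const

lemma pd_contDiff_top {f : EuclideanSpace ℝ (Fin d) → ℝ} (hf : ContDiff ℝ (⊤ : ℕ∞) f) (i : Fin d) :
    ContDiff ℝ (⊤ : ℕ∞) (pd i f) := pd_contDiff (n := ⊤) (by simpa using hf) i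

lemma cd_mul {u g : EuclideanSpace ℝ (Fin d) → ℝ} {O : Set (EuclideanSpace ℝ (Fin d))} (hO : IsOpen O)
    (hu : ContDiffOn ℝ 1 u O) (hg : ContDiff ℝ 1 g) (hs : tsupport g ⊆ O) : ContDiff ℝ 1 (fun x => u x * g x) := by
  rw [contDiff_iff_contDiffAt]
  intro x
  by_cases hx : x ∈ tsupport g
  · exact (hu.contDiffAt (hO.mem_nhds (hs hx))).mul hg.contDiffAt
  · rw [notMem_tsupport_iff_eventuallyEq] at hx
    have : (fun x => u x * g x) =ᶠ[nhds x] fun _ => 0 := by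
      filter_upwards [hx] with y hy
      simp [hy]
    exact contDiffAt_const.congr_of_eventuallyEq this

lemma cs_mul (u : EuclideanSpace ℝ (Fin d) → ℝ) {g : EuclideanSpace ℝ (Fin d) → ℝ} (hg : HasCompactSupport g) :
    HasCompactSupport (fun x => u x * g x) := hg.mul_left

lemma fderiv_mul_supp {u g : EuclideanSpace ℝ (Fin d) → ℝ} {O : Set (EuclideanSpace ℝ (Fin d))} (hO : IsOpen O)
    (hu : ContDiffOn ℝ 1 u O) (hg : ContDiff ℝ 1 g) (hs : tsupport g ⊆ O) (j : Fin d) (x) :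
    pd j (fun x => u x * g x) x = pd j u x * g x + u x * pd j g x := by
  by_cases hx : x ∈ tsupport g
  · have h1 : DifferentiableAt ℝ u x := (hu.contDiffAt (hO.mem_nhds (hs hx))).differentiableAt (by norm_num)
    have h2 : DifferentiableAt ℝ g x := hg.contDiffAt.differentiableAt (by norm_num)
    unfold pd
    rw [fderiv_fun_mul h1 h2]
    simp; ring
  · have h1 : g x = 0 := image_eq_zero_of_notMem_tsupport hx
    have h2 := pd_zero_of_notMem j hx
    rw [h1, h2]
    have : x ∉ tsupport (fun x => u x * g x) := fun h => hx ((tsupport_mul_subset_right) h)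
    rw [pd_zero_of_notMem j this]; simp

/-- integrability + IBP for `u` C¹ on open `O`, `g` C¹ compactly supported in `O` -/
lemma ibp1 {u g : EuclideanSpace ℝ (Fin d) → ℝ} {O : Set (EuclideanSpace ℝ (Fin d))} (hO : IsOpen O)
    (hu : ContDiffOn ℝ 1 u O) (hg : ContDiff ℝ 1 g) (hc : HasCompactSupport g) (hs : tsupport g ⊆ O) (j : Fin d) :
    Integrable (fun x => pd j u x * g x) ∧ Integrable (fun x => u x * pd j g x) ∧
    ∫ x, pd j u x * g x = - ∫ x, u x * pd j g x := by
  have hw := cd_mul hO hu hg hs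
  have hwc := cs_mul u hc
  have hI := ibp0 hw hwc (EuclideanSpace.single j 1)
  have hdc : Continuous (pd j (fun x => u x * g x)) := by
    unfold pd
    exact (hw.continuous_fderiv (by norm_num)).clm_apply continuous_const
  have i1 : Integrable (pd j (fun x => u x * g x)) :=
    hdc.integrable_of_hasCompactSupport (hwc.of_isClosed_subset (isClosed_tsupport _) (tsupport_pd j _))
  have hpg : HasCompactSupport (pd j g) := hc.of_isClosed_subset (isClosed_tsupport _) (tsupport_pd j g)
  have hpc : Continuous (pd j g) := by
    unfold pd
    exact (hg.continuous_fderiv (by norm_num)).clm_apply continuous_const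
  have hcont : Continuous (fun x => u x * pd j g x) := by
    rw [continuous_iff_continuousAt]
    intro x
    by_cases hx : x ∈ tsupport g
    · exact (hu.contDiffAt (hO.mem_nhds (hs hx))).continuousAt.mul hpc.continuousAt
    · have hx' : x ∉ tsupport (pd j g) := fun h => hx (tsupport_pd j g h)
      rw [notMem_tsupport_iff_eventuallyEq] at hx'
      have : (fun x => u x * pd j g x) =ᶠ[nhds x] fun _ => 0 := by
        filter_upwards [hx'] with y hy
        simp [hy]
      exact continuousAt_const.congr this.symm
  have i2 : Integrable (fun x => u x * pd j g x) := hcont.integrable_of_hasCompactSupport hpg.mul_left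
  have heq : (fun x => pd j u x * g x) = fun x => pd j (fun x => u x * g x) x - u x * pd j g x := by
    ext x
    rw [fderiv_mul_supp hO hu hg hs]; ring
  refine ⟨by rw [heq]; exact i1.sub i2, i2, ?_⟩
  rw [heq, integral_sub i1 i2]
  have : ∫ x, pd j (fun x => u x * g x) x = 0 := hI
  rw [this, zero_sub]

def Lop (A : Matrix (Fin d) (Fin d) ℝ) (ψ : EuclideanSpace ℝ (Fin d) → ℝ) (y : EuclideanSpace ℝ (Fin d)) : ℝ :=
  ∑ i, ∑ j, A i j * pd j (pd i ψ) y

theorem vweak {A : Matrix (Fin d) (Fin d) ℝ} {u : EuclideanSpace ℝ (Fin d) → ℝ}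
    (hu : IsWeakSol (fun _ => A) (ball 0 1) u) {ψ : EuclideanSpace ℝ (Fin d) → ℝ}
    (hψ : ContDiff ℝ (⊤ : ℕ∞) ψ) (hc : HasCompactSupport ψ) (hs : tsupport ψ ⊆ ball 0 1) :
    ∫ y, u y * Lop A ψ y = 0 := by
  obtain ⟨hu1, hu2⟩ := hu
  have h0 := hu2 ψ hψ hc hs
  have hb := fun i j => ibp1 isOpen_ball hu1 (g := pd i ψ) ((pd_contDiff_top hψ i).of_le (by norm_cast))
    (hc.of_isClosed_subset (isClosed_tsupport _) (tsupport_pd i _)) ((tsupport_pd i ψ).trans hs) j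
  have h1 : ∫ x in ball (0 : EuclideanSpace ℝ (Fin d)) 1, bform A (gradient u x) (gradient ψ x)
      = ∫ x, ∑ i, ∑ j, A i j * (pd j u x * pd i ψ x) := by
    rw [setIntegral_eq_integral_of_forall_compl_eq_zero]
    · simp only [bform, grad_coord, mul_assoc]
    · intro x hx
      unfold bform
      refine Finset.sum_eq_zero fun i _ => Finset.sum_eq_zero fun j _ => ?_
      rw [grad_coord ψ, pd_zero_of_notMem i (fun h => hx (hs h)), mul_zero]
  rw [h1, integral_finsetSum] at h0
  swap
  · intro i _
    exact integrable_finsetSum _ fun j _ => ((hb i j).1).const_mul _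
  have h2 : ∀ i, ∫ x, ∑ j, A i j * (pd j u x * pd i ψ x) = - ∫ x, ∑ j, A i j * (u x * pd j (pd i ψ) x) := by
    intro i
    rw [integral_finsetSum _ fun j _ => ((hb i j).1).const_mul _, integral_finsetSum _ fun j _ => ((hb i j).2.1).const_mul _,
      ← Finset.sum_neg_distrib]
    refine Finset.sum_congr rfl fun j _ => ?_
    rw [integral_const_mul, integral_const_mul, (hb i j).2.2]; ring
  simp_rw [h2] at h0
  rw [Finset.sum_neg_distrib, neg_eq_zero, ← integral_finsetSum] at h0
  · rw [← h0]
    congr 1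
    ext x
    unfold Lop
    simp_rw [Finset.mul_sum]
    refine Finset.sum_congr rfl fun i _ => Finset.sum_congr rfl fun j _ => ?_
    ring
  · intro i _
    exact integrable_finsetSum _ fun j _ => ((hb i j).2.1).const_mul _

lemma pd_mul' {f g : EuclideanSpace ℝ (Fin d) → ℝ} (hf : Differentiable ℝ f) (hg : Differentiable ℝ g) (i : Fin d) :
    pd i (fun y => f y * g y) = fun y => pd i f y * g y + f y * pd i g y := by
  ext y
  unfold pd
  rw [fderiv_fun_mul (hf y) (hg y)]
  simp; ring

lemma pd_add' {f g : EuclideanSpace ℝ (Fin d) → ℝ} (hf : Differentiable ℝ f) (hg : Differentiable ℝ g) (i : Fin d) :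
    pd i (fun y => f y + g y) = fun y => pd i f y + pd i g y := by
  ext y
  unfold pd
  rw [fderiv_fun_add (hf y) (hg y)]
  simp

lemma pd_comp {F F' : ℝ → ℝ} {q : EuclideanSpace ℝ (Fin d) → ℝ} (hF : ∀ y, HasDerivAt F (F' (q y)) (q y))
    (hq : Differentiable ℝ q) (i : Fin d) :
    pd i (fun y => F (q y)) = fun y => F' (q y) * pd i q y := by
  ext y
  unfold pd
  have := ((hF y).comp_hasFDerivAt y (hq y).hasFDerivAt).fderiv
  rw [show fderiv ℝ (fun y => F (q y)) y = _ from this]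
  simp

/-- product rule for `Lop` -/
lemma Lop_mul {A : Matrix (Fin d) (Fin d) ℝ} (aS : ∀ i j, A i j = A j i) {f g : EuclideanSpace ℝ (Fin d) → ℝ}
    (hf : ContDiff ℝ (⊤ : ℕ∞) f) (hg : ContDiff ℝ (⊤ : ℕ∞) g) (y) :
    Lop A (fun y => f y * g y) y = f y * Lop A g y + 2 * (∑ i, ∑ j, A i j * pd j f y * pd i g y) + g y * Lop A f y := by
  have df := hf.differentiable (by simp)
  have dg := hg.differentiable (by simp)
  have dpf := fun i => (pd_contDiff_top hf i).differentiable (by simp)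
  have dpg := fun i => (pd_contDiff_top hg i).differentiable (by simp)
  have h1 : ∀ i j, pd j (pd i (fun y => f y * g y)) y
      = f y * pd j (pd i g) y + (pd j f y * pd i g y + pd i f y * pd j g y) + g y * pd j (pd i f) y := by
    intro i j
    rw [pd_mul' df dg, pd_add' ((dpf i).fun_mul dg) (df.fun_mul (dpg i)), pd_mul' (dpf i) dg, pd_mul' df (dpg i)]
    ring
  have h2 : ∑ i, ∑ j, A i j * (pd i f y * pd j g y) = ∑ i, ∑ j, A i j * pd j f y * pd i g y := by
    rw [Finset.sum_comm]
    refine Finset.sum_congr rfl fun i _ => Finset.sum_congr rfl fun j _ => ?_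
    rw [aS j i]; ring
  unfold Lop
  rw [two_mul]
  nth_rewrite 2 [← h2]
  simp_rw [h1, Finset.mul_sum, ← Finset.sum_add_distrib]
  refine Finset.sum_congr rfl fun i _ => Finset.sum_congr rfl fun j _ => ?_
  ring

end VW
end SSM

namespace SSM

section FS
variable {d : ℕ}

def gamR (d : ℕ) (t : ℝ) : ℝ := if d = 2 then Real.log t else t ^ (1 - (d : ℝ) / 2) / (1 - (d : ℝ) / 2)
def gamC (d : ℕ) (t : ℂ) : ℂ := if d = 2 then Complex.log t else t ^ (1 - (d : ℂ) / 2) / (1 - (d : ℂ) / 2)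

lemma gam_real {t : ℝ} (ht : 0 < t) : gamC d (t : ℂ) = (gamR d t : ℂ) := by
  unfold gamC gamR
  split_ifs
  · rw [Complex.ofReal_log ht.le]
  · push_cast
    rw [Complex.ofReal_cpow ht.le]
    push_cast
    rfl

lemma gamC_diff {z : ℂ} (hz : 0 < z.re) : DifferentiableAt ℂ (gamC d) z := by
  unfold gamC
  have hs : z ∈ Complex.slitPlane := Or.inl hz
  split_ifs
  · exact Complex.differentiableAt_log hs
  · exact (DifferentiableAt.cpow differentiableAt_id (differentiableAt_const _) hs).div_const _

lemma gamR_deriv {t : ℝ} (ht : 0 < t) : HasDerivAt (gamR d) (t ^ (-(d : ℝ) / 2)) t := by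
  by_cases h : d = 2
  · have : gamR d = Real.log := by ext s; simp [gamR, h]
    rw [this]
    convert Real.hasDerivAt_log ht.ne' using 1
    subst h
    norm_num
    rw [Real.rpow_neg_one]
  · have : gamR d = fun t => t ^ (1 - (d : ℝ) / 2) / (1 - (d : ℝ) / 2) := by ext s; simp [gamR, h]
    rw [this]
    have hd : (1 - (d : ℝ) / 2) ≠ 0 := by
      intro h0
      apply h
      have : (d : ℝ) = 2 := by linarith
      exact_mod_cast this
    have := (Real.hasDerivAt_rpow_const (p := 1 - (d : ℝ) / 2) (Or.inl ht.ne')).div_const (1 - (d : ℝ) / 2)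
    have e : (1 - (d : ℝ) / 2) * t ^ (1 - (d : ℝ) / 2 - 1) / (1 - (d : ℝ) / 2) = t ^ (-(d : ℝ) / 2) := by
      rw [mul_comm, mul_div_assoc, div_self hd, mul_one]
      congr 1
      ring
    rw [← e]
    exact this

lemma gamR_contDiffAt {t : ℝ} (ht : 0 < t) : ContDiffAt ℝ (⊤ : ℕ∞) (gamR d) t := by
  by_cases h : d = 2
  · have : gamR d = Real.log := by ext s; simp [gamR, h]
    rw [this]
    exact Real.contDiffAt_log.2 ht.ne'
  · have : gamR d = fun t => t ^ (1 - (d : ℝ) / 2) / (1 - (d : ℝ) / 2) := by ext s; simp [gamR, h]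
    rw [this]
    exact (Real.contDiffAt_rpow_const_of_ne ht.ne').div_const _

/-- regularised quadratic form -/
def qe (B : Matrix (Fin d) (Fin d) ℝ) (ε : ℝ) (x y : EuclideanSpace ℝ (Fin d)) : ℝ := ε ^ 2 + bform B (y - x) (y - x)

def lin (B : Matrix (Fin d) (Fin d) ℝ) (x : EuclideanSpace ℝ (Fin d)) (i : Fin d) (y : EuclideanSpace ℝ (Fin d)) : ℝ :=
  2 * ∑ k, B i k * (y k - x k)

lemma pd_coord (i k : Fin d) (c : ℝ) (y) : pd i (fun y => y k - c) y = if i = k then 1 else 0 := by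
  unfold pd
  rw [fderiv_sub_const]
  have : (fun y : EuclideanSpace ℝ (Fin d) => y k) = (EuclideanSpace.proj k : EuclideanSpace ℝ (Fin d) →L[ℝ] ℝ) := rfl
  rw [this, ContinuousLinearMap.fderiv]
  simp [eq_comm]

lemma coord_contDiff (k : Fin d) (c : ℝ) : ContDiff ℝ (⊤ : ℕ∞) (fun y : EuclideanSpace ℝ (Fin d) => y k - c) := by
  fun_prop

lemma pd_sum' {ι : Type*} (s : Finset ι) {f : ι → EuclideanSpace ℝ (Fin d) → ℝ} (hf : ∀ k, Differentiable ℝ (f k)) (i : Fin d) (y) :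
    pd i (fun y => ∑ k ∈ s, f k y) y = ∑ k ∈ s, pd i (f k) y := by
  unfold pd
  rw [fderiv_fun_sum fun k _ => hf k y]
  simp

lemma pd_const_mul {f : EuclideanSpace ℝ (Fin d) → ℝ} (hf : Differentiable ℝ f) (c : ℝ) (i : Fin d) (y) :
    pd i (fun y => c * f y) y = c * pd i f y := by
  unfold pd
  rw [fderiv_const_mul (hf y)]
  simp

lemma lin_contDiff (B : Matrix (Fin d) (Fin d) ℝ) (x i) : ContDiff ℝ (⊤ : ℕ∞) (lin B x i) := by
  unfold lin; fun_prop

lemma pd_lin (B : Matrix (Fin d) (Fin d) ℝ) (x) (i j : Fin d) (y) : pd j (lin B x i) y = 2 * B i j := by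
  have hd : ∀ k, Differentiable ℝ (fun y : EuclideanSpace ℝ (Fin d) => y k - x k) :=
    fun k => (coord_contDiff k _).differentiable (by simp)
  unfold lin
  rw [pd_const_mul (by fun_prop), pd_sum' _ (fun k => (hd k).const_mul _)]
  simp_rw [pd_const_mul (hd _), pd_coord]
  simp

lemma qe_eq (B : Matrix (Fin d) (Fin d) ℝ) (ε x y) :
    qe B ε x y = ε ^ 2 + ∑ i, ∑ j, B i j * ((y j - x j) * (y i - x i)) := by
  unfold qe bform
  simp [mul_assoc]

lemma qe_contDiff (B : Matrix (Fin d) (Fin d) ℝ) (ε x) : ContDiff ℝ (⊤ : ℕ∞) (qe B ε x) := by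
  have : qe B ε x = fun y => ε ^ 2 + ∑ i, ∑ j, B i j * ((y j - x j) * (y i - x i)) := by
    ext y; exact qe_eq B ε x y
  rw [this]; fun_prop

lemma pd_qe {B : Matrix (Fin d) (Fin d) ℝ} (bS : ∀ i j, B i j = B j i) (ε x) (i : Fin d) :
    pd i (qe B ε x) = lin B x i := by
  ext y
  have : qe B ε x = fun y => (fun _ => ε ^ 2) y + (∑ i, ∑ j, B i j * ((y j - x j) * (y i - x i))) := by
    ext y; exact qe_eq B ε x y
  have hd : ∀ k, Differentiable ℝ (fun y : EuclideanSpace ℝ (Fin d) => y k - x k) :=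
    fun k => (coord_contDiff k _).differentiable (by simp)
  rw [this, pd_add' (by fun_prop) (by fun_prop)]
  have h0 : pd i (fun _ : EuclideanSpace ℝ (Fin d) => ε ^ 2) y = 0 := by unfold pd; simp
  simp only [h0, zero_add]
  rw [pd_sum' _ (fun k => by fun_prop)]
  have h1 : ∀ k, pd i (fun y => ∑ j, B k j * ((y j - x j) * (y k - x k))) y
      = ∑ j, B k j * ((if i = j then 1 else 0) * (y k - x k) + (y j - x j) * (if i = k then 1 else 0)) := by
    intro k
    rw [pd_sum' _ (fun j => by fun_prop)]
    refine Finset.sum_congr rfl fun j _ => ?_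
    rw [pd_const_mul ((hd j).fun_mul (hd k)), pd_mul' (hd j) (hd k)]
    beta_reduce
    rw [pd_coord, pd_coord]
  simp_rw [h1, mul_add, Finset.sum_add_distrib]
  unfold lin
  simp only [ite_mul, one_mul, zero_mul, mul_ite, mul_zero, mul_one, Finset.sum_ite_eq, Finset.mem_univ, if_true]
  rw [Finset.sum_comm (f := fun k j => if i = k then B k j * (y j - x j) else 0)]
  simp only [Finset.sum_ite_eq, Finset.mem_univ, if_true]
  rw [two_mul]
  congr 1
  exact Finset.sum_congr rfl fun j _ => by rw [bS]

lemma qe_pos {lam : ℝ} {A B : Matrix (Fin d) (Fin d) ℝ} (h : Ell d lam A B) {ε : ℝ} (hε : 0 < ε) (x y) : 0 < qe B ε x y := by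
  unfold qe
  have := h.qlo (y - x)
  have h2 := sq_nonneg ‖y - x‖
  have := pow_pos hε 2
  linarith

lemma fs_contDiff {lam : ℝ} {A B : Matrix (Fin d) (Fin d) ℝ} (h : Ell d lam A B) {ε : ℝ} (hε : 0 < ε) (x) :
    ContDiff ℝ (⊤ : ℕ∞) (fun y => gamR d (qe B ε x y)) := by
  rw [contDiff_iff_contDiffAt]
  intro y
  exact (gamR_contDiffAt (qe_pos h hε x y)).comp y (qe_contDiff B ε x).contDiffAt

lemma pd_fs {lam : ℝ} {A B : Matrix (Fin d) (Fin d) ℝ} (h : Ell d lam A B) {ε : ℝ} (hε : 0 < ε) (x) (i : Fin d) :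
    pd i (fun y => gamR d (qe B ε x y)) = fun y => (qe B ε x y) ^ (-(d : ℝ) / 2) * lin B x i y := by
  rw [pd_comp (F' := fun t => t ^ (-(d : ℝ) / 2)) (fun y => gamR_deriv (qe_pos h hε x y)) ((qe_contDiff B ε x).differentiable (by simp)),
    pd_qe h.bS]

lemma ell_lin {lam : ℝ} {A B : Matrix (Fin d) (Fin d) ℝ} (h : Ell d lam A B) (x y) (i : Fin d) :
    ∑ j, A i j * lin B x j y = 2 * (y i - x i) := by
  unfold lin
  simp_rw [Finset.mul_sum]
  rw [Finset.sum_comm]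
  have : ∀ k, ∑ j, A i j * (2 * (B j k * (y k - x k))) = 2 * ((if i = k then 1 else 0) * (y k - x k)) := by
    intro k
    rw [← h.ab i k, Finset.sum_mul, Finset.mul_sum]
    exact Finset.sum_congr rfl fun j _ => by ring
  simp_rw [this]
  simp

lemma Lop_fs {lam : ℝ} {A B : Matrix (Fin d) (Fin d) ℝ} (h : Ell d lam A B) {ε : ℝ} (hε : 0 < ε) (x y) :
    Lop A (fun y => gamR d (qe B ε x y)) y = 2 * d * ε ^ 2 * (qe B ε x y) ^ (-(d : ℝ) / 2 - 1) := by
  have hq := qe_pos h hε x y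
  set q := qe B ε x y with hqd
  have hrp : ∀ y, HasDerivAt (fun t : ℝ => t ^ (-(d : ℝ) / 2)) ((fun t => (-(d : ℝ) / 2) * t ^ (-(d : ℝ) / 2 - 1)) (qe B ε x y)) (qe B ε x y) :=
    fun y => Real.hasDerivAt_rpow_const (Or.inl (qe_pos h hε x y).ne')
  have hdq : Differentiable ℝ (qe B ε x) := (qe_contDiff B ε x).differentiable (by simp)
  have h1 : ∀ i j, pd j (pd i (fun y => gamR d (qe B ε x y))) y
      = (-(d : ℝ) / 2) * q ^ (-(d : ℝ) / 2 - 1) * (lin B x j y * lin B x i y) + q ^ (-(d : ℝ) / 2) * (2 * B i j) := by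
    intro i j
    have hdd : Differentiable ℝ (fun y => qe B ε x y ^ (-(d : ℝ) / 2)) := fun y => ((hrp y).differentiableAt.comp y (hdq y))
    rw [pd_fs h hε, pd_mul' hdd ((lin_contDiff B x i).differentiable (by simp)),
      pd_comp (F := fun t => t ^ (-(d : ℝ) / 2)) (F' := fun t => (-(d : ℝ) / 2) * t ^ (-(d : ℝ) / 2 - 1)) hrp hdq, pd_qe h.bS]
    beta_reduce
    rw [pd_lin]
    ring
  have h2 : ∑ i, ∑ j, A i j * (lin B x j y * lin B x i y) = 4 * bform B (y - x) (y - x) := by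
    have : ∀ i, ∑ j, A i j * (lin B x j y * lin B x i y) = 2 * (y i - x i) * lin B x i y := by
      intro i
      rw [← ell_lin h x y i, Finset.sum_mul]
      exact Finset.sum_congr rfl fun j _ => by ring
    simp_rw [this]
    unfold lin bform
    simp only [Finset.mul_sum]
    refine Finset.sum_congr rfl fun i _ => Finset.sum_congr rfl fun j _ => ?_
    simp; ring
  have h3 : ∑ i, ∑ j, A i j * B i j = d := by
    have : ∀ i, ∑ j, A i j * B i j = 1 := by
      intro i
      have := h.ab i i
      rw [if_pos rfl] at this
      rw [← this]
      exact Finset.sum_congr rfl fun j _ => by rw [h.bS i j]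
    simp [this]
  unfold Lop
  simp_rw [h1]
  have h4 : ∑ i, ∑ j, A i j * ((-(d : ℝ) / 2) * q ^ (-(d : ℝ) / 2 - 1) * (lin B x j y * lin B x i y) + q ^ (-(d : ℝ) / 2) * (2 * B i j))
      = (-(d : ℝ) / 2) * q ^ (-(d : ℝ) / 2 - 1) * (∑ i, ∑ j, A i j * (lin B x j y * lin B x i y))
        + q ^ (-(d : ℝ) / 2) * 2 * ∑ i, ∑ j, A i j * B i j := by
    simp_rw [Finset.mul_sum, ← Finset.sum_add_distrib]
    exact Finset.sum_congr rfl fun i _ => Finset.sum_congr rfl fun j _ => by ring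
  rw [h4, h2, h3]
  have h5 : q ^ (-(d : ℝ) / 2) = q ^ (-(d : ℝ) / 2 - 1) * q := by
    rw [← Real.rpow_add_one hq.ne']; congr 1; ring
  rw [h5]
  have h6 : bform B (y - x) (y - x) = q - ε ^ 2 := by rw [hqd]; unfold qe; ring
  rw [h6]; ring

/-- the cut-off function -/
def chi (d : ℕ) : EuclideanSpace ℝ (Fin d) → ℝ :=
  (⟨3/4, 7/8, by norm_num, by norm_num⟩ : ContDiffBump (0 : EuclideanSpace ℝ (Fin d)))

lemma chi_contDiff : ContDiff ℝ (⊤ : ℕ∞) (chi d) := ContDiffBump.contDiff _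
lemma chi_supp : tsupport (chi d) = closedBall 0 (7/8) := by unfold chi; rw [ContDiffBump.tsupport_eq]
lemma chi_compact : HasCompactSupport (chi d) := ContDiffBump.hasCompactSupport _
lemma chi_one {x : EuclideanSpace ℝ (Fin d)} (hx : x ∈ ball (0 : EuclideanSpace ℝ (Fin d)) (3/4)) : chi d x = 1 :=
  ContDiffBump.one_of_mem_closedBall _ (ball_subset_closedBall hx)
lemma chi_nonneg (x : EuclideanSpace ℝ (Fin d)) : 0 ≤ chi d x := ContDiffBump.nonneg _
lemma chi_le (x : EuclideanSpace ℝ (Fin d)) : chi d x ≤ 1 := ContDiffBump.le_one _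

lemma pd_chi_zero (i : Fin d) {x : EuclideanSpace ℝ (Fin d)} (hx : x ∈ ball (0 : EuclideanSpace ℝ (Fin d)) (3/4)) : pd i (chi d) x = 0 := by
  have : chi d =ᶠ[nhds x] fun _ => 1 := by
    filter_upwards [isOpen_ball.mem_nhds hx] with y hy using chi_one hy
  unfold pd
  rw [this.fderiv_eq]; simp

lemma pd2_chi_zero (i j : Fin d) {x : EuclideanSpace ℝ (Fin d)} (hx : x ∈ ball (0 : EuclideanSpace ℝ (Fin d)) (3/4)) : pd j (pd i (chi d)) x = 0 := by
  have : pd i (chi d) =ᶠ[nhds x] fun _ => 0 := by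
    filter_upwards [isOpen_ball.mem_nhds hx] with y hy using pd_chi_zero i hy
  unfold pd at this ⊢
  rw [this.fderiv_eq]; simp

/-- identity before the limit -/
lemma fs_identity {lam : ℝ} {A B : Matrix (Fin d) (Fin d) ℝ} (h : Ell d lam A B) {u : EuclideanSpace ℝ (Fin d) → ℝ}
    (hu : IsWeakSol (fun _ => A) (ball 0 1) u) {ε : ℝ} (hε : 0 < ε) (x) :
    ∫ y, u y * (chi d y * (2 * d * ε ^ 2 * (qe B ε x y) ^ (-(d : ℝ) / 2 - 1))
      + (4 * (qe B ε x y) ^ (-(d : ℝ) / 2) * (∑ j, pd j (chi d) y * (y j - x j)) + gamR d (qe B ε x y) * Lop A (chi d) y)) = 0 := by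
  have hs : tsupport (fun y => chi d y * gamR d (qe B ε x y)) ⊆ ball 0 1 := by
    refine (tsupport_mul_subset_left).trans ?_
    rw [chi_supp]
    exact closedBall_subset_ball (by norm_num)
  have := vweak hu (chi_contDiff.mul (fs_contDiff h hε x)) (chi_compact.mul_right) hs
  rw [← this]
  congr 1
  ext y
  rw [Lop_mul h.aS chi_contDiff (fs_contDiff h hε x), Lop_fs h hε]
  have h2 : ∑ i, ∑ j, A i j * pd j (chi d) y * pd i (fun y => gamR d (qe B ε x y)) y
      = 2 * (qe B ε x y) ^ (-(d : ℝ) / 2) * (∑ j, pd j (chi d) y * (y j - x j)) := by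
    rw [Finset.sum_comm, Finset.mul_sum]
    refine Finset.sum_congr rfl fun j _ => ?_
    have := ell_lin h x y j
    rw [show 2 * (qe B ε x y) ^ (-(d : ℝ) / 2) * (pd j (chi d) y * (y j - x j)) = (qe B ε x y) ^ (-(d : ℝ) / 2) * pd j (chi d) y * (2 * (y j - x j)) by ring,
      ← this, Finset.mul_sum]
    refine Finset.sum_congr rfl fun i _ => ?_
    rw [pd_fs h hε, h.aS i j]; ring
  rw [h2]; ring

end FS
end SSM

namespace SSM

section LIM
variable {d : ℕ}

def kk (B : Matrix (Fin d) (Fin d) ℝ) (w : EuclideanSpace ℝ (Fin d)) : ℝ := 2 * d * (1 + bform B w w) ^ (-(d : ℝ) / 2 - 1)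
def k0 (d : ℕ) (w : EuclideanSpace ℝ (Fin d)) : ℝ := 2 * d * (1 + ‖w‖ ^ 2) ^ (-(d : ℝ) / 2 - 1)
def c0 (B : Matrix (Fin d) (Fin d) ℝ) : ℝ := ∫ w, kk B w

lemma k0_integrable : Integrable (k0 d) := by
  unfold k0
  apply Integrable.const_mul
  have := integrable_rpow_neg_one_add_norm_sq (E := EuclideanSpace ℝ (Fin d)) (μ := volume) (r := (d : ℝ) + 2) (by simp)
  refine this.congr (Filter.Eventually.of_forall fun x => ?_)
  simp only
  congr 1; ring

lemma k0_cont : Continuous (k0 d) := by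
  unfold k0
  refine continuous_const.mul (Continuous.rpow_const (by fun_prop) fun x => Or.inl ?_)
  positivity

lemma k0_int_pos (hd : 2 ≤ d) : 0 < ∫ w, k0 d w := by
  refine integral_pos_of_integrable_nonneg_nonzero k0_cont k0_integrable (fun x => by unfold k0; positivity) (x := 0) ?_
  have : (d : ℝ) ≠ 0 := by positivity
  simp [k0, this]

lemma bform_eq_qe (B : Matrix (Fin d) (Fin d) ℝ) (w) : bform B w w = qe B 0 0 w := by simp [qe]

lemma bform_cont (B : Matrix (Fin d) (Fin d) ℝ) : Continuous (fun w : EuclideanSpace ℝ (Fin d) => bform B w w) := by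
  simp_rw [bform_eq_qe]
  exact (qe_contDiff B 0 0).continuous

variable {lam : ℝ} {A B : Matrix (Fin d) (Fin d) ℝ}

lemma bform_nonneg (h : Ell d lam A B) (w) : 0 ≤ bform B w w := (sq_nonneg _).trans (h.qlo w)

lemma kk_cont (h : Ell d lam A B) : Continuous (kk B) := by
  unfold kk
  refine continuous_const.mul (Continuous.rpow_const (continuous_const.add (bform_cont B)) fun x => Or.inl ?_)
  have := bform_nonneg h x
  positivity

lemma kk_nonneg (h : Ell d lam A B) (w) : 0 ≤ kk B w := by
  unfold kk
  have := bform_nonneg h w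
  positivity

lemma kk_le (h : Ell d lam A B) (w) : kk B w ≤ k0 d w := by
  unfold kk k0
  refine mul_le_mul_of_nonneg_left ?_ (by positivity)
  refine Real.rpow_le_rpow_of_nonpos (by positivity) ?_ ?_
  · linarith [h.qlo w]
  · have : (0 : ℝ) ≤ d := by positivity
    linarith

lemma kk_ge (h : Ell d lam A B) (hl : 0 < lam) (hl1 : lam ≤ 1) (w) : lam ^ ((d : ℝ) / 2 + 1) * k0 d w ≤ kk B w := by
  unfold kk k0
  have h1 := bform_nonneg h w
  have h2 : 1 + bform B w w ≤ 1 / lam * (1 + ‖w‖ ^ 2) := by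
    have := h.qhi w
    have : 1 ≤ 1 / lam := by rw [le_div_iff₀ hl]; linarith
    nlinarith
  have h3 : (1 / lam * (1 + ‖w‖ ^ 2)) ^ (-(d : ℝ) / 2 - 1) ≤ (1 + bform B w w) ^ (-(d : ℝ) / 2 - 1) :=
    Real.rpow_le_rpow_of_nonpos (by positivity) h2 (by have : (0 : ℝ) ≤ d := by positivity
                                                       linarith)
  have h4 : (1 / lam * (1 + ‖w‖ ^ 2)) ^ (-(d : ℝ) / 2 - 1) = lam ^ ((d : ℝ) / 2 + 1) * (1 + ‖w‖ ^ 2) ^ (-(d : ℝ) / 2 - 1) := by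
    rw [Real.mul_rpow (by positivity) (by positivity), one_div, Real.inv_rpow hl.le, ← Real.rpow_neg hl.le]
    congr 2; ring
  rw [h4] at h3
  calc _ = 2 * d * (lam ^ ((d : ℝ) / 2 + 1) * (1 + ‖w‖ ^ 2) ^ (-(d : ℝ) / 2 - 1)) := by ring
    _ ≤ _ := mul_le_mul_of_nonneg_left h3 (by positivity)

lemma kk_integrable (h : Ell d lam A B) : Integrable (kk B) := by
  refine k0_integrable.mono' (kk_cont h).aestronglyMeasurable (Filter.Eventually.of_forall fun x => ?_)
  rw [Real.norm_of_nonneg (kk_nonneg h x)]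
  exact kk_le h x

def cstar (d : ℕ) (lam : ℝ) : ℝ := lam ^ ((d : ℝ) / 2 + 1) * ∫ w, k0 d w

lemma cstar_pos (hd : 2 ≤ d) (hl : 0 < lam) : 0 < cstar d lam := mul_pos (by positivity) (k0_int_pos hd)

lemma c0_ge (h : Ell d lam A B) (hl : 0 < lam) (hl1 : lam ≤ 1) : cstar d lam ≤ c0 B := by
  unfold cstar c0
  rw [← integral_const_mul]
  exact integral_mono (k0_integrable.const_mul _) (kk_integrable h) (kk_ge h hl hl1)

/-- the remaining kernel -/
def RR (A B : Matrix (Fin d) (Fin d) ℝ) (ε : ℝ) (x y : EuclideanSpace ℝ (Fin d)) : ℝ :=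
  4 * (qe B ε x y) ^ (-(d : ℝ) / 2) * (∑ j, pd j (chi d) y * (y j - x j)) + gamR d (qe B ε x y) * Lop A (chi d) y

lemma RR_zero {ε x} {y : EuclideanSpace ℝ (Fin d)} (hy : y ∈ ball (0 : EuclideanSpace ℝ (Fin d)) (3/4)) : RR A B ε x y = 0 := by
  unfold RR Lop
  simp [pd_chi_zero _ hy, pd2_chi_zero _ _ hy]

lemma RR_zero' {ε x} {y : EuclideanSpace ℝ (Fin d)} (hy : y ∉ closedBall (0 : EuclideanSpace ℝ (Fin d)) (7/8)) : RR A B ε x y = 0 := by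
  have h1 : ∀ j, pd j (chi d) y = 0 := fun j => pd_zero_of_notMem j (by rwa [chi_supp])
  have h2 : ∀ i j, pd j (pd i (chi d)) y = 0 := fun i j => pd_zero_of_notMem j (fun h => by
    have := tsupport_pd i _ h
    rw [chi_supp] at this
    exact hy this)
  unfold RR Lop
  simp [h1, h2]

lemma Lop_cont : Continuous (Lop A (chi d)) := by
  unfold Lop
  have : ∀ i j, Continuous (pd j (pd i (chi d))) := fun i j => (pd_contDiff_top (pd_contDiff_top chi_contDiff i) j).continuous
  fun_prop

lemma RR_cont (h : Ell d lam A B) {x : EuclideanSpace ℝ (Fin d)} (hx : x ∈ ball (0 : EuclideanSpace ℝ (Fin d)) (3/4)) :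
    Continuous (Function.uncurry fun ε y => RR A B ε x y) := by
  rw [continuous_iff_continuousAt]
  rintro ⟨ε, y⟩
  by_cases hy : y ∈ ball (0 : EuclideanSpace ℝ (Fin d)) (3/4)
  · have : (Function.uncurry fun ε y => RR A B ε x y) =ᶠ[nhds (ε, y)] fun _ => 0 := by
      have : (Prod.snd ⁻¹' ball (0 : EuclideanSpace ℝ (Fin d)) (3/4)) ∈ nhds (ε, y) :=
        (isOpen_ball.preimage continuous_snd).mem_nhds hy
      filter_upwards [this] with p hp
      exact RR_zero hp
    exact continuousAt_const.congr this.symm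
  · have hq : 0 < qe B ε x y := by
      have h1 := h.qlo (y - x)
      have : y ≠ x := fun e => hy (e ▸ hx)
      have : 0 < ‖y - x‖ := norm_pos_iff.2 (sub_ne_zero.2 this)
      have := pow_pos this 2
      have := sq_nonneg ε
      unfold qe
      linarith
    have hqc : Continuous (fun p : ℝ × EuclideanSpace ℝ (Fin d) => qe B p.1 x p.2) := by
      simp_rw [qe_eq]
      fun_prop
    have h1 : ContinuousAt (fun p : ℝ × EuclideanSpace ℝ (Fin d) => qe B p.1 x p.2 ^ (-(d : ℝ) / 2)) (ε, y) :=
      hqc.continuousAt.rpow_const (Or.inl hq.ne')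
    have h2 : ContinuousAt (fun p : ℝ × EuclideanSpace ℝ (Fin d) => gamR d (qe B p.1 x p.2)) (ε, y) :=
      ContinuousAt.comp (f := fun p : ℝ × EuclideanSpace ℝ (Fin d) => qe B p.1 x p.2) (g := gamR d) (x := (ε, y)) (gamR_contDiffAt hq).continuousAt hqc.continuousAt
    have h3 : Continuous (fun p : ℝ × EuclideanSpace ℝ (Fin d) => ∑ j, pd j (chi d) p.2 * (p.2 j - x j)) := by
      have : ∀ j, Continuous (pd j (chi d)) := fun j => (pd_contDiff_top chi_contDiff j).continuous
      fun_prop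
    have h4 : Continuous (fun p : ℝ × EuclideanSpace ℝ (Fin d) => Lop A (chi d) p.2) := Lop_cont.comp continuous_snd
    exact ((continuousAt_const.mul h1).mul h3.continuousAt).add (h2.mul h4.continuousAt)

lemma lim_identity (hd : 2 ≤ d) (hl : 0 < lam) (hl1 : lam ≤ 1) (h : Ell d lam A B) {v : EuclideanSpace ℝ (Fin d) → ℝ} (hv : Continuous v) (hvc : HasCompactSupport v)
    {x : EuclideanSpace ℝ (Fin d)} (hx : x ∈ ball (0 : EuclideanSpace ℝ (Fin d)) (3/4))
    (hI : ∀ ε > 0, ∫ y, v y * (chi d y * (2 * d * ε ^ 2 * (qe B ε x y) ^ (-(d : ℝ) / 2 - 1)) + RR A B ε x y) = 0) :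
    c0 B * v x = - ∫ y, v y * RR A B 0 x y := by
  have hcp : 0 < c0 B := (cstar_pos hd hl).trans_le (c0_ge h hl hl1)
  have hR : Continuous (fun ε => ∫ y, v y * RR A B ε x y) := by
    rw [← continuousOn_univ]
    refine continuousOn_integral_of_compact_support (isCompact_closedBall (0 : EuclideanSpace ℝ (Fin d)) (7/8)) ?_ ?_
    · exact ((hv.comp continuous_snd).mul (RR_cont h hx)).continuousOn
    · intro ε y _ hy
      rw [RR_zero' hy, mul_zero]
  -- peak
  have hpk := tendsto_integral_comp_smul_smul_of_integrable' (μ := (volume : Measure (EuclideanSpace ℝ (Fin d))))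
    (φ := fun w => kk B w / c0 B) (g := fun y => v y * chi d y) (x₀ := x)
    (fun w => div_nonneg (kk_nonneg h w) hcp.le) (by rw [integral_div]; exact div_self hcp.ne') ?_
    ((hv.mul chi_contDiff.continuous).integrable_of_hasCompactSupport hvc.mul_right) (hv.mul chi_contDiff.continuous).continuousAt
  swap
  · rw [finrank_euclideanSpace_fin]
    have hl : Filter.Tendsto (fun w : EuclideanSpace ℝ (Fin d) => (2 * d / c0 B) * (‖w‖ ^ 2)⁻¹) (Bornology.cobounded _) (nhds ((2 * d / c0 B) * 0)) :=
      (((Filter.tendsto_pow_atTop (by norm_num)).comp tendsto_norm_cobounded_atTop).inv_tendsto_atTop).const_mul _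
    rw [mul_zero] at hl
    refine squeeze_zero' (Filter.Eventually.of_forall fun w => ?_) ?_ hl
    · have := kk_nonneg h w
      positivity
    · filter_upwards [tendsto_norm_cobounded_atTop.eventually_gt_atTop 0] with w hw
      have h1 : kk B w ≤ 2 * d * (‖w‖ ^ d * ‖w‖ ^ 2)⁻¹ := by
        refine (kk_le h w).trans ?_
        unfold k0
        refine mul_le_mul_of_nonneg_left ?_ (by positivity)
        have h3 : (‖w‖ ^ d * ‖w‖ ^ 2)⁻¹ = (‖w‖ ^ 2) ^ (-(d : ℝ) / 2 - 1) := by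
          rw [← pow_add, ← Real.rpow_natCast, ← Real.rpow_neg hw.le, ← Real.rpow_natCast ‖w‖ 2, ← Real.rpow_mul hw.le]
          congr 1
          push_cast; ring
        rw [h3]
        refine Real.rpow_le_rpow_of_nonpos (by positivity) (by linarith) ?_
        have : (0 : ℝ) ≤ d := by positivity
        linarith
      calc ‖w‖ ^ d * (kk B w / c0 B) ≤ ‖w‖ ^ d * (2 * d * (‖w‖ ^ d * ‖w‖ ^ 2)⁻¹ / c0 B) := by gcongr
        _ = _ := by field_simp
  have hlim2 : Filter.Tendsto (fun c : ℝ => ∫ y, v y * RR A B (1 / c) x y) Filter.atTop (nhds (∫ y, v y * RR A B 0 x y)) := by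
    have : Filter.Tendsto (fun c : ℝ => 1 / c) Filter.atTop (nhds 0) := by
      simpa using tendsto_inv_atTop_zero (𝕜 := ℝ)
    exact (hR.tendsto 0).comp this
  have hsum := (hpk.const_mul (c0 B)).add hlim2
  have hz : ∀ᶠ c : ℝ in Filter.atTop, (c0 B * ∫ y, (c ^ Module.finrank ℝ (EuclideanSpace ℝ (Fin d)) * (kk B (c • (x - y)) / c0 B)) • (v y * chi d y))
      + ∫ y, v y * RR A B (1 / c) x y = 0 := by
    filter_upwards [Filter.eventually_gt_atTop 0] with c hc
    rw [← hI (1 / c) (by positivity)]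
    simp_rw [mul_add]
    rw [integral_add]
    · congr 1
      rw [← integral_const_mul]
      congr 1
      ext y
      have e1 : qe B (1 / c) x y = (1 / c) ^ 2 * (1 + bform B (c • (x - y)) (c • (x - y))) := by
        have : bform B (c • (x - y)) (c • (x - y)) = c ^ 2 * bform B (y - x) (y - x) := by
          unfold bform
          simp_rw [Finset.mul_sum]
          refine Finset.sum_congr rfl fun i _ => Finset.sum_congr rfl fun j _ => ?_
          simp; ring
        rw [this]; unfold qe
        field_simp
      have hp : 0 < 1 + bform B (c • (x - y)) (c • (x - y)) := by
        have := bform_nonneg h (c • (x - y)); positivity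
      have e2 : (1 / c) ^ 2 * qe B (1 / c) x y ^ (-(d : ℝ) / 2 - 1) = c ^ d * (1 + bform B (c • (x - y)) (c • (x - y))) ^ (-(d : ℝ) / 2 - 1) := by
        rw [e1, Real.mul_rpow (by positivity) hp.le, ← mul_assoc]
        congr 1
        rw [← Real.rpow_natCast (1 / c) 2, ← Real.rpow_mul (by positivity), ← Real.rpow_add (by positivity), one_div,
          Real.inv_rpow hc.le, ← Real.rpow_neg hc.le, ← Real.rpow_natCast]
        congr 1
        push_cast; ring
      have e3 : kk B (c • (x - y)) = 2 * d * (1 + bform B (c • (x - y)) (c • (x - y))) ^ (-(d : ℝ) / 2 - 1) := rfl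
      rw [smul_eq_mul, e3, finrank_euclideanSpace_fin]
      rw [show v y * (chi d y * (2 * d * (1 / c) ^ 2 * qe B (1 / c) x y ^ (-(d : ℝ) / 2 - 1)))
        = v y * chi d y * (2 * d) * ((1 / c) ^ 2 * qe B (1 / c) x y ^ (-(d : ℝ) / 2 - 1)) by ring, e2]
      field_simp
    · refine Continuous.integrable_of_hasCompactSupport ?_ hvc.mul_right
      refine hv.mul (chi_contDiff.continuous.mul (continuous_const.mul (Continuous.rpow_const (qe_contDiff B _ x).continuous fun y => Or.inl ?_)))
      exact (qe_pos h (by positivity) x y).ne'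
    · exact (hv.mul ((RR_cont h hx).comp (continuous_const.prodMk continuous_id))).integrable_of_hasCompactSupport hvc.mul_right
  have h0 := tendsto_nhds_unique (tendsto_const_nhds.congr' (hz.mono fun c hc => hc.symm)) hsum
  have hx1 : chi d x = 1 := chi_one hx
  rw [hx1, mul_one] at h0
  linarith

end LIM
end SSM

namespace SSM

section EXT
variable {d : ℕ} {lam : ℝ} {A B : Matrix (Fin d) (Fin d) ℝ}

/-- real points inside complex space -/
def io (x : EuclideanSpace ℝ (Fin d)) : Fin d → ℂ := fun k => (x k : ℂ)

def Om (d : ℕ) (η : ℝ) : Set (Fin d → ℂ) := Metric.thickening η (io '' closedBall (0 : EuclideanSpace ℝ (Fin d)) (1/2))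

lemma Om_open (η : ℝ) : IsOpen (Om d η) := isOpen_thickening

lemma mem_Om {η : ℝ} {z : Fin d → ℂ} : z ∈ Om d η ↔ ∃ x ∈ closedBall (0 : EuclideanSpace ℝ (Fin d)) (1/2), ‖z - io x‖ < η := by
  unfold Om
  rw [mem_thickening_iff]
  simp [dist_eq_norm]

def qC (B : Matrix (Fin d) (Fin d) ℝ) (z : Fin d → ℂ) (y : EuclideanSpace ℝ (Fin d)) : ℂ :=
  ∑ i, ∑ j, (B i j : ℂ) * (((y j : ℂ) - z j) * ((y i : ℂ) - z i))

def KC (A B : Matrix (Fin d) (Fin d) ℝ) (z : Fin d → ℂ) (y : EuclideanSpace ℝ (Fin d)) : ℂ :=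
  4 * (qC B z y) ^ (-(d : ℂ) / 2) * (∑ j, (pd j (chi d) y : ℂ) * ((y j : ℂ) - z j)) + gamC d (qC B z y) * (Lop A (chi d) y : ℂ)

lemma qC_io (x y : EuclideanSpace ℝ (Fin d)) : qC B (io x) y = (qe B 0 x y : ℂ) := by
  rw [qe_eq]
  unfold qC io
  push_cast
  simp

lemma KC_io {x y : EuclideanSpace ℝ (Fin d)} (hq : 0 < qe B 0 x y) : KC A B (io x) y = (RR A B 0 x y : ℂ) := by
  unfold KC RR
  rw [qC_io, gam_real hq]
  push_cast
  rw [Complex.ofReal_cpow hq.le]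
  push_cast
  rfl

/-- the annulus -/
def Ann (d : ℕ) : Set (EuclideanSpace ℝ (Fin d)) := closedBall 0 (7/8) \ ball 0 (3/4)

lemma pd_chi_out (j : Fin d) {y : EuclideanSpace ℝ (Fin d)} (hy : y ∉ Ann d) : pd j (chi d) y = 0 := by
  by_cases h : y ∈ ball (0 : EuclideanSpace ℝ (Fin d)) (3/4)
  · exact pd_chi_zero j h
  · refine pd_zero_of_notMem j ?_
    rw [chi_supp]
    exact fun h' => hy ⟨h', h⟩

lemma pd2_chi_out (i j : Fin d) {y : EuclideanSpace ℝ (Fin d)} (hy : y ∉ Ann d) : pd j (pd i (chi d)) y = 0 := by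
  by_cases h : y ∈ ball (0 : EuclideanSpace ℝ (Fin d)) (3/4)
  · exact pd2_chi_zero i j h
  · refine pd_zero_of_notMem j fun h' => ?_
    have := tsupport_pd i _ h'
    rw [chi_supp] at this
    exact hy ⟨this, h⟩

lemma KC_out {z} {y : EuclideanSpace ℝ (Fin d)} (hy : y ∉ Ann d) : KC A B z y = 0 := by
  unfold KC Lop
  simp [pd_chi_out _ hy, pd2_chi_out _ _ hy]

lemma coord_le (x : EuclideanSpace ℝ (Fin d)) (i : Fin d) : |x i| ≤ ‖x‖ := PiLp.norm_apply_le x i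

def eta (d : ℕ) (lam : ℝ) : ℝ := lam / (160 * d ^ 2)

lemma eta_pos (hd : 2 ≤ d) (hl : 0 < lam) : 0 < eta d lam := by unfold eta; positivity

lemma eta_le (hd : 2 ≤ d) (hl : 0 < lam) (hl1 : lam ≤ 1) : eta d lam ≤ 1 / (160 * d) := by
  have : (2 : ℝ) ≤ d := by exact_mod_cast hd
  unfold eta
  rw [div_le_div_iff₀ (by positivity) (by positivity)]
  nlinarith

lemma real_mem (hd : 2 ≤ d) (hl : 0 < lam) (hl1 : lam ≤ 1) {x : EuclideanSpace ℝ (Fin d)} (hx : io x ∈ Om d (eta d lam)) :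
    x ∈ ball (0 : EuclideanSpace ℝ (Fin d)) (5/8) := by
  obtain ⟨x', hx', h⟩ := mem_Om.1 hx
  have hd' : (2 : ℝ) ≤ d := by exact_mod_cast hd
  have h1 : ∀ i, |(x - x') i| ≤ eta d lam := by
    intro i
    have := (norm_le_pi_norm (io x - io x') i).trans h.le
    simp only [io, Pi.sub_apply, ← Complex.ofReal_sub, Complex.norm_real] at this
    simpa using this
  have h2 : ‖x - x'‖ ≤ ∑ i : Fin d, |(x - x') i| := by
    rw [EuclideanSpace.norm_eq]
    rw [Real.sqrt_le_left (Finset.sum_nonneg fun i _ => abs_nonneg _)]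
    simp only [Real.norm_eq_abs]
    exact Finset.sum_sq_le_sq_sum_of_nonneg fun i _ => abs_nonneg _
  have h3 : ∑ i : Fin d, |(x - x') i| ≤ d * eta d lam := by
    refine (Finset.sum_le_sum fun i _ => h1 i).trans ?_
    simp
  have h4 := eta_le hd hl hl1
  have h5 : d * eta d lam ≤ 1 / 160 := by
    calc d * eta d lam ≤ d * (1 / (160 * d)) := by gcongr
      _ = _ := by field_simp
  rw [mem_closedBall_zero_iff] at hx'
  rw [mem_ball_zero_iff]
  have : ‖x‖ ≤ ‖x - x'‖ + ‖x'‖ := by simpa using norm_add_le (x - x') x'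
  linarith

lemma qC_bounds (hd : 2 ≤ d) (hl : 0 < lam) (hl1 : lam ≤ 1) (h : Ell d lam A B) {z} (hz : z ∈ Om d (eta d lam))
    {y : EuclideanSpace ℝ (Fin d)} (hy : y ∈ Ann d) : 1 / 32 ≤ (qC B z y).re ∧ ‖qC B z y‖ ≤ 5 / lam ∧ ∀ j, ‖(y j : ℂ) - z j‖ ≤ 2 := by
  obtain ⟨x, hx, hzx⟩ := mem_Om.1 hz
  rw [mem_closedBall_zero_iff] at hx
  obtain ⟨hy1, hy2⟩ := hy
  rw [mem_closedBall_zero_iff] at hy1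
  rw [mem_ball_zero_iff, not_lt] at hy2
  have hd' : (2 : ℝ) ≤ d := by exact_mod_cast hd
  set η := eta d lam with hη
  have hη0 : 0 < η := eta_pos hd hl
  have hη1 : η ≤ 1 / 160 := (eta_le hd hl hl1).trans (by
    rw [div_le_div_iff₀ (by positivity) (by positivity)]; nlinarith)
  have hw1 : ‖y - x‖ ≤ 11 / 8 := by
    have := norm_sub_le y x; linarith
  have hw2 : 1 / 4 ≤ ‖y - x‖ := by
    have := norm_sub_norm_le y x; linarith
  have hζ : ∀ i, ‖z i - (x i : ℂ)‖ ≤ η := fun i => (norm_le_pi_norm (z - io x) i).trans hzx.le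
  have hwi : ∀ i, ‖(y i : ℂ) - x i‖ ≤ 11 / 8 := by
    intro i
    rw [← Complex.ofReal_sub, Complex.norm_real]
    exact (coord_le (y - x) i).trans hw1
  have hdiff : ‖qC B z y - (qe B 0 x y : ℂ)‖ ≤ 1 / 32 := by
    rw [← qC_io]
    unfold qC
    rw [← Finset.sum_sub_distrib]
    have hterm : ∀ i j, ‖(B i j : ℂ) * (((y j : ℂ) - z j) * ((y i : ℂ) - z i)) - (B i j : ℂ) * (((y j : ℂ) - io x j) * ((y i : ℂ) - io x i))‖ ≤ 1 / lam * (5 * η) := by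
      intro i j
      have : (B i j : ℂ) * (((y j : ℂ) - z j) * ((y i : ℂ) - z i)) - (B i j : ℂ) * (((y j : ℂ) - io x j) * ((y i : ℂ) - io x i))
        = (B i j : ℂ) * ((z j - x j) * (z i - x i) - (z j - x j) * (y i - x i) - (z i - x i) * (y j - x j)) := by
        simp only [io]; ring
      rw [this, norm_mul, Complex.norm_real]
      refine mul_le_mul (h.bB i j) ?_ (norm_nonneg _) (by positivity)
      refine (norm_sub_le _ _).trans ((add_le_add_left (norm_sub_le _ _) _).trans ?_)
      simp only [norm_mul]
      have a1 := mul_le_mul (hζ j) (hζ i) (norm_nonneg _) hη0.le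
      have a2 := mul_le_mul (hζ j) (hwi i) (norm_nonneg _) hη0.le
      have a3 := mul_le_mul (hζ i) (hwi j) (norm_nonneg _) hη0.le
      nlinarith
    calc _ ≤ ∑ i : Fin d, ∑ j : Fin d, 1 / lam * (5 * η) := by
          refine norm_sum_le_of_le _ fun i _ => ?_
          rw [← Finset.sum_sub_distrib]
          exact norm_sum_le_of_le _ fun j _ => hterm i j
      _ = 1 / 32 := by
          simp [hη, eta]
          field_simp
          norm_num
  have hQ1 : 1 / 16 ≤ qe B 0 x y := by
    unfold qe
    have := h.qlo (y - x)
    nlinarith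
  have hQ2 : qe B 0 x y ≤ 1 / lam * (121 / 64) := by
    unfold qe
    have := h.qhi (y - x)
    have h2 : 1 / lam * ‖y - x‖ ^ 2 ≤ 1 / lam * (121 / 64) := by
      gcongr
      nlinarith
    linarith
  refine ⟨?_, ?_, ?_⟩
  · have := (Complex.abs_re_le_norm _).trans hdiff
    rw [Complex.sub_re, Complex.ofReal_re, abs_le] at this
    linarith [this.1]
  · have : ‖qC B z y‖ ≤ 1 / 32 + qe B 0 x y := by
      have := norm_add_le (qC B z y - (qe B 0 x y : ℂ)) (qe B 0 x y : ℂ)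
      rw [sub_add_cancel, Complex.norm_real, Real.norm_of_nonneg (by linarith)] at this
      linarith
    have h1 : 1 ≤ 1 / lam := by rw [le_div_iff₀ hl]; linarith
    rw [show 5 / lam = 5 * (1 / lam) by ring]
    linarith
  · intro j
    have : (y j : ℂ) - z j = ((y j : ℂ) - x j) - (z j - x j) := by ring
    rw [this]
    refine (norm_sub_le _ _).trans ?_
    linarith [hζ j, hwi j]

lemma KC_bound (hd : 2 ≤ d) (hl : 0 < lam) (hl1 : lam ≤ 1) : ∃ C, 0 ≤ C ∧ ∀ A B : Matrix (Fin d) (Fin d) ℝ, Ell d lam A B → ∀ z ∈ Om d (eta d lam), ∀ y,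
    ‖KC A B z y‖ ≤ C := by
  have hcomp : IsCompact ({q : ℂ | 1 / 32 ≤ q.re} ∩ closedBall 0 (5 / lam)) :=
    (isCompact_closedBall _ _).inter_left (isClosed_le continuous_const Complex.continuous_re)
  obtain ⟨C1, hC1⟩ := hcomp.exists_bound_of_continuousOn (f := fun q : ℂ => q ^ (-(d : ℂ) / 2)) (by
    intro q hq
    have : q ∈ Complex.slitPlane := Or.inl (by have := hq.1; simp only [mem_ofPred_eq] at this; linarith)
    exact (continuousAt_id.cpow continuousAt_const this).continuousWithinAt)
  obtain ⟨C2, hC2⟩ := hcomp.exists_bound_of_continuousOn (f := gamC d) (by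
    intro q hq
    have : 0 < q.re := by have := hq.1; simp only [mem_ofPred_eq] at this; linarith
    exact (gamC_diff this).continuousAt.continuousWithinAt)
  have hb1 : ∀ j : Fin d, ∃ C, ∀ y, ‖pd j (chi d) y‖ ≤ C := fun j =>
    (pd_contDiff_top chi_contDiff j).continuous.bounded_above_of_compact_support
      (chi_compact.of_isClosed_subset (isClosed_tsupport _) (tsupport_pd j _))
  have hb2 : ∀ i j : Fin d, ∃ C, ∀ y, ‖pd j (pd i (chi d)) y‖ ≤ C := fun i j =>
    (pd_contDiff_top (pd_contDiff_top chi_contDiff i) j).continuous.bounded_above_of_compact_support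
      (chi_compact.of_isClosed_subset (isClosed_tsupport _) ((tsupport_pd j _).trans (tsupport_pd i _)))
  choose D1 hD1 using hb1
  choose D2 hD2 using hb2
  refine ⟨4 * |C1| * (∑ j, |D1 j| * 2) + |C2| * ∑ i, ∑ j, |D2 i j|, by positivity, ?_⟩
  intro A B h z hz y
  by_cases hy : y ∈ Ann d
  swap
  · rw [KC_out hy, norm_zero]
    positivity
  obtain ⟨q1, q2, q3⟩ := qC_bounds hd hl hl1 h hz hy
  have hqm : qC B z y ∈ ({q : ℂ | 1 / 32 ≤ q.re} ∩ closedBall 0 (5 / lam)) := ⟨q1, by simpa using q2⟩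
  unfold KC
  refine (norm_add_le _ _).trans (add_le_add ?_ ?_)
  · rw [norm_mul, norm_mul]
    have e1 : ‖(4 : ℂ)‖ = 4 := by simp
    rw [e1]
    refine mul_le_mul (mul_le_mul_of_nonneg_left ((hC1 _ hqm).trans (le_abs_self _)) (by norm_num)) ?_ (norm_nonneg _) (by positivity)
    refine norm_sum_le_of_le _ fun j _ => ?_
    rw [norm_mul, Complex.norm_real]
    exact mul_le_mul ((hD1 j y).trans (le_abs_self _)) (q3 j) (norm_nonneg _) (abs_nonneg _)
  · rw [norm_mul, Complex.norm_real]
    refine mul_le_mul ((hC2 _ hqm).trans (le_abs_self _)) ?_ (norm_nonneg _) (abs_nonneg _)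
    unfold Lop
    refine norm_sum_le_of_le _ fun i _ => norm_sum_le_of_le _ fun j _ => ?_
    rw [norm_mul]
    calc _ ≤ 1 * |D2 i j| := mul_le_mul (h.aB i j) ((hD2 i j y).trans (le_abs_self _)) (norm_nonneg _) zero_le_one
      _ = _ := one_mul _

lemma KC_diff (hd : 2 ≤ d) (hl : 0 < lam) (hl1 : lam ≤ 1) (h : Ell d lam A B) (y) : DifferentiableOn ℂ (fun z => KC A B z y) (Om d (eta d lam)) := by
  by_cases hy : y ∈ Ann d
  swap
  · simp_rw [KC_out hy]; exact differentiableOn_const _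
  intro z hz
  obtain ⟨q1, -, -⟩ := qC_bounds hd hl hl1 h hz hy
  have hq0 : 0 < (qC B z y).re := by linarith
  have hqd : Differentiable ℂ (fun z => qC B z y) := by unfold qC; fun_prop
  have h1 : DifferentiableAt ℂ (fun z => gamC d (qC B z y)) z :=
    DifferentiableAt.comp (g := gamC d) (f := fun z => qC B z y) z (gamC_diff hq0) (hqd z)
  have h2 : DifferentiableAt ℂ (fun z => (qC B z y) ^ (-(d : ℂ) / 2)) z :=
    DifferentiableAt.cpow (hqd z) (differentiableAt_const _) (Or.inl hq0)
  have h3 : DifferentiableAt ℂ (fun z : Fin d → ℂ => ∑ j, (pd j (chi d) y : ℂ) * ((y j : ℂ) - z j)) z := by fun_prop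
  exact (((h2.const_mul 4).mul h3).add (h1.mul_const _)).differentiableWithinAt

lemma KC_meas (z) : Measurable (fun y => KC A B z y) := by
  have hq : Measurable (fun y => qC B z y) := by unfold qC; fun_prop
  have h1 : ∀ j, Measurable (fun y => (pd j (chi d) y : ℂ)) := fun j =>
    Complex.measurable_ofReal.comp (pd_contDiff_top chi_contDiff j).continuous.measurable
  have h2 : Measurable (fun y => (Lop A (chi d) y : ℂ)) := Complex.measurable_ofReal.comp Lop_cont.measurable
  have h3 : Measurable (fun y => gamC d (qC B z y)) := by
    unfold gamC
    split_ifs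
    · exact Complex.measurable_log.comp hq
    · exact (hq.pow_const _).div_const _
  have h4 : Measurable (fun y => (qC B z y) ^ (-(d : ℂ) / 2)) := hq.pow_const _
  unfold KC
  fun_prop

end EXT
end SSM

namespace SSM

section REP
variable {d : ℕ} {lam : ℝ} {A B : Matrix (Fin d) (Fin d) ℝ}

def chi2 (d : ℕ) : EuclideanSpace ℝ (Fin d) → ℝ :=
  (⟨7/8, 15/16, by norm_num, by norm_num⟩ : ContDiffBump (0 : EuclideanSpace ℝ (Fin d)))

lemma chi2_contDiff : ContDiff ℝ 1 (chi2 d) := ContDiffBump.contDiff _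
lemma chi2_supp : tsupport (chi2 d) ⊆ ball 0 1 := by
  unfold chi2; rw [ContDiffBump.tsupport_eq]; exact closedBall_subset_ball (by norm_num)
lemma chi2_compact : HasCompactSupport (chi2 d) := ContDiffBump.hasCompactSupport _
lemma chi2_one {x : EuclideanSpace ℝ (Fin d)} (hx : x ∈ closedBall (0 : EuclideanSpace ℝ (Fin d)) (7/8)) : chi2 d x = 1 :=
  ContDiffBump.one_of_mem_closedBall _ hx

/-- representation formula -/
lemma rep (hd : 2 ≤ d) (hl : 0 < lam) (hl1 : lam ≤ 1) (h : Ell d lam A B) {u : EuclideanSpace ℝ (Fin d) → ℝ}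
    (hu : IsWeakSol (fun _ => A) (ball 0 1) u) {x : EuclideanSpace ℝ (Fin d)} (hx : x ∈ ball (0 : EuclideanSpace ℝ (Fin d)) (3/4)) :
    c0 B * u x = - ∫ y, u y * RR A B 0 x y := by
  have hv : Continuous (fun y => u y * chi2 d y) := (cd_mul isOpen_ball hu.1 chi2_contDiff chi2_supp).continuous
  have hvc : HasCompactSupport (fun y => u y * chi2 d y) := cs_mul u chi2_compact
  have hgen : ∀ f : EuclideanSpace ℝ (Fin d) → ℝ, (∀ y ∉ closedBall (0 : EuclideanSpace ℝ (Fin d)) (7/8), f y = 0) →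
      ∀ y, u y * chi2 d y * f y = u y * f y := by
    intro f hf y
    by_cases hy : y ∈ closedBall (0 : EuclideanSpace ℝ (Fin d)) (7/8)
    · rw [chi2_one hy, mul_one]
    · rw [hf y hy, mul_zero, mul_zero]
  have := lim_identity hd hl hl1 h hv hvc hx (by
    intro ε hε
    rw [← fs_identity h hu hε x]
    congr 1
    ext y
    have := hgen (fun y => chi d y * (2 * d * ε ^ 2 * (qe B ε x y) ^ (-(d : ℝ) / 2 - 1)) + RR A B ε x y) (by
      intro y hy
      have hc : chi d y = 0 := image_eq_zero_of_notMem_tsupport (by rwa [chi_supp])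
      beta_reduce
      rw [hc, RR_zero' hy]; ring) y
    exact this)
  rw [chi2_one (ball_subset_closedBall (ball_subset_ball (by norm_num) hx)), mul_one] at this
  rw [this]
  congr 2
  ext y
  exact hgen (fun y => RR A B 0 x y) (fun y hy => RR_zero' hy) y

lemma u_int (hu : ContDiffOn ℝ 1 u (ball (0 : EuclideanSpace ℝ (Fin d)) 1))
    (h1 : (⨍ x in ball (0 : EuclideanSpace ℝ (Fin d)) 1, (u x) ^ 2) = 1) :
    IntegrableOn u (ball 0 1) ∧ ∫ x in ball 0 1, |u x| ≤ volume.real (ball (0 : EuclideanSpace ℝ (Fin d)) 1) := by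
  have hm : AEStronglyMeasurable u (volume.restrict (ball (0 : EuclideanSpace ℝ (Fin d)) 1)) :=
    hu.continuousOn.aestronglyMeasurable measurableSet_ball
  have hi2 : IntegrableOn (fun x => (u x) ^ 2) (ball (0 : EuclideanSpace ℝ (Fin d)) 1) := by
    by_contra hn
    rw [setAverage_eq, integral_undef hn] at h1
    simp at h1
  have hV : 0 < volume.real (ball (0 : EuclideanSpace ℝ (Fin d)) 1) :=
    ENNReal.toReal_pos (measure_ball_pos _ _ one_pos).ne' measure_ball_lt_top.ne
  have hI : ∫ x in ball (0 : EuclideanSpace ℝ (Fin d)) 1, (u x) ^ 2 = volume.real (ball (0 : EuclideanSpace ℝ (Fin d)) 1) := by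
    rw [setAverage_eq, smul_eq_mul, inv_mul_eq_iff_eq_mul₀ hV.ne', mul_one] at h1
    exact h1
  have hc : IntegrableOn (fun _ => (1 : ℝ)) (ball (0 : EuclideanSpace ℝ (Fin d)) 1) := integrableOn_const measure_ball_lt_top.ne
  have hb : IntegrableOn (fun x => (1 + (u x) ^ 2) / 2) (ball (0 : EuclideanSpace ℝ (Fin d)) 1) := (hc.add hi2).div_const 2
  have hle : ∀ x, |u x| ≤ (1 + (u x) ^ 2) / 2 := fun x => by
    rw [← sq_abs]; nlinarith [sq_nonneg (|u x| - 1)]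
  have hui : IntegrableOn u (ball (0 : EuclideanSpace ℝ (Fin d)) 1) := hb.mono' hm (Filter.Eventually.of_forall hle)
  refine ⟨hui, ?_⟩
  calc ∫ x in ball (0 : EuclideanSpace ℝ (Fin d)) 1, |u x| ≤ ∫ x in ball (0 : EuclideanSpace ℝ (Fin d)) 1, (1 + (u x) ^ 2) / 2 :=
        integral_mono hui.abs hb hle
    _ = _ := by
        rw [integral_div, integral_add hc hi2, hI]
        simp

/-- **Holomorphic extension** -/
theorem ext_exists (hd : 2 ≤ d) (hl : 0 < lam) (hl1 : lam ≤ 1) : ∃ M, 0 < M ∧ ∀ (A B : Matrix (Fin d) (Fin d) ℝ) (u : EuclideanSpace ℝ (Fin d) → ℝ),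
    Ell d lam A B → IsWeakSol (fun _ => A) (ball 0 1) u → (⨍ x in ball (0 : EuclideanSpace ℝ (Fin d)) 1, (u x) ^ 2) = 1 →
    ∃ U : (Fin d → ℂ) → ℂ, DifferentiableOn ℂ U (Om d (eta d lam)) ∧ (∀ z ∈ Om d (eta d lam), ‖U z‖ ≤ M) ∧
      ∀ x ∈ ball (0 : EuclideanSpace ℝ (Fin d)) (3/4), U (io x) = u x := by
  obtain ⟨C, hC0, hC⟩ := KC_bound hd hl hl1
  set V := volume.real (ball (0 : EuclideanSpace ℝ (Fin d)) 1) with hV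
  have hV0 : 0 ≤ V := ENNReal.toReal_nonneg
  have hcs := cstar_pos hd hl
  refine ⟨1 / cstar d lam * (V * C) + 1, by positivity, ?_⟩
  intro A B u h hu h1
  obtain ⟨hui, hub⟩ := u_int hu.1 h1
  have hc0 := c0_ge h hl hl1
  have hc0p : 0 < c0 B := hcs.trans_le hc0
  -- work with the restricted measure
  refine ⟨fun z => -(1 / c0 B : ℝ) * ∫ y in ball (0 : EuclideanSpace ℝ (Fin d)) 1, (u y : ℂ) * KC A B z y, ?_, ?_, ?_⟩
  · refine DifferentiableOn.const_mul (fun z hz => DifferentiableAt.differentiableWithinAt ?_) _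
    obtain ⟨R, hR, hball⟩ := Metric.isOpen_iff.1 (Om_open (d := d) (eta d lam)) z hz
    refine par_diff hR (bound := fun y => |u y| * C) (hui.abs.mul_const C) ?_ ?_ ?_
    · exact Filter.Eventually.of_forall fun y => ((KC_diff hd hl hl1 h y).mono hball).const_mul _
    · refine Filter.Eventually.of_forall fun y z' hz' => ?_
      rw [norm_mul, Complex.norm_real]
      exact mul_le_mul_of_nonneg_left (hC A B h z' (hball hz') y) (abs_nonneg _)
    · intro z' _
      exact (Complex.continuous_ofReal.comp_aestronglyMeasurable hui.aestronglyMeasurable).mul (KC_meas z').aestronglyMeasurable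
  · intro z hz
    rw [norm_mul, norm_neg, Complex.norm_real, Real.norm_of_nonneg (by positivity)]
    have : ‖∫ y in ball (0 : EuclideanSpace ℝ (Fin d)) 1, (u y : ℂ) * KC A B z y‖ ≤ V * C := by
      refine (norm_integral_le_of_norm_le (hui.abs.mul_const C) (Filter.Eventually.of_forall fun y => ?_)).trans ?_
      · rw [norm_mul, Complex.norm_real]
        exact mul_le_mul_of_nonneg_left (hC A B h z hz y) (abs_nonneg _)
      · rw [integral_mul_const]
        exact mul_le_mul_of_nonneg_right hub hC0
    calc _ ≤ 1 / cstar d lam * (V * C) := mul_le_mul (one_div_le_one_div_of_le hcs hc0) this (norm_nonneg _) (by positivity)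
      _ ≤ _ := by linarith
  · intro x hx
    have hr := rep hd hl hl1 h hu hx
    have e1 : ∫ y in ball (0 : EuclideanSpace ℝ (Fin d)) 1, (u y : ℂ) * KC A B (io x) y = ((∫ y, u y * RR A B 0 x y : ℝ) : ℂ) := by
      rw [← integral_complex_ofReal, setIntegral_eq_integral_of_forall_compl_eq_zero]
      · congr 1
        ext y
        by_cases hy : y ∈ Ann d
        · rw [KC_io]
          · push_cast; rfl
          · have h1 := h.qlo (y - x)
            have : y ≠ x := fun e => hy.2 (e ▸ hx)
            have : 0 < ‖y - x‖ := norm_pos_iff.2 (sub_ne_zero.2 this)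
            have := pow_pos this 2
            unfold qe
            linarith
        · rw [KC_out hy]
          have : RR A B 0 x y = 0 := by
            unfold RR Lop
            simp [pd_chi_out _ hy, pd2_chi_out _ _ hy]
          rw [this]; simp
      · intro y hy
        rw [KC_out, mul_zero]
        intro hA
        exact hy (closedBall_subset_ball (by norm_num) hA.1)
    simp only
    rw [e1, ← Complex.ofReal_neg, ← Complex.ofReal_mul]
    congr 1
    rw [neg_mul, ← mul_neg, ← hr]
    field_simp

end REP
end SSM

namespace SSM

section DER
variable {d : ℕ}

lemma hol_contDiffOn {W : Type*} [NormedAddCommGroup W] [NormedSpace ℂ W] [FiniteDimensional ℂ W]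
    {Ω : Set W} (hΩ : IsOpen Ω) (n : ℕ) : ∀ {U : W → ℂ}, DifferentiableOn ℂ U Ω → ContDiffOn ℂ n U Ω := by
  induction n with
  | zero => intro U hU; exact contDiffOn_zero.2 hU.continuousOn
  | succ n ih =>
    intro U hU
    push_cast
    rw [contDiffOn_succ_iff_fderiv_of_isOpen hΩ]
    refine ⟨hU, by simp, ?_⟩
    rw [contDiffOn_clm_apply]
    intro w
    exact ih (diff_fderiv_apply hΩ hU w)

def cd (i : Fin d) (G : (Fin d → ℂ) → ℂ) : (Fin d → ℂ) → ℂ := fun z => fderiv ℂ G z (Pi.single i 1)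

variable {Ω : Set (Fin d → ℂ)}

lemma cd_diff (hΩ : IsOpen Ω) {G : (Fin d → ℂ) → ℂ} (hG : DifferentiableOn ℂ G Ω) (i : Fin d) : DifferentiableOn ℂ (cd i G) Ω :=
  diff_fderiv_apply hΩ hG _

lemma cd_congr (hΩ : IsOpen Ω) {G H : (Fin d → ℂ) → ℂ} (h : ∀ z ∈ Ω, G z = H z) (i : Fin d) : ∀ z ∈ Ω, cd i G z = cd i H z := by
  intro z hz
  have : G =ᶠ[nhds z] H := by
    filter_upwards [hΩ.mem_nhds hz] with y hy using h y hy
  unfold cd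
  rw [this.fderiv_eq]

lemma cd_symm (hΩ : IsOpen Ω) {G : (Fin d → ℂ) → ℂ} (hG : DifferentiableOn ℂ G Ω) (i j : Fin d) :
    ∀ z ∈ Ω, cd i (cd j G) z = cd j (cd i G) z := by
  intro z hz
  have h2 : ContDiffAt ℂ 2 G z := (hol_contDiffOn hΩ 2 hG).contDiffAt (hΩ.mem_nhds hz)
  have hs := h2.isSymmSndFDerivAt (by simp [minSmoothness])
  have hd : DifferentiableAt ℂ (fderiv ℂ G) z := (h2.fderiv_right (m := 1) (by norm_num)).differentiableAt (by norm_num)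
  have key : ∀ v w, fderiv ℂ (fun z => fderiv ℂ G z w) z v = fderiv ℂ (fderiv ℂ G) z v w := by
    intro v w
    rw [fderiv_clm_apply hd (differentiableAt_const w)]
    simp
  unfold cd
  rw [key, key]
  exact hs _ _

def Gl (U : (Fin d → ℂ) → ℂ) : List (Fin d) → (Fin d → ℂ) → ℂ
  | [] => U
  | i :: l => cd i (Gl U l)

variable {U : (Fin d → ℂ) → ℂ}

lemma Gl_diff (hΩ : IsOpen Ω) (hU : DifferentiableOn ℂ U Ω) (l : List (Fin d)) : DifferentiableOn ℂ (Gl U l) Ω := by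
  induction l with
  | nil => exact hU
  | cons i l ih => exact cd_diff hΩ ih i

lemma Gl_swap (hΩ : IsOpen Ω) (hU : DifferentiableOn ℂ U Ω) (i j : Fin d) (l : List (Fin d)) :
    ∀ z ∈ Ω, Gl U (i :: j :: l) z = Gl U (j :: i :: l) z := cd_symm hΩ (Gl_diff hΩ hU l) i j

/-- linear version of `io` -/
def ioL (d : ℕ) : EuclideanSpace ℝ (Fin d) →L[ℝ] (Fin d → ℂ) :=
  ContinuousLinearMap.pi fun k => Complex.ofRealCLM.comp (EuclideanSpace.proj k : EuclideanSpace ℝ (Fin d) →L[ℝ] ℝ)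

lemma ioL_apply (x : EuclideanSpace ℝ (Fin d)) : ioL d x = io x := by ext k; rfl
lemma ioL_coe : (ioL d : EuclideanSpace ℝ (Fin d) → _) = io := by ext x k; rfl
lemma io_cont : Continuous (io : EuclideanSpace ℝ (Fin d) → _) := by rw [← ioL_coe]; exact (ioL d).continuous
lemma io_single (i : Fin d) : io (EuclideanSpace.single i (1 : ℝ)) = Pi.single i 1 := by
  ext k
  by_cases h : k = i
  · subst h; simp [io]
  · simp [io, h]

def reG (G : (Fin d → ℂ) → ℂ) (x : EuclideanSpace ℝ (Fin d)) : ℝ := (G (io x)).re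

lemma reG_fderiv (hΩ : IsOpen Ω) {G : (Fin d → ℂ) → ℂ} (hG : DifferentiableOn ℂ G Ω) {x : EuclideanSpace ℝ (Fin d)} (hx : io x ∈ Ω) :
    HasFDerivAt (fun x => G (io x)) (((fderiv ℂ G (io x)).restrictScalars ℝ).comp (ioL d)) x := by
  have h1 : HasFDerivAt G (fderiv ℂ G (io x)) (io x) := (hG.differentiableAt (hΩ.mem_nhds hx)).hasFDerivAt
  have h2 := h1.restrictScalars ℝ
  have h3 : HasFDerivAt (io : EuclideanSpace ℝ (Fin d) → _) (ioL d) x := by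
    have := (ioL d).hasFDerivAt (x := x)
    rwa [ioL_coe] at this
  exact h2.comp x h3

lemma reG_pd (hΩ : IsOpen Ω) {G : (Fin d → ℂ) → ℂ} (hG : DifferentiableOn ℂ G Ω) {x : EuclideanSpace ℝ (Fin d)} (hx : io x ∈ Ω) (i : Fin d) :
    pd i (reG G) x = reG (cd i G) x := by
  have h := (Complex.reCLM.hasFDerivAt (x := G (io x))).comp x (reG_fderiv hΩ hG hx)
  have : fderiv ℝ (reG G) x = _ := h.fderiv
  unfold pd
  rw [this]
  simp [reG, cd, ioL_apply, io_single]

lemma im_cd (hΩ : IsOpen Ω) {G : (Fin d → ℂ) → ℂ} (hG : DifferentiableOn ℂ G Ω)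
    (hr : ∀ x, io x ∈ Ω → (G (io x)).im = 0) (i : Fin d) : ∀ x, io x ∈ Ω → (cd i G (io x)).im = 0 := by
  intro x hx
  have h := (Complex.imCLM.hasFDerivAt (x := G (io x))).comp x (reG_fderiv hΩ hG hx)
  have h0 : (Complex.imCLM ∘ fun x => G (io x)) =ᶠ[nhds x] fun _ => (0 : ℝ) := by
    filter_upwards [(hΩ.preimage io_cont).mem_nhds hx] with y hy
    exact hr y hy
  have h1 := h.fderiv
  rw [h0.fderiv_eq] at h1
  have := congrArg (fun L => L (EuclideanSpace.single i (1 : ℝ))) h1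
  simp [ioL_apply, io_single] at this
  exact this.symm

lemma Gl_im (hΩ : IsOpen Ω) (hU : DifferentiableOn ℂ U Ω) (hr : ∀ x, io x ∈ Ω → (U (io x)).im = 0) (l : List (Fin d)) :
    ∀ x, io x ∈ Ω → (Gl U l (io x)).im = 0 := by
  induction l with
  | nil => exact hr
  | cons i l ih => exact im_cd hΩ (Gl_diff hΩ hU l) ih i

lemma reG_contDiffOn (hΩ : IsOpen Ω) {G : (Fin d → ℂ) → ℂ} (hG : DifferentiableOn ℂ G Ω) :
    ContDiffOn ℝ 1 (reG G) (io ⁻¹' Ω) := by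
  have h1 : ContDiffOn ℝ 1 G Ω := (by exact_mod_cast hol_contDiffOn hΩ 1 hG : ContDiffOn ℂ 1 G Ω).restrict_scalars ℝ
  have h2 : ContDiffOn ℝ 1 (fun x => G (ioL d x)) (io ⁻¹' Ω) :=
    h1.comp (ioL d).contDiff.contDiffOn (fun x hx => by rw [ioL_apply]; exact hx)
  simp_rw [ioL_apply] at h2
  exact Complex.reCLM.contDiff.comp_contDiffOn h2

/-- pointwise PDE -/
lemma pde0 (hΩ : IsOpen Ω) (hU : DifferentiableOn ℂ U Ω) (hr : ∀ x, io x ∈ Ω → (U (io x)).im = 0)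
    {A : Matrix (Fin d) (Fin d) ℝ} {u : EuclideanSpace ℝ (Fin d) → ℝ}
    (hu : IsWeakSol (fun _ => A) (ball 0 1) u) (hs : io ⁻¹' Ω ⊆ ball (0 : EuclideanSpace ℝ (Fin d)) 1)
    (he : ∀ x, io x ∈ Ω → U (io x) = u x) :
    ∀ x, io x ∈ Ω → ∑ i, ∑ j, (A i j : ℂ) * Gl U [i, j] (io x) = 0 := by
  set O : Set (EuclideanSpace ℝ (Fin d)) := io ⁻¹' Ω with hOdef
  have hO : IsOpen O := hΩ.preimage io_cont
  set f : EuclideanSpace ℝ (Fin d) → ℝ := fun x => ∑ i, ∑ j, A i j * reG (Gl U [i, j]) x with hf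
  have hfc : ContinuousOn f O := by
    refine continuousOn_finsetSum _ fun i _ => continuousOn_finsetSum _ fun j _ => continuousOn_const.mul ?_
    exact (reG_contDiffOn hΩ (Gl_diff hΩ hU [i, j])).continuousOn
  have hae := hO.ae_eq_zero_of_integral_contDiff_smul_eq_zero (f := f) (μ := volume) (hfc.locallyIntegrableOn hO.measurableSet) (by
    intro ψ hψ hc hsup
    have hw := vweak hu hψ hc (hsup.trans hs)
    have hcp : ∀ i, HasCompactSupport (pd i ψ) := fun i => hc.of_isClosed_subset (isClosed_tsupport _) (tsupport_pd i _)
    have b1 := fun i j => ibp1 hO (reG_contDiffOn hΩ hU) (g := pd i ψ) ((pd_contDiff_top hψ i).of_le (by norm_cast)) (hcp i)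
      ((tsupport_pd i ψ).trans hsup) j
    have b2 := fun i j => ibp1 hO (reG_contDiffOn hΩ (Gl_diff hΩ hU [j])) (g := ψ) (hψ.of_le (by norm_cast)) hc hsup i
    have e1 : ∀ x, u x * Lop A ψ x = ∑ i, ∑ j, A i j * (reG U x * pd j (pd i ψ) x) := by
      intro x
      by_cases hx : x ∈ O
      · have : reG U x = u x := by unfold reG; rw [he x hx]; simp
        unfold Lop
        rw [this, Finset.mul_sum]
        refine Finset.sum_congr rfl fun i _ => ?_
        rw [Finset.mul_sum]
        exact Finset.sum_congr rfl fun j _ => by ring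
      · have : ∀ i j, pd j (pd i ψ) x = 0 := fun i j => pd_zero_of_notMem j (fun h => hx (hsup (tsupport_pd i ψ h)))
        unfold Lop
        simp [this]
    simp_rw [e1] at hw
    have I1 : ∀ i, Integrable (fun x => ∑ j, A i j * (reG U x * pd j (pd i ψ) x)) := fun i =>
      integrable_finsetSum _ fun j _ => ((b1 i j).2.1).const_mul _
    have I2 : ∀ i, Integrable (fun x => ∑ j, A i j * (pd i (reG (Gl U [j])) x * ψ x)) := fun i =>
      integrable_finsetSum _ fun j _ => ((b2 i j).1).const_mul _
    rw [integral_finsetSum _ fun i _ => I1 i] at hw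
    have e2 : ∀ i, ∫ x, ∑ j, A i j * (reG U x * pd j (pd i ψ) x) = ∫ x, ∑ j, A i j * (pd i (reG (Gl U [j])) x * ψ x) := by
      intro i
      rw [integral_finsetSum _ fun j _ => ((b1 i j).2.1).const_mul _, integral_finsetSum _ fun j _ => ((b2 i j).1).const_mul _]
      refine Finset.sum_congr rfl fun j _ => ?_
      rw [integral_const_mul, integral_const_mul, (b2 i j).2.2]
      have e3 : ∫ x, reG (Gl U [j]) x * pd i ψ x = ∫ x, pd j (reG U) x * pd i ψ x := by
        congr 1
        ext x
        by_cases hx : x ∈ O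
        · rw [reG_pd hΩ hU hx]; rfl
        · rw [pd_zero_of_notMem i (fun h => hx (hsup h)), mul_zero, mul_zero]
      rw [e3, (b1 i j).2.2, neg_neg]
    simp_rw [e2] at hw
    rw [← integral_finsetSum _ fun i _ => I2 i] at hw
    rw [← hw]
    congr 1
    ext x
    by_cases hx : x ∈ O
    · rw [smul_eq_mul, hf]
      simp only [Finset.mul_sum]
      refine Finset.sum_congr rfl fun i _ => Finset.sum_congr rfl fun j _ => ?_
      rw [reG_pd hΩ (Gl_diff hΩ hU [j]) hx]
      simp only [Gl]
      ring
    · have : ψ x = 0 := image_eq_zero_of_notMem_tsupport fun h => hx (hsup h)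
      simp [this])
  have hz : EqOn f (fun _ => 0) O := by
    refine Measure.eqOn_open_of_ae_eq (μ := volume) ?_ hO hfc continuousOn_const
    rw [Filter.EventuallyEq, ae_restrict_iff' hO.measurableSet]
    exact hae
  intro x hx
  have h0 := hz hx
  simp only [hf] at h0
  have hreal : ∀ i j, Gl U [i, j] (io x) = (reG (Gl U [i, j]) x : ℂ) := by
    intro i j
    apply Complex.ext
    · simp [reG]
    · simpa using Gl_im hΩ hU hr [i, j] x hx
  simp_rw [hreal]
  exact_mod_cast h0

lemma cd_zero_real (hΩ : IsOpen Ω) {G : (Fin d → ℂ) → ℂ} (hG : DifferentiableOn ℂ G Ω)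
    (hr : ∀ x, io x ∈ Ω → G (io x) = 0) (i : Fin d) : ∀ x, io x ∈ Ω → cd i G (io x) = 0 := by
  intro x hx
  have h := reG_fderiv hΩ hG hx
  have h0 : (fun x => G (io x)) =ᶠ[nhds x] fun _ => (0 : ℂ) := by
    filter_upwards [(hΩ.preimage io_cont).mem_nhds hx] with y hy
    exact hr y hy
  have h1 := h.fderiv
  rw [h0.fderiv_eq] at h1
  have := congrArg (fun L => L (EuclideanSpace.single i (1 : ℝ))) h1
  simp [ioL_apply, io_single] at this
  exact this.symm

lemma pde (hΩ : IsOpen Ω) (hU : DifferentiableOn ℂ U Ω) {A : Matrix (Fin d) (Fin d) ℝ}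
    (h0 : ∀ x, io x ∈ Ω → ∑ i, ∑ j, (A i j : ℂ) * Gl U [i, j] (io x) = 0) (l : List (Fin d)) :
    ∀ x, io x ∈ Ω → ∑ i, ∑ j, (A i j : ℂ) * Gl U (i :: j :: l) (io x) = 0 := by
  induction l with
  | nil => exact h0
  | cons k l ih =>
    have hW : DifferentiableOn ℂ (fun z => ∑ i, ∑ j, (A i j : ℂ) * Gl U (i :: j :: l) z) Ω :=
      DifferentiableOn.fun_sum fun i _ => DifferentiableOn.fun_sum fun j _ => (Gl_diff hΩ hU _).const_mul _
    have h1 := cd_zero_real hΩ hW ih k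
    intro x hx
    rw [← h1 x hx]
    have hda : ∀ i j, DifferentiableAt ℂ (Gl U (i :: j :: l)) (io x) := fun i j => (Gl_diff hΩ hU _).differentiableAt (hΩ.mem_nhds hx)
    have : cd k (fun z => ∑ i, ∑ j, (A i j : ℂ) * Gl U (i :: j :: l) z) (io x) = ∑ i, ∑ j, (A i j : ℂ) * Gl U (k :: i :: j :: l) (io x) := by
      unfold cd
      rw [fderiv_fun_sum fun i _ => DifferentiableAt.fun_sum fun j _ => (hda i j).const_mul _]
      simp only [_root_.sum_apply]
      refine Finset.sum_congr rfl fun i _ => ?_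
      rw [fderiv_fun_sum fun j _ => (hda i j).const_mul _]
      simp only [_root_.sum_apply]
      refine Finset.sum_congr rfl fun j _ => ?_
      rw [fderiv_const_mul (hda i j)]
      rfl
    rw [this]
    refine Finset.sum_congr rfl fun i _ => Finset.sum_congr rfl fun j _ => ?_
    congr 1
    rw [Gl_swap hΩ hU k i (j :: l) _ hx]
    exact cd_congr hΩ (Gl_swap hΩ hU j k l) i _ hx

end DER
end SSM

namespace SSM

section TAY
variable {d : ℕ}
open MvPolynomial

def Sp (c : List (Fin d) → ℝ) : ℕ → List (Fin d) → MvPolynomial (Fin d) ℝ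
  | 0, l => C (c l)
  | k + 1, l => ∑ i, X i * Sp c k (i :: l)

variable {c : List (Fin d) → ℝ}

lemma Sp_hom (k : ℕ) (l) : (Sp c k l).IsHomogeneous k := by
  induction k generalizing l with
  | zero => exact isHomogeneous_C _ _
  | succ k ih =>
    unfold Sp
    refine IsHomogeneous.sum _ _ _ fun i _ => ?_
    rw [add_comm]
    exact (isHomogeneous_X _ _).mul (ih _)

lemma Sp_perm (hc : ∀ l l', l.Perm l' → c l = c l') (k : ℕ) : ∀ l l', l.Perm l' → Sp c k l = Sp c k l' := by
  induction k with
  | zero => intro l l' h; simp only [Sp]; rw [hc l l' h]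
  | succ k ih =>
    intro l l' h
    simp only [Sp]
    exact Finset.sum_congr rfl fun i _ => by rw [ih _ _ (h.cons i)]

lemma Sp_pderiv (hc : ∀ l l', l.Perm l' → c l = c l') (i : Fin d) (k : ℕ) : ∀ l, pderiv i (Sp c (k + 1) l) = ((k : MvPolynomial (Fin d) ℝ) + 1) * Sp c k (i :: l) := by
  induction k with
  | zero =>
    intro l
    simp [Sp, pderiv_X, Pi.single_apply]
  | succ k ih =>
    intro l
    rw [Sp]
    simp only [map_sum, Derivation.leibniz, smul_eq_mul, pderiv_X, ih, Finset.sum_add_distrib]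
    have h1 : ∑ j, X j * (((k : MvPolynomial (Fin d) ℝ) + 1) * Sp c k (i :: j :: l)) = ((k : MvPolynomial (Fin d) ℝ) + 1) * Sp c (k + 1) (i :: l) := by
      rw [Sp, Finset.mul_sum]
      refine Finset.sum_congr rfl fun j _ => ?_
      rw [Sp_perm hc k (i :: j :: l) (j :: i :: l) (List.Perm.swap _ _ _)]; ring
    rw [h1]
    have h2 : ∑ j, Sp c (k + 1) (j :: l) * (Pi.single i 1 : Fin d → MvPolynomial (Fin d) ℝ) j = Sp c (k + 1) (i :: l) := by
      simp [Pi.single_apply]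
    rw [h2]
    push_cast; ring

lemma Sp_pde0 (hc : ∀ l l', l.Perm l' → c l = c l') {A : Matrix (Fin d) (Fin d) ℝ}
    (hA : ∀ l, ∑ i, ∑ j, A i j * c (i :: j :: l) = 0) (k : ℕ) : ∀ l, ∑ i, ∑ j, C (A i j) * Sp c k (j :: i :: l) = 0 := by
  induction k with
  | zero =>
    intro l
    simp only [Sp, ← C_mul, ← map_sum]
    rw [← C_0]
    congr 1
    rw [← hA l]
    exact Finset.sum_congr rfl fun i _ => Finset.sum_congr rfl fun j _ => by rw [hc _ _ (List.Perm.swap i j l)]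
  | succ k ih =>
    intro l
    simp only [Sp, Finset.mul_sum]
    have : ∀ q, ∑ i, ∑ j, C (A i j) * (X q * Sp c k (q :: j :: i :: l)) = 0 := by
      intro q
      have h := ih (q :: l)
      have h2 : ∑ i, ∑ j, C (A i j) * (X q * Sp c k (q :: j :: i :: l)) = X q * ∑ i, ∑ j, C (A i j) * Sp c k (j :: i :: q :: l) := by
        simp only [Finset.mul_sum]
        refine Finset.sum_congr rfl fun i _ => Finset.sum_congr rfl fun j _ => ?_
        have hp : (q :: j :: i :: l).Perm (j :: i :: q :: l) :=
          (List.Perm.swap _ _ _).trans ((List.Perm.swap _ _ _).cons j)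
        rw [Sp_perm hc k _ _ hp]; ring
      rw [h2, h, mul_zero]
    calc _ = ∑ i, ∑ q, ∑ j, C (A i j) * (X q * Sp c k (q :: j :: i :: l)) := by
            exact Finset.sum_congr rfl fun i _ => Finset.sum_comm
      _ = ∑ q, ∑ i, ∑ j, C (A i j) * (X q * Sp c k (q :: j :: i :: l)) := Finset.sum_comm
      _ = 0 := Finset.sum_eq_zero fun q _ => this q

lemma Sp_pde (hc : ∀ l l', l.Perm l' → c l = c l') {A : Matrix (Fin d) (Fin d) ℝ}
    (hA : ∀ l, ∑ i, ∑ j, A i j * c (i :: j :: l) = 0) (k : ℕ) (l) :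
    ∑ i, ∑ j, C (A i j) * pderiv j (pderiv i (Sp c k l)) = 0 := by
  match k with
  | 0 => simp [Sp]
  | 1 =>
    refine Finset.sum_eq_zero fun i _ => Finset.sum_eq_zero fun j _ => ?_
    rw [Sp_pderiv hc i 0 l]
    simp [Sp]
  | k + 2 =>
    have h1 : ∀ i j, pderiv j (pderiv i (Sp c (k + 2) l)) = (((k + 1 : ℕ) : MvPolynomial (Fin d) ℝ) + 1) * (((k : MvPolynomial (Fin d) ℝ) + 1) * Sp c k (j :: i :: l)) := by
      intro i j
      rw [Sp_pderiv hc i (k + 1) l, Derivation.leibniz, Sp_pderiv hc j k]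
      have : pderiv j (((k + 1 : ℕ) : MvPolynomial (Fin d) ℝ) + 1) = 0 := by simp
      rw [this]; simp
    simp_rw [h1]
    have h2 := Sp_pde0 hc hA k l
    calc _ = (((k + 1 : ℕ) : MvPolynomial (Fin d) ℝ) + 1) * ((k : MvPolynomial (Fin d) ℝ) + 1) * ∑ i, ∑ j, C (A i j) * Sp c k (j :: i :: l) := by
            simp only [Finset.mul_sum]
            exact Finset.sum_congr rfl fun i _ => Finset.sum_congr rfl fun j _ => by ring
      _ = 0 := by rw [h2, mul_zero]

/-- if `S_k [] = 0` for all `k < K` then `c l = 0` for all `l` of length `< K` -/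
lemma Sp_zero (hc : ∀ l l', l.Perm l' → c l = c l') {k : ℕ} : ∀ l, Sp c k l = 0 → ∀ m : List (Fin d), m.length = k → c (m ++ l) = 0 := by
  induction k with
  | zero =>
    intro l h m hm
    rw [List.length_eq_zero_iff] at hm
    subst hm
    simpa [Sp] using h
  | succ k ih =>
    intro l h m hm
    obtain ⟨i, m', rfl⟩ := List.exists_cons_of_ne_nil (l := m) (by intro e; simp [e] at hm)
    have h1 : Sp c k (i :: l) = 0 := by
      have := Sp_pderiv hc i k l
      rw [h, map_zero] at this
      have hk : ((k : MvPolynomial (Fin d) ℝ) + 1) ≠ 0 := by exact_mod_cast Nat.succ_ne_zero k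
      exact (mul_eq_zero.1 this.symm).resolve_left hk
    have h2 := ih (i :: l) h1 m' (by simpa using hm)
    rw [← h2]
    exact hc _ _ (by simpa using (List.perm_middle (a := i) (l₁ := m') (l₂ := l)).symm)

variable {Ω : Set (Fin d → ℂ)} {U : (Fin d → ℂ) → ℂ}

lemma Gl_perm (hΩ : IsOpen Ω) (hU : DifferentiableOn ℂ U Ω) {l l' : List (Fin d)} (h : l.Perm l') : ∀ z ∈ Ω, Gl U l z = Gl U l' z := by
  induction h with
  | nil => intro z _; rfl
  | cons i _ ih => exact cd_congr hΩ ih i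
  | swap i j l => exact Gl_swap hΩ hU j i l
  | trans _ _ ih1 ih2 => intro z hz; rw [ih1 z hz, ih2 z hz]

lemma line_deriv (hΩ : IsOpen Ω) {G : (Fin d → ℂ) → ℂ} (hG : DifferentiableOn ℂ G Ω) {z0 w : Fin d → ℂ} {ζ : ℂ} (hz : z0 + ζ • w ∈ Ω) :
    HasDerivAt (fun ζ : ℂ => G (z0 + ζ • w)) (∑ i, w i * cd i G (z0 + ζ • w)) ζ := by
  have h1 := (hG.differentiableAt (hΩ.mem_nhds hz)).hasFDerivAt
  have h2 : HasDerivAt (fun ζ : ℂ => z0 + ζ • w) w ζ := by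
    simpa using! ((hasDerivAt_id ζ).smul_const w).const_add z0
  have h3 := h1.comp_hasDerivAt ζ h2
  have e : fderiv ℂ G (z0 + ζ • w) w = ∑ i, w i * cd i G (z0 + ζ • w) := by
    have hw : w = ∑ i, w i • (Pi.single i 1 : Fin d → ℂ) := by
      ext k; simp [Finset.sum_apply, Pi.single_apply]
    have hL : ∀ L : (Fin d → ℂ) →L[ℂ] ℂ, L w = ∑ i, w i * L (Pi.single i 1) := by
      intro L
      conv_lhs => rw [hw]
      rw [map_sum]
      simp
    exact hL _
  rw [← e]
  exact h3

lemma line_contDiffAt (hΩ : IsOpen Ω) {G : (Fin d → ℂ) → ℂ} (hG : DifferentiableOn ℂ G Ω) {z0 w : Fin d → ℂ} {ζ : ℂ} (hz : z0 + ζ • w ∈ Ω) (n : ℕ) :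
    ContDiffAt ℂ n (fun ζ : ℂ => G (z0 + ζ • w)) ζ := by
  have h1 : ContDiffAt ℂ n G (z0 + ζ • w) := (hol_contDiffOn hΩ n hG).contDiffAt (hΩ.mem_nhds hz)
  exact h1.comp ζ (by fun_prop)

lemma iter_line (hΩ : IsOpen Ω) (hU : DifferentiableOn ℂ U Ω) {z0 : Fin d → ℂ} (hz : z0 ∈ Ω) (hcv : ∀ l, Gl U l z0 = c l) (w : Fin d → ℂ) (k : ℕ) :
    ∀ l, iteratedDeriv k (fun ζ : ℂ => Gl U l (z0 + ζ • w)) 0 = aeval w (Sp c k l) := by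
  induction k with
  | zero => intro l; simp [Sp, hcv]
  | succ k ih =>
    intro l
    rw [iteratedDeriv_succ']
    have hev : deriv (fun ζ : ℂ => Gl U l (z0 + ζ • w)) =ᶠ[nhds 0] fun ζ => ∑ i, w i * Gl U (i :: l) (z0 + ζ • w) := by
      have hc : Continuous (fun ζ : ℂ => z0 + ζ • w) := by fun_prop
      have : (fun ζ : ℂ => z0 + ζ • w) ⁻¹' Ω ∈ nhds 0 := (hΩ.preimage hc).mem_nhds (by simpa using hz)
      filter_upwards [this] with ζ hζ
      exact (line_deriv hΩ (Gl_diff hΩ hU l) hζ).deriv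
    rw [hev.iteratedDeriv_eq]
    have hcd : ∀ i, ContDiffAt ℂ k (fun ζ : ℂ => Gl U (i :: l) (z0 + ζ • w)) 0 := fun i =>
      line_contDiffAt hΩ (Gl_diff hΩ hU _) (by simpa using hz) k
    rw [iteratedDeriv_fun_sum fun i _ => contDiffAt_const.mul (hcd i)]
    simp only [Sp, map_sum, map_mul, aeval_X]
    refine Finset.sum_congr rfl fun i _ => ?_
    rw [iteratedDeriv_const_mul_field, ih]

end TAY
end SSM

namespace SSM

section TAYR
variable {d : ℕ}
open MvPolynomial Filter

variable {U : (Fin d → ℂ) → ℂ} {c : List (Fin d) → ℝ}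

lemma taylor_rem {z0 : Fin d → ℂ} {η M : ℝ} (hU : DifferentiableOn ℂ U (ball z0 η)) (hM : ∀ z ∈ ball z0 η, ‖U z‖ ≤ M)
    (hcv : ∀ l, Gl U l z0 = c l) (hη : 0 < η) (w : Fin d → ℂ) {R : ℝ} (hR : 2 ≤ R) (hRw : R * ‖w‖ < η) (K : ℕ) :
    ‖U (z0 + w) - ∑ k ∈ Finset.range K, ((k.factorial : ℂ))⁻¹ * aeval w (Sp c k [])‖ ≤ 2 * M / R ^ K := by
  have hM0 : 0 ≤ M := (norm_nonneg _).trans (hM z0 (mem_ball_self hη))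
  set s := (η - R * ‖w‖) / (2 * (‖w‖ + 1)) with hs
  have hs0 : 0 < s := by
    have : 0 < η - R * ‖w‖ := by linarith
    positivity
  have hsw : (R + s) * ‖w‖ < η := by
    have h1 : s * (2 * (‖w‖ + 1)) = η - R * ‖w‖ := by rw [hs]; field_simp
    nlinarith [norm_nonneg w]
  set φ : ℂ → ℂ := fun ζ => U (z0 + ζ • w) with hφ
  have hmap : ∀ ζ : ℂ, ζ ∈ ball (0 : ℂ) (R + s) → z0 + ζ • w ∈ ball z0 η := by
    intro ζ hζ
    rw [mem_ball_zero_iff] at hζ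
    rw [mem_ball_iff_norm, add_sub_cancel_left, norm_smul]
    nlinarith [norm_nonneg w, norm_nonneg ζ]
  have hφd : DifferentiableOn ℂ φ (ball 0 (R + s)) := by
    intro ζ hζ
    exact ((line_deriv isOpen_ball hU (hmap ζ hζ)).differentiableAt).differentiableWithinAt
  have hit : ∀ k, iteratedDeriv k φ 0 = aeval w (Sp c k []) := fun k =>
    iter_line isOpen_ball hU (mem_ball_self hη) hcv w k []
  have hsum := Complex.hasSum_taylorSeries_on_ball hφd (z := 1) (by rw [mem_ball_zero_iff]; simp; linarith)
  have hb : ∀ k, ‖iteratedDeriv k φ 0‖ ≤ k.factorial * M / R ^ k := by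
    intro k
    refine Complex.norm_iteratedDeriv_le_of_forall_mem_sphere_norm_le k (by linarith) ?_ ?_
    · refine DifferentiableOn.diffContOnCl_ball (U := ball 0 (R + s)) hφd ?_
      exact closedBall_subset_ball (by linarith)
    · intro ζ hζ
      refine hM _ (hmap ζ ?_)
      rw [mem_sphere_zero_iff_norm] at hζ
      rw [mem_ball_zero_iff]; linarith
  simp only [sub_zero, one_pow, one_mul, hit, smul_eq_mul] at hsum
  have h2 := (hasSum_nat_add_iff' K).2 hsum
  have hφ1 : φ 1 = U (z0 + w) := by simp [hφ]
  rw [hφ1] at h2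
  rw [← h2.tsum_eq]
  have hR0 : 0 < R := by linarith
  have hg : HasSum (fun k : ℕ => M / R ^ K * (1 / R) ^ k) (M / R ^ K * (1 - 1 / R)⁻¹) :=
    (hasSum_geometric_of_lt_one (by positivity) (by rw [div_lt_one hR0]; linarith)).mul_left _
  refine (tsum_of_norm_bounded hg ?_).trans ?_
  · intro k
    rw [norm_mul, norm_inv, Complex.norm_natCast, ← hit]
    have := hb (k + K)
    have hf : (0 : ℝ) < (k + K).factorial := by positivity
    calc _ ≤ ((k + K).factorial : ℝ)⁻¹ * ((k + K).factorial * M / R ^ (k + K)) := by gcongr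
      _ = M / R ^ K * (1 / R) ^ k := by rw [pow_add, div_pow, one_pow]; field_simp
  · have h3 : (1 - 1 / R)⁻¹ ≤ 2 := by
      have : (1 / R) ≤ 1 / 2 := by gcongr
      rw [inv_le_comm₀ (by linarith) (by norm_num)]; linarith
    calc _ ≤ M / R ^ K * 2 := by gcongr
      _ = _ := by ring

lemma Gl_bound (l : List (Fin d)) : ∀ ρ : ℝ, 0 < ρ → ∃ C, 0 < C ∧ ∀ (U : (Fin d → ℂ) → ℂ) (z : Fin d → ℂ) (B : ℝ),
    DifferentiableOn ℂ U (ball z ρ) → (∀ y ∈ ball z ρ, ‖U y‖ ≤ B) → ‖Gl U l z‖ ≤ C * B := by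
  induction l with
  | nil =>
    intro ρ hρ
    exact ⟨1, one_pos, fun U z B _ hB => by rw [one_mul]; exact hB z (mem_ball_self hρ)⟩
  | cons i l ih =>
    intro ρ hρ
    obtain ⟨C, hC, h⟩ := ih (ρ / 2) (by positivity)
    refine ⟨2 * C / (ρ / 2), by positivity, fun U z B hU hB => ?_⟩
    have hsub : ∀ y ∈ ball z (ρ / 2), ball y (ρ / 2) ⊆ ball z ρ := by
      intro y hy
      refine ball_subset_ball' ?_
      rw [mem_ball] at hy; linarith
    have h1 : ∀ y ∈ ball z (ρ / 2), ‖Gl U l y‖ ≤ C * B := fun y hy =>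
      h U y B (hU.mono (hsub y hy)) fun y' hy' => hB y' (hsub y hy hy')
    have h2 : DifferentiableOn ℂ (Gl U l) (ball z (ρ / 2)) :=
      (Gl_diff isOpen_ball hU l).mono (ball_subset_ball (by linarith))
    have h3 := cauchy_fderiv_bound (half_pos hρ) h2 h1
    have h4 : ‖fderiv ℂ (Gl U l) z (Pi.single i 1)‖ ≤ ‖fderiv ℂ (Gl U l) z‖ * 1 := by
      refine ContinuousLinearMap.le_opNorm_of_le _ ?_
      rw [Pi.norm_single]; simp
    calc ‖Gl U (i :: l) z‖ ≤ _ := h4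
      _ ≤ 2 * (C * B) / (ρ / 2) := by rw [mul_one]; exact h3
      _ = _ := by ring

variable {ι : Type*} {𝓕 : Filter ι}

lemma Sp_conv {cn : ι → List (Fin d) → ℝ} (h : ∀ l, Tendsto (fun n => cn n l) 𝓕 (nhds (c l))) {R : ℝ} (hR : 0 < R) (k : ℕ) :
    ∀ l, ∀ ε > 0, ∀ᶠ n in 𝓕, ∀ w : Fin d → ℂ, ‖w‖ ≤ R → ‖aeval w (Sp (cn n) k l) - aeval w (Sp c k l)‖ ≤ ε := by
  induction k with
  | zero =>
    intro l ε hε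
    filter_upwards [(Metric.tendsto_nhds.1 (h l)) ε hε] with n hn w _
    simp only [Sp, aeval_C]
    rw [Real.dist_eq] at hn
    simp only [Complex.coe_algebraMap]
    rw [← Complex.ofReal_sub, Complex.norm_real]
    exact hn.le
  | succ k ih =>
    intro l ε hε
    have hd0 : (0 : ℝ) < d + 1 := by positivity
    have : ∀ᶠ n in 𝓕, ∀ i : Fin d, ∀ w : Fin d → ℂ, ‖w‖ ≤ R → ‖aeval w (Sp (cn n) k (i :: l)) - aeval w (Sp c k (i :: l))‖ ≤ ε / (R * (d + 1)) :=
      eventually_all.2 fun i => ih (i :: l) _ (by positivity)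
    filter_upwards [this] with n hn w hw
    simp only [Sp, map_sum, map_mul, aeval_X]
    rw [← Finset.sum_sub_distrib]
    refine (norm_sum_le _ _).trans ?_
    calc _ ≤ ∑ i : Fin d, R * (ε / (R * (d + 1))) := by
            refine Finset.sum_le_sum fun i _ => ?_
            rw [← mul_sub, norm_mul]
            have := hn i w hw
            have h2 := (norm_le_pi_norm w i).trans hw
            gcongr
      _ = d * (ε / (d + 1)) := by
            rw [Finset.sum_const, Finset.card_univ, Fintype.card_fin, nsmul_eq_mul]; field_simp
      _ ≤ ε := by
            rw [mul_div_assoc', div_le_iff₀ hd0]; nlinarith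

lemma blowup {Un : ι → (Fin d → ℂ) → ℂ} {cn : ι → List (Fin d) → ℝ} {z0 : Fin d → ℂ} {η M : ℝ} (hη : 0 < η) (hM0 : 0 < M)
    (hU : ∀ n, DifferentiableOn ℂ (Un n) (ball z0 η)) (hM : ∀ n, ∀ z ∈ ball z0 η, ‖Un n z‖ ≤ M)
    (hcv : ∀ n l, Gl (Un n) l z0 = cn n l) (h : ∀ l, Tendsto (fun n => cn n l) 𝓕 (nhds (c l)))
    {m : ℕ} (hz : ∀ k < m, Sp c k [] = 0) {R : ℝ} (hR : 0 < R) {ε : ℝ} (hε : 0 < ε) :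
    ∃ ρ, 0 < ρ ∧ ρ * R < η ∧ ∀ᶠ n in 𝓕, ∀ z : Fin d → ℂ, ‖z‖ ≤ R →
      ‖((ρ : ℂ) ^ m)⁻¹ * Un n (z0 + (ρ : ℂ) • z) - (m.factorial : ℂ)⁻¹ * aeval z (Sp c m [])‖ ≤ ε := by
  -- choose ρ
  set q := 2 * R / η with hq
  have hq0 : 0 < q := by positivity
  set ρ := min (1 / (2 * q)) (ε / (4 * M * q ^ (m + 1))) with hρ
  have hρ0 : 0 < ρ := lt_min (by positivity) (by positivity)
  have hρ1 : ρ * q ≤ 1 / 2 := by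
    have : ρ ≤ 1 / (2 * q) := min_le_left _ _
    calc ρ * q ≤ 1 / (2 * q) * q := by gcongr
      _ = 1 / 2 := by field_simp
  have hρ2 : ρ * (4 * M * q ^ (m + 1)) ≤ ε := by
    have : ρ ≤ ε / (4 * M * q ^ (m + 1)) := min_le_right _ _
    rwa [le_div_iff₀ (by positivity)] at this
  have hρR : ρ * R < η := by
    have : ρ * q = ρ * R * 2 / η := by rw [hq]; ring
    rw [this, div_le_iff₀ hη] at hρ1
    nlinarith
  refine ⟨ρ, hρ0, hρR, ?_⟩
  have hev : ∀ᶠ n in 𝓕, ∀ k ∈ Finset.range (m + 1), ∀ w : Fin d → ℂ, ‖w‖ ≤ ρ * R → ‖aeval w (Sp (cn n) k []) - aeval w (Sp c k [])‖ ≤ ε * ρ ^ m / (2 * (m + 1)) :=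
    (Finset.eventually_all _).2 fun k _ => Sp_conv h (by positivity) k [] _ (by positivity)
  filter_upwards [hev] with n hn z hzR
  have hρm : (0 : ℝ) < ρ ^ m := by positivity
  have hw : ‖(ρ : ℂ) • z‖ ≤ ρ * R := by
    rw [norm_smul, Complex.norm_real, Real.norm_of_nonneg hρ0.le]; gcongr
  set w := (ρ : ℂ) • z with hwd
  have hRR : 2 ≤ 1 / (ρ * q) := by
    rw [le_div_iff₀ (by positivity)]; linarith
  have hRw : 1 / (ρ * q) * ‖w‖ < η := by
    calc 1 / (ρ * q) * ‖w‖ ≤ 1 / (ρ * q) * (ρ * R) := by gcongr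
      _ = η / 2 := by rw [hq]; field_simp
      _ < η := by linarith
  have h1 := taylor_rem (hU n) (hM n) (hcv n) hη w hRR hRw (m + 1)
  have h2 : ‖∑ k ∈ Finset.range (m + 1), ((k.factorial : ℂ))⁻¹ * aeval w (Sp (cn n) k []) - ∑ k ∈ Finset.range (m + 1), ((k.factorial : ℂ))⁻¹ * aeval w (Sp c k [])‖ ≤ ε * ρ ^ m / 2 := by
    rw [← Finset.sum_sub_distrib]
    refine (norm_sum_le _ _).trans ?_
    calc _ ≤ ∑ k ∈ Finset.range (m + 1), ε * ρ ^ m / (2 * (m + 1)) := by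
            refine Finset.sum_le_sum fun k hk => ?_
            rw [← mul_sub, norm_mul, norm_inv, Complex.norm_natCast]
            have hf : ((k.factorial : ℝ))⁻¹ ≤ 1 := by
              apply inv_le_one_of_one_le₀
              exact_mod_cast Nat.one_le_iff_ne_zero.2 (Nat.factorial_ne_zero k)
            calc _ ≤ 1 * (ε * ρ ^ m / (2 * (m + 1))) := by
                    gcongr
                    exact hn k hk w hw
              _ = _ := one_mul _
      _ = _ := by
            rw [Finset.sum_const, Finset.card_range, nsmul_eq_mul]; push_cast; field_simp
  have h3 : ∑ k ∈ Finset.range (m + 1), ((k.factorial : ℂ))⁻¹ * aeval w (Sp c k []) = (ρ : ℂ) ^ m * ((m.factorial : ℂ)⁻¹ * aeval z (Sp c m [])) := by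
    rw [Finset.sum_range_succ, Finset.sum_eq_zero, zero_add]
    · have : aeval w (Sp c m []) = (ρ : ℂ) ^ m * aeval z (Sp c m []) := hom_scale (Sp_hom m []) (ρ : ℂ) z
      rw [this]; ring
    · intro k hk
      rw [hz k (Finset.mem_range.1 hk)]; simp
  have h4 : 2 * M / (1 / (ρ * q)) ^ (m + 1) ≤ ε * ρ ^ m / 2 := by
    have : 2 * M / (1 / (ρ * q)) ^ (m + 1) = (ρ * (4 * M * q ^ (m + 1))) * ρ ^ m / 2 := by
      rw [one_div, inv_pow, div_inv_eq_mul, mul_pow, pow_succ ρ]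
      ring
    rw [this]; gcongr
  have h5 : ‖Un n (z0 + w) - (ρ : ℂ) ^ m * ((m.factorial : ℂ)⁻¹ * aeval z (Sp c m []))‖ ≤ ε * ρ ^ m := by
    rw [← h3]
    calc _ ≤ _ := norm_sub_le_norm_sub_add_norm_sub _ (∑ k ∈ Finset.range (m + 1), ((k.factorial : ℂ))⁻¹ * aeval w (Sp (cn n) k [])) _
      _ ≤ ε * ρ ^ m := by linarith
  have hρc : (ρ : ℂ) ^ m ≠ 0 := pow_ne_zero _ (Complex.ofReal_ne_zero.2 hρ0.ne')
  have h6 : ((ρ : ℂ) ^ m)⁻¹ * Un n (z0 + w) - (m.factorial : ℂ)⁻¹ * aeval z (Sp c m []) = ((ρ : ℂ) ^ m)⁻¹ * (Un n (z0 + w) - (ρ : ℂ) ^ m * ((m.factorial : ℂ)⁻¹ * aeval z (Sp c m []))) := by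
    field_simp
  rw [h6, norm_mul, norm_inv, norm_pow, Complex.norm_real, Real.norm_of_nonneg hρ0.le, inv_mul_le_iff₀ hρm]
  linarith

end TAYR
end SSM

namespace SSM

section NONDEG
variable {d : ℕ} {lam M : ℝ}
open MvPolynomial Filter

structure Sol (d : ℕ) (lam M : ℝ) (A : Matrix (Fin d) (Fin d) ℝ) (U : (Fin d → ℂ) → ℂ) : Prop where
  ell : ∃ B, Ell d lam A B
  diff : DifferentiableOn ℂ U (Om d (eta d lam))
  bd : ∀ z ∈ Om d (eta d lam), ‖U z‖ ≤ M
  im : ∀ l x, io x ∈ Om d (eta d lam) → (Gl U l (io x)).im = 0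
  pde : ∀ l x, io x ∈ Om d (eta d lam) → ∑ i, ∑ j, (A i j : ℂ) * Gl U (i :: j :: l) (io x) = 0

lemma ball_Om {x : EuclideanSpace ℝ (Fin d)} (hx : x ∈ closedBall (0 : EuclideanSpace ℝ (Fin d)) (1/2)) {η : ℝ} :
    ball (io x) η ⊆ Om d η := by
  intro z hz
  rw [mem_ball_iff_norm] at hz
  exact mem_Om.2 ⟨x, hx, hz⟩

lemma io_dist (x y : EuclideanSpace ℝ (Fin d)) : ‖io x - io y‖ ≤ ‖x - y‖ := by
  refine (pi_norm_le_iff_of_nonneg (norm_nonneg _)).2 fun k => ?_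
  have : (io x - io y) k = (((x - y) k : ℝ) : ℂ) := by simp [io]
  rw [this, Complex.norm_real]
  exact coord_le (x - y) k

lemma Sol.re_eq {A : Matrix (Fin d) (Fin d) ℝ} {U} (h : Sol d lam M A U) {x : EuclideanSpace ℝ (Fin d)} (hx : io x ∈ Om d (eta d lam)) (l) :
    Gl U l (io x) = (((Gl U l (io x)).re : ℝ) : ℂ) := by
  apply Complex.ext
  · simp
  · simp [h.im l x hx]

lemma Sp_c0 (k : ℕ) : ∀ l, Sp (fun _ : List (Fin d) => (0 : ℝ)) k l = 0 := by
  induction k with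
  | zero => intro l; simp [Sp]
  | succ k ih => intro l; simp [Sp, ih]

variable {ι : Type*} {𝓕 : Filter ι}

lemma near_zero {Un : ι → (Fin d → ℂ) → ℂ} {cn : ι → List (Fin d) → ℝ} {z0 : Fin d → ℂ} {η M : ℝ} (hη : 0 < η) (hM0 : 0 < M)
    (hU : ∀ n, DifferentiableOn ℂ (Un n) (ball z0 η)) (hM : ∀ n, ∀ z ∈ ball z0 η, ‖Un n z‖ ≤ M)
    (hcv : ∀ n l, Gl (Un n) l z0 = cn n l) (h : ∀ l, Tendsto (fun n => cn n l) 𝓕 (nhds 0)) {ε : ℝ} (hε : 0 < ε) :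
    ∀ᶠ n in 𝓕, ∀ z ∈ ball z0 (η / 4), ‖Un n z‖ ≤ ε := by
  obtain ⟨K, hK⟩ := exists_pow_lt_of_lt_one (show 0 < ε / (4 * M) by positivity) (show (1 / 2 : ℝ) < 1 by norm_num)
  have hev : ∀ᶠ n in 𝓕, ∀ k ∈ Finset.range K, ∀ w : Fin d → ℂ, ‖w‖ ≤ η / 4 → ‖aeval w (Sp (cn n) k []) - aeval w (Sp (fun _ : List (Fin d) => (0 : ℝ)) k [])‖ ≤ ε / (2 * (K + 1)) :=
    (Finset.eventually_all _).2 fun k _ => Sp_conv h (by positivity) k [] _ (by positivity)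
  filter_upwards [hev] with n hn z hz
  rw [mem_ball_iff_norm] at hz
  set w := z - z0 with hw
  have h1 := taylor_rem (hU n) (hM n) (hcv n) hη w le_rfl (by linarith) K
  have e : z0 + w = z := by rw [hw]; abel
  rw [e] at h1
  have h2 : ‖∑ k ∈ Finset.range K, ((k.factorial : ℂ))⁻¹ * aeval w (Sp (cn n) k [])‖ ≤ ε / 2 := by
    refine (norm_sum_le _ _).trans ?_
    calc _ ≤ ∑ k ∈ Finset.range K, ε / (2 * (K + 1)) := by
            refine Finset.sum_le_sum fun k hk => ?_
            rw [norm_mul, norm_inv, Complex.norm_natCast]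
            have hf : ((k.factorial : ℝ))⁻¹ ≤ 1 := by
              apply inv_le_one_of_one_le₀
              exact_mod_cast Nat.one_le_iff_ne_zero.2 (Nat.factorial_ne_zero k)
            have h3 := hn k hk w hz.le
            rw [Sp_c0, map_zero, sub_zero] at h3
            calc _ ≤ 1 * (ε / (2 * (K + 1))) := by gcongr
              _ = _ := one_mul _
      _ = K * ε / (2 * (K + 1)) := by
            rw [Finset.sum_const, Finset.card_range, nsmul_eq_mul]; ring
      _ ≤ _ := by
            rw [div_le_div_iff₀ (by positivity) (by positivity)]
            nlinarith
  have h3 : 2 * M / 2 ^ K ≤ ε / 2 := by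
    rw [div_pow, one_pow, lt_div_iff₀ (by positivity)] at hK
    have : 2 * M / 2 ^ K = 1 / 2 ^ K * (4 * M) / 2 := by ring
    rw [this]; linarith
  calc ‖Un n z‖ ≤ ‖Un n z - ∑ k ∈ Finset.range K, ((k.factorial : ℂ))⁻¹ * aeval w (Sp (cn n) k [])‖ + ‖∑ k ∈ Finset.range K, ((k.factorial : ℂ))⁻¹ * aeval w (Sp (cn n) k [])‖ := by
        simpa using norm_add_le (Un n z - ∑ k ∈ Finset.range K, ((k.factorial : ℂ))⁻¹ * aeval w (Sp (cn n) k [])) (∑ k ∈ Finset.range K, ((k.factorial : ℂ))⁻¹ * aeval w (Sp (cn n) k []))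
    _ ≤ ε := by linarith

def Flat (𝓕 : Filter ι) (Un : ι → (Fin d → ℂ) → ℂ) (x : EuclideanSpace ℝ (Fin d)) : Prop :=
  ∀ l, Tendsto (fun n => Gl (Un n) l (io x)) 𝓕 (nhds 0)

lemma flat_near (hd : 2 ≤ d) (hl : 0 < lam) (hM : 0 < M) {An : ι → Matrix (Fin d) (Fin d) ℝ} {Un : ι → (Fin d → ℂ) → ℂ} (hS : ∀ n, Sol d lam M (An n) (Un n))
    {x : EuclideanSpace ℝ (Fin d)} (hx : x ∈ closedBall (0 : EuclideanSpace ℝ (Fin d)) (1/2)) (hF : Flat 𝓕 Un x) {ε : ℝ} (hε : 0 < ε) :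
    ∀ᶠ n in 𝓕, ∀ z ∈ ball (io x) (eta d lam / 4), ‖Un n z‖ ≤ ε := by
  have hη := eta_pos hd hl
  have hm : io x ∈ Om d (eta d lam) := ball_Om hx (mem_ball_self hη)
  refine near_zero (cn := fun n l => (Gl (Un n) l (io x)).re) hη hM (fun n => (hS n).diff.mono (ball_Om hx)) (fun n z hz => (hS n).bd z (ball_Om hx hz))
    (fun n l => (hS n).re_eq hm l) (fun l => ?_) hε
  have := (Complex.continuous_re.tendsto 0).comp (hF l)
  simpa using! this

lemma flat_step (hd : 2 ≤ d) (hl : 0 < lam) (hM : 0 < M) {An : ι → Matrix (Fin d) (Fin d) ℝ} {Un : ι → (Fin d → ℂ) → ℂ} (hS : ∀ n, Sol d lam M (An n) (Un n))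
    {x : EuclideanSpace ℝ (Fin d)} (hx : x ∈ closedBall (0 : EuclideanSpace ℝ (Fin d)) (1/2)) (hF : Flat 𝓕 Un x)
    {y : EuclideanSpace ℝ (Fin d)} (hy : ‖y - x‖ ≤ eta d lam / 8) : Flat 𝓕 Un y := by
  have hη := eta_pos hd hl
  intro l
  obtain ⟨C, hC, h⟩ := Gl_bound l (eta d lam / 8) (by positivity)
  have hsub : ball (io y) (eta d lam / 8) ⊆ ball (io x) (eta d lam / 4) := by
    refine ball_subset_ball' ?_
    rw [dist_eq_norm]
    have := io_dist y x
    linarith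
  rw [Metric.tendsto_nhds]
  intro ε hε
  filter_upwards [flat_near hd hl hM hS hx hF (ε := ε / (2 * C)) (by positivity)] with n hn
  rw [dist_zero_right]
  have h1 := h (Un n) (io y) (ε / (2 * C)) ((hS n).diff.mono (hsub.trans ((ball_subset_ball (by linarith)).trans (ball_Om hx)))) fun z hz => hn z (hsub hz)
  have : C * (ε / (2 * C)) = ε / 2 := by field_simp
  linarith

lemma flat_all (hd : 2 ≤ d) (hl : 0 < lam) (hM : 0 < M) {An : ι → Matrix (Fin d) (Fin d) ℝ} {Un : ι → (Fin d → ℂ) → ℂ} (hS : ∀ n, Sol d lam M (An n) (Un n))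
    {x : EuclideanSpace ℝ (Fin d)} (hx : x ∈ closedBall (0 : EuclideanSpace ℝ (Fin d)) (1/2)) (hF : Flat 𝓕 Un x)
    {y : EuclideanSpace ℝ (Fin d)} (hy : y ∈ closedBall (0 : EuclideanSpace ℝ (Fin d)) (1/2)) : Flat 𝓕 Un y := by
  have hη := eta_pos hd hl
  have key : ∀ k : ℕ, ∀ y : EuclideanSpace ℝ (Fin d), y ∈ closedBall (0 : EuclideanSpace ℝ (Fin d)) (1/2) → ‖y - x‖ ≤ k * (eta d lam / 8) → Flat 𝓕 Un y := by
    intro k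
    induction k with
    | zero =>
      intro y _ h
      have : y = x := by
        rw [← sub_eq_zero, ← norm_le_zero_iff]; simpa using h
      rw [this]; exact hF
    | succ k ih =>
      intro y hy h
      push_cast at h
      have hk : (0 : ℝ) < (k : ℝ) + 1 := by positivity
      set t : ℝ := k / (k + 1) with ht
      have ht0 : 0 ≤ t := by positivity
      have ht1 : t ≤ 1 := by rw [ht, div_le_one hk]; linarith
      have ht2 : 1 - t = 1 / (k + 1) := by rw [ht]; field_simp; ring
      set y' := x + t • (y - x) with hy'
      have hm : y' ∈ closedBall (0 : EuclideanSpace ℝ (Fin d)) (1/2) :=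
        (convex_closedBall _ _).add_smul_sub_mem hx hy ⟨ht0, ht1⟩
      refine flat_step hd hl hM hS hm (ih y' hm ?_) ?_
      · rw [hy', add_sub_cancel_left, norm_smul, Real.norm_of_nonneg ht0]
        calc t * ‖y - x‖ ≤ t * ((k + 1) * (eta d lam / 8)) := by gcongr
          _ = _ := by rw [ht]; field_simp
      · have : y - y' = (1 - t) • (y - x) := by rw [hy']; module
        rw [this, norm_smul, Real.norm_of_nonneg (by linarith), ht2]
        calc 1 / ((k : ℝ) + 1) * ‖y - x‖ ≤ 1 / ((k : ℝ) + 1) * ((k + 1) * (eta d lam / 8)) := by gcongr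
          _ = _ := by field_simp
  obtain ⟨k, hk⟩ := exists_nat_ge (‖y - x‖ / (eta d lam / 8))
  exact key k y hy (by rwa [div_le_iff₀ (by positivity)] at hk)

theorem not_flat (hd : 2 ≤ d) (hl : 0 < lam) (hM : 0 < M) (𝒰 : Ultrafilter ι) {An : ι → Matrix (Fin d) (Fin d) ℝ} {Un : ι → (Fin d → ℂ) → ℂ} (hS : ∀ n, Sol d lam M (An n) (Un n))
    {xn : ι → EuclideanSpace ℝ (Fin d)} (hxn : ∀ n, xn n ∈ closedBall (0 : EuclideanSpace ℝ (Fin d)) (1/2)) {ε : ℝ} (hε : 0 < ε) (hb : ∀ n, ε ≤ ‖Un n (io (xn n))‖)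
    {x : EuclideanSpace ℝ (Fin d)} (hx : x ∈ closedBall (0 : EuclideanSpace ℝ (Fin d)) (1/2)) : ¬ Flat (𝒰 : Filter ι) Un x := by
  intro hF
  have hη := eta_pos hd hl
  obtain ⟨y, hy, hlim⟩ := (isCompact_closedBall (0 : EuclideanSpace ℝ (Fin d)) (1/2)).ultrafilter_le_nhds (𝒰.map xn) (by
    rw [le_principal_iff, Ultrafilter.mem_coe, Ultrafilter.mem_map]
    exact Filter.univ_mem' hxn)
  have hF' := flat_all hd hl hM hS hx hF hy
  have h1 := flat_near hd hl hM hS hy hF' (half_pos hε)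
  have h2 : ∀ᶠ n in (𝒰 : Filter ι), xn n ∈ ball y (eta d lam / 4) := hlim (ball_mem_nhds y (by positivity))
  obtain ⟨n, hn1, hn2⟩ := (h1.and h2).exists
  have h3 := hn1 (io (xn n)) (by
    rw [mem_ball_iff_norm] at hn2 ⊢
    exact (io_dist _ _).trans_lt hn2)
  linarith [hb n]

end NONDEG
end SSM

namespace SSM

section LINK
variable {d : ℕ} {lam N : ℝ}
open Filter

theorem sol_exists (hd : 2 ≤ d) (hl : 0 < lam) (hl1 : lam ≤ 1) (hN : 1 < N) : ∃ M, 0 < M ∧ ∀ u : EuclideanSpace ℝ (Fin d) → ℝ, MemF d lam N u →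
    ∃ A U, Sol d lam M A U ∧ (∀ x ∈ ball (0 : EuclideanSpace ℝ (Fin d)) (1/2), U (io x) = u x ∧ ∀ i, Gl U [i] (io x) = gradient u x i) ∧
      ∃ x ∈ closedBall (0 : EuclideanSpace ℝ (Fin d)) (1/2), Real.sqrt (1 / N) ≤ ‖U (io x)‖ := by
  obtain ⟨M, hM, h⟩ := ext_exists (d := d) hd hl hl1
  refine ⟨M, hM, fun u hu => ?_⟩
  obtain ⟨⟨A, hA, hell, hw⟩, h1, h2⟩ := hu
  obtain ⟨B, hB⟩ := ell_exists hl hA hell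
  obtain ⟨U, hU, hb, hx⟩ := h A B u hB hw h1
  have hΩ := Om_open (d := d) (eta d lam)
  have hxx : ∀ x, io x ∈ Om d (eta d lam) → U (io x) = u x := fun x hx' =>
    hx x (ball_subset_ball (by norm_num) (real_mem hd hl hl1 hx'))
  have hr : ∀ x, io x ∈ Om d (eta d lam) → (U (io x)).im = 0 := fun x hx' => by
    rw [hxx x hx']; simp
  have hsub : io ⁻¹' Om d (eta d lam) ⊆ ball (0 : EuclideanSpace ℝ (Fin d)) 1 := fun x hx' =>
    ball_subset_ball (by norm_num) (real_mem hd hl hl1 hx')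
  have hin : ∀ x ∈ closedBall (0 : EuclideanSpace ℝ (Fin d)) (1/2), io x ∈ Om d (eta d lam) := fun x hx' =>
    ball_Om hx' (mem_ball_self (eta_pos hd hl))
  have him := Gl_im hΩ hU hr
  refine ⟨A, U, ⟨⟨B, hB⟩, hU, hb, him, fun l => pde hΩ hU (pde0 hΩ hU hr hw hsub hxx) l⟩, ?_, ?_⟩
  · intro x hx'
    have hxo := hin x (ball_subset_closedBall hx')
    refine ⟨hxx x hxo, fun i => ?_⟩
    rw [grad_coord]
    have e1 := reG_pd hΩ hU hxo i
    have e2 : pd i (reG U) x = pd i u x := by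
      have : reG U =ᶠ[nhds x] u := by
        filter_upwards [(hΩ.preimage io_cont).mem_nhds hxo] with y hy
        unfold reG
        rw [hxx y hy]; simp
      unfold pd
      rw [this.fderiv_eq]
    rw [← e2, e1]
    apply Complex.ext
    · simp [reG, Gl]
    · simp [him [i] x hxo]
  · have hav : 1 / N ≤ ⨍ x in ball (0 : EuclideanSpace ℝ (Fin d)) (1 / 2), (u x) ^ 2 := by
      rw [div_le_iff₀ (by linarith)]; linarith
    have hintg : IntegrableOn (fun x => (u x)^2) (ball (0 : EuclideanSpace ℝ (Fin d)) (1 / 2)) := by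
      by_contra hni
      rw [setAverage_eq, integral_undef hni, smul_zero] at hav
      have : 0 < 1 / N := by positivity
      linarith
    obtain ⟨x, hxb, hxv⟩ := exists_setAverage_le (measure_ball_pos volume (0 : EuclideanSpace ℝ (Fin d)) (by norm_num : (0:ℝ) < 1/2)).ne' measure_ball_lt_top.ne hintg
    refine ⟨x, ball_subset_closedBall hxb, ?_⟩
    rw [hxx x (hin x (ball_subset_closedBall hxb)), Complex.norm_real, Real.norm_eq_abs]
    rw [← Real.sqrt_sq_eq_abs]
    exact Real.sqrt_le_sqrt (hav.trans hxv)

end LINK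
end SSM

namespace SSM

section PIECE
variable {d : ℕ} {lam M : ℝ}
open Filter

lemma rank_ge_two {A B H : Matrix (Fin d) (Fin d) ℝ} (hl : 0 < lam) (hE : Ell d lam A B) (hs : ∀ p q, H p q = H q p) (hH : H ≠ 0)
    (htr : ∑ i, ∑ j, A i j * H i j = 0) : ∃ p q p' q', H p p' * H q q' - H p q' * H q p' ≠ 0 := by
  by_contra hcon
  push Not at hcon
  have hm : ∀ p q p' q', H p p' * H q q' = H p q' * H q p' := fun p q p' q' => by linarith [hcon p q p' q']
  obtain ⟨p, q, hpq⟩ : ∃ p q, H p q ≠ 0 := by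
    by_contra h
    push Not at h
    exact hH (Matrix.ext h)
  have hpp : H p p ≠ 0 := by
    intro h0
    have := hm p q p q
    rw [h0, zero_mul, hs q p] at this
    exact hpq (by simpa using this.symm)
  set v : EuclideanSpace ℝ (Fin d) := WithLp.toLp 2 (fun r => H r p) with hv
  have hb : bform A v v = H p p * ∑ i, ∑ j, A i j * H i j := by
    unfold bform
    rw [Finset.mul_sum]
    refine Finset.sum_congr rfl fun i _ => ?_
    rw [Finset.mul_sum]
    refine Finset.sum_congr rfl fun j _ => ?_
    have h1 := hm p i p j
    have h2 : v i = H i p := rfl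
    have h3 : v j = H j p := rfl
    have h4 : H p p * (A i j * H i j) = A i j * (H p p * H i j) := by ring
    rw [h2, h3, h4, h1, hs p j]; ring
  rw [htr, mul_zero] at hb
  have h1 := hE.low v
  rw [hb] at h1
  have h2 : ‖v‖ = 0 := by
    have : ‖v‖^2 ≤ 0 := by nlinarith [sq_nonneg ‖v‖]
    nlinarith [norm_nonneg v]
  rw [norm_eq_zero] at h2
  have : v p = 0 := by rw [h2]; rfl
  exact hpp this

/-- maximal minor -/
lemma max_minor {m : Fin d → Fin d → ℝ} (h : ∃ p q p' q', m p p' * m q q' - m p q' * m q p' ≠ 0) :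
    ∃ p q i j, i < j ∧ m p i * m q j - m p j * m q i ≠ 0 ∧
      ∀ k k', |m p k * m q k' - m p k' * m q k| ≤ |m p i * m q j - m p j * m q i| := by
  obtain ⟨p0, q0, i0, j0, h0⟩ := h
  set f : Fin d × Fin d × Fin d × Fin d → ℝ := fun t => |m t.1 t.2.2.1 * m t.2.1 t.2.2.2 - m t.1 t.2.2.2 * m t.2.1 t.2.2.1| with hf
  obtain ⟨t, -, ht⟩ := Finset.exists_max_image Finset.univ f ⟨(p0, q0, i0, j0), Finset.mem_univ _⟩
  obtain ⟨p, q, i, j⟩ := t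
  have hmax : ∀ k k', |m p k * m q k' - m p k' * m q k| ≤ |m p i * m q j - m p j * m q i| := fun k k' =>
    ht (p, q, k, k') (Finset.mem_univ _)
  have hne : m p i * m q j - m p j * m q i ≠ 0 := by
    have := ht (p0, q0, i0, j0) (Finset.mem_univ _)
    have h1 : 0 < f (p0, q0, i0, j0) := abs_pos.2 h0
    exact abs_pos.1 (h1.trans_le this)
  rcases lt_trichotomy i j with hij | hij | hij
  · exact ⟨p, q, i, j, hij, hne, hmax⟩
  · subst hij; exact absurd (by ring) hne
  · refine ⟨p, q, j, i, hij, ?_, fun k k' => ?_⟩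
    · intro h; apply hne; linarith
    · rw [abs_sub_comm (m p j * m q i)]; exact hmax k k'

lemma pivot {m : Fin d → Fin d → ℝ} {p q i j : Fin d} (hij : i < j) (hne : m p i * m q j - m p j * m q i ≠ 0)
    (hmax : ∀ k k', |m p k * m q k' - m p k' * m q k| ≤ |m p i * m q j - m p j * m q i|)
    {μ : ℝ} (hμ : ∀ q k, |m q k| ≤ μ) {ξ : Fin d → ℝ} {δ : ℝ} (he : ∀ q, |∑ k, ξ k * m q k| ≤ δ)
    (hδ : 2 * μ * δ ≤ |m p i * m q j - m p j * m q i| * (‖ξ‖ / 2)) :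
    ‖ξ‖ ≤ 2 * d * ‖fun k : {k // k ≠ i ∧ k ≠ j} => ξ k‖ := by
  set D := m p i * m q j - m p j * m q i with hD
  have hD0 : 0 < |D| := abs_pos.2 hne
  set T := ‖fun k : {k // k ≠ i ∧ k ≠ j} => ξ k‖ with hT
  have hT0 : 0 ≤ T := norm_nonneg _
  have hTk : ∀ k, k ≠ i → k ≠ j → |ξ k| ≤ T := fun k h1 h2 =>
    norm_le_pi_norm (fun k : {k // k ≠ i ∧ k ≠ j} => ξ k) ⟨k, h1, h2⟩
  have hμ0 : 0 ≤ μ := (abs_nonneg _).trans (hμ p i)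
  have hδ0 : 0 ≤ δ := (abs_nonneg _).trans (he p)
  have hd1 : (1 : ℝ) ≤ d := by
    have : 0 < d := i.pos
    exact_mod_cast this
  -- general estimate
  have gen : ∀ (a : Fin d → ℝ) (i0 : Fin d), (∀ k, |a k| ≤ |D|) → |a i0| = |D| → (∀ k, (k = i ∨ k = j) → k ≠ i0 → a k = 0) →
      |∑ k, ξ k * a k| ≤ 2 * μ * δ → |ξ i0| ≤ d * T + ‖ξ‖ / 2 := by
    intro a i0 ha hi0 haz hsum
    have h1 : ξ i0 * a i0 = ∑ k, ξ k * a k - ∑ k ∈ Finset.univ.erase i0, ξ k * a k := by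
      rw [← Finset.add_sum_erase Finset.univ (fun k => ξ k * a k) (Finset.mem_univ i0)]; ring
    have h2 : |∑ k ∈ Finset.univ.erase i0, ξ k * a k| ≤ d * (T * |D|) := by
      refine (Finset.abs_sum_le_sum_abs _ _).trans ?_
      calc _ ≤ ∑ k ∈ Finset.univ.erase i0, T * |D| := by
              refine Finset.sum_le_sum fun k hk => ?_
              rw [abs_mul]
              by_cases hk2 : k = i ∨ k = j
              · rw [haz k hk2 (Finset.ne_of_mem_erase hk)]; simp; positivity
              · push Not at hk2
                have := hTk k hk2.1 hk2.2
                have := ha k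
                gcongr
        _ ≤ ∑ k : Fin d, T * |D| := Finset.sum_le_sum_of_subset_of_nonneg (Finset.erase_subset _ _) fun _ _ _ => by positivity
        _ = d * (T * |D|) := by rw [Finset.sum_const, Finset.card_univ, Fintype.card_fin, nsmul_eq_mul]
    have h3 : |ξ i0| * |D| ≤ (d * T + ‖ξ‖ / 2) * |D| := by
      rw [← hi0, ← abs_mul, h1, hi0]
      refine (abs_sub _ _).trans ?_
      nlinarith
    exact le_of_mul_le_mul_right h3 hD0
  have hcomb : ∀ s : Fin d, |∑ k, ξ k * (m p k * m q s - m p s * m q k)| ≤ 2 * μ * δ := by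
    intro s
    have : ∑ k, ξ k * (m p k * m q s - m p s * m q k) = (∑ k, ξ k * m p k) * m q s - m p s * (∑ k, ξ k * m q k) := by
      rw [Finset.sum_mul, Finset.mul_sum, ← Finset.sum_sub_distrib]
      exact Finset.sum_congr rfl fun k _ => by ring
    rw [this]
    refine (abs_sub _ _).trans ?_
    rw [abs_mul, abs_mul]
    have h1 : |∑ k, ξ k * m p k| * |m q s| ≤ δ * μ := mul_le_mul (he p) (hμ q s) (abs_nonneg _) hδ0
    have h2 : |m p s| * |∑ k, ξ k * m q k| ≤ μ * δ := mul_le_mul (hμ p s) (he q) (abs_nonneg _) hμ0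
    linarith
  have hi := gen (fun k => m p k * m q j - m p j * m q k) i (fun k => hmax k j) rfl (by
    rintro k (h | h) hne'
    · exact absurd h hne'
    · subst h; ring) (hcomb j)
  have hj := gen (fun k => m p k * m q i - m p i * m q k) j (fun k => hmax k i) (by rw [hD, abs_sub_comm]) (by
    rintro k (h | h) hne'
    · subst h; ring
    · exact absurd h hne') (hcomb i)
  have hfin : ‖ξ‖ ≤ d * T + ‖ξ‖ / 2 := by
    refine (pi_norm_le_iff_of_nonneg (by positivity)).2 fun k => ?_
    rw [Real.norm_eq_abs]
    by_cases h1 : k = i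
    · rw [h1]; exact hi
    by_cases h2 : k = j
    · rw [h2]; exact hj
    have := hTk k h1 h2
    nlinarith [norm_nonneg ξ]
  linarith

lemma fderiv_expand {f : EuclideanSpace ℝ (Fin d) → ℝ} (x v : EuclideanSpace ℝ (Fin d)) : fderiv ℝ f x v = ∑ p, v p * pd p f x := by
  have hL : ∀ L : EuclideanSpace ℝ (Fin d) →L[ℝ] ℝ, L v = ∑ p, v p * L (EuclideanSpace.single p 1) := by
    intro L
    have hw : v = ∑ i, v i • (EuclideanSpace.single i (1 : ℝ)) := by
      ext k; simp [Pi.single_apply]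
    conv_lhs => rw [hw]
    rw [map_sum]
    simp
  exact hL _

theorem piece (hl : 0 < lam) {A : Matrix (Fin d) (Fin d) ℝ} {U} (hS : Sol d lam M A U) {x : EuclideanSpace ℝ (Fin d)} (hx : io x ∈ Om d (eta d lam))
    (h0 : U (io x) = 0) (h1 : ∀ i, Gl U [i] (io x) = 0) (hnf : ∃ l, Gl U l (io x) ≠ 0) (Ξ : EuclideanSpace ℝ (Fin d) ≃L[ℝ] (Fin d → ℝ)) :
    ∃ l i j, i < j ∧ (∀ q, reG (Gl U (q :: l)) x = 0) ∧ ∃ V ∈ nhds x, ∀ x' ∈ V, ∀ x'' ∈ V,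
      (∀ q, reG (Gl U (q :: l)) x' = 0) → (∀ q, reG (Gl U (q :: l)) x'' = 0) →
      ‖Ξ (x' - x'')‖ ≤ 2 * d * ‖fun k : {k // k ≠ i ∧ k ≠ j} => Ξ (x' - x'') k.1‖ := by
  classical
  have hΩ := Om_open (d := d) (eta d lam)
  have hex : ∃ L : ℕ, ∃ l : List (Fin d), l.length = L ∧ Gl U l (io x) ≠ 0 := by
    obtain ⟨l, hl⟩ := hnf; exact ⟨_, l, rfl, hl⟩
  obtain ⟨ls, hlen, hls⟩ := Nat.find_spec hex
  have hmin : ∀ l : List (Fin d), l.length < ls.length → Gl U l (io x) = 0 := by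
    intro l hl
    by_contra h
    rw [hlen] at hl
    exact Nat.find_min hex hl ⟨l, rfl, h⟩
  match ls, hls, hmin with
  | [], hls, _ => exact absurd h0 hls
  | [i], hls, _ => exact absurd (h1 i) hls
  | p0 :: q0 :: l, hls, hmin =>
  have hz : ∀ q, reG (Gl U (q :: l)) x = 0 := fun q => by
    unfold reG; rw [hmin (q :: l) (by simp)]; rfl
  set H : Matrix (Fin d) (Fin d) ℝ := Matrix.of fun q p => reG (Gl U (p :: q :: l)) x with hH
  have hHs : ∀ p q, H p q = H q p := by
    intro p q
    simp only [hH, Matrix.of_apply, reG]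
    rw [Gl_perm hΩ hS.diff (List.Perm.swap p q l) _ hx]
  have hH0 : H ≠ 0 := by
    intro h
    have : H q0 p0 = 0 := by rw [h]; rfl
    simp only [hH, Matrix.of_apply, reG] at this
    apply hls
    rw [hS.re_eq hx, this]; simp
  have htr : ∑ i, ∑ j, A i j * H i j = 0 := by
    have := congrArg Complex.re (hS.pde l x hx)
    simp only [Complex.re_sum, Complex.re_ofReal_mul, Complex.zero_re] at this
    rw [← this]
    refine Finset.sum_congr rfl fun i _ => Finset.sum_congr rfl fun j _ => ?_
    rw [hHs i j]; rfl
  obtain ⟨B, hB⟩ := hS.ell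
  have hrk := rank_ge_two hl hB hHs hH0 htr
  set b : Fin d → EuclideanSpace ℝ (Fin d) := fun k => Ξ.symm (Pi.single k 1) with hb
  have hexp : ∀ z : EuclideanSpace ℝ (Fin d), ∀ p, z p = ∑ k, Ξ z k * b k p := by
    intro z p
    have hw : Ξ z = ∑ k, Ξ z k • (Pi.single k 1 : Fin d → ℝ) := by
      ext k; simp [Finset.sum_apply, Pi.single_apply]
    have h2 : z = ∑ k, Ξ z k • b k := by
      conv_lhs => rw [← Ξ.symm_apply_apply z, hw]
      rw [map_sum]
      simp [hb]
    conv_lhs => rw [h2]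
    simp
  set m : Fin d → Fin d → ℝ := fun q k => ∑ p, b k p * H q p with hm
  have hHm : ∀ q p, H q p = ∑ k, Ξ (EuclideanSpace.single p 1) k * m q k := by
    intro q p
    simp only [hm, Finset.mul_sum]
    rw [Finset.sum_comm]
    have : ∀ r, ∑ k, Ξ (EuclideanSpace.single p 1) k * (b k r * H q r) = (EuclideanSpace.single p (1:ℝ) : EuclideanSpace ℝ (Fin d)) r * H q r := by
      intro r
      rw [hexp (EuclideanSpace.single p 1) r, Finset.sum_mul]
      exact Finset.sum_congr rfl fun k _ => by ring
    simp only [this]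
    simp [Pi.single_apply]
  have hmin2 : ∃ p q p' q', m p p' * m q q' - m p q' * m q p' ≠ 0 := by
    by_contra hcon
    push Not at hcon
    obtain ⟨p, q, p', q', h⟩ := hrk
    apply h
    rw [hHm p p', hHm q q', hHm p q', hHm q p']
    rw [mul_comm (∑ k, Ξ (EuclideanSpace.single q' 1) k * m p k)]
    rw [Finset.sum_mul_sum, Finset.sum_mul_sum, ← Finset.sum_sub_distrib]
    refine Finset.sum_eq_zero fun k _ => ?_
    rw [← Finset.sum_sub_distrib]
    refine Finset.sum_eq_zero fun k' _ => ?_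
    have := hcon p q k k'
    linear_combination (Ξ (EuclideanSpace.single p' 1) k * Ξ (EuclideanSpace.single q' 1) k') * this
  obtain ⟨p, q, i, j, hij, hne, hmax⟩ := max_minor hmin2
  refine ⟨l, i, j, hij, hz, ?_⟩
  set D := m p i * m q j - m p j * m q i with hD
  have hD0 : 0 < |D| := abs_pos.2 hne
  set μ := ∑ q, ∑ k, |m q k| with hμ
  have hμ0 : 0 ≤ μ := Finset.sum_nonneg fun _ _ => Finset.sum_nonneg fun _ _ => abs_nonneg _
  have hμb : ∀ q k, |m q k| ≤ μ := fun q k =>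
    (Finset.single_le_sum (f := fun k => |m q k|) (fun _ _ => abs_nonneg _) (Finset.mem_univ k)).trans
      (Finset.single_le_sum (f := fun q => ∑ k, |m q k|) (fun _ _ => Finset.sum_nonneg fun _ _ => abs_nonneg _) (Finset.mem_univ q))
  set Cs := ‖(Ξ.symm : (Fin d → ℝ) →L[ℝ] EuclideanSpace ℝ (Fin d))‖ with hCs
  have hCs0 : 0 ≤ Cs := norm_nonneg _
  have hzC : ∀ z, ‖z‖ ≤ Cs * ‖Ξ z‖ := by
    intro z
    have := (Ξ.symm : (Fin d → ℝ) →L[ℝ] EuclideanSpace ℝ (Fin d)).le_opNorm (Ξ z)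
    simpa using this
  set ε := |D| / (4 * (μ + 1) * (Cs + 1)) with hε
  have hε0 : 0 < ε := by positivity
  have hstr : ∀ r : Fin d, ∀ᶠ y : EuclideanSpace ℝ (Fin d) × EuclideanSpace ℝ (Fin d) in nhds (x, x),
      ‖reG (Gl U (r :: l)) y.1 - reG (Gl U (r :: l)) y.2 - fderiv ℝ (reG (Gl U (r :: l))) x (y.1 - y.2)‖ ≤ ε * ‖y.1 - y.2‖ := by
    intro r
    have hc : ContDiffAt ℝ 1 (reG (Gl U (r :: l))) x :=
      (reG_contDiffOn hΩ (Gl_diff hΩ hS.diff _)).contDiffAt ((hΩ.preimage io_cont).mem_nhds hx)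
    have := (hc.hasStrictFDerivAt (by norm_num)).isLittleO.def hε0
    exact this
  have hall := eventually_all.2 hstr
  rw [nhds_prod_eq] at hall
  obtain ⟨V, hV, hVall'⟩ := Filter.mem_prod_self_iff.1 hall
  have hVall : ∀ x' ∈ V, ∀ x'' ∈ V, ∀ r, ‖reG (Gl U (r :: l)) x' - reG (Gl U (r :: l)) x'' - fderiv ℝ (reG (Gl U (r :: l))) x (x' - x'')‖ ≤ ε * ‖x' - x''‖ :=
    fun x' hx' x'' hx'' => hVall' (Set.mk_mem_prod hx' hx'')
  refine ⟨V, hV, fun x' hx' x'' hx'' hz' hz'' => ?_⟩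
  refine pivot hij hne hmax hμb (δ := ε * ‖x' - x''‖) (fun r => ?_) ?_
  · have h2 := hVall x' hx' x'' hx'' r
    simp only [hz' r, hz'' r, sub_self, zero_sub, norm_neg, Real.norm_eq_abs] at h2
    convert h2 using 2
    rw [fderiv_expand]
    have h3 : ∀ p, pd p (reG (Gl U (r :: l))) x = H r p := fun p => reG_pd hΩ (Gl_diff hΩ hS.diff _) hx p
    simp only [h3, hm, Finset.mul_sum]
    rw [Finset.sum_comm]
    refine Finset.sum_congr rfl fun p _ => ?_
    rw [hexp (x' - x'') p, Finset.sum_mul]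
    exact Finset.sum_congr rfl fun k _ => by ring
  · have h2 := hzC (x' - x'')
    have h3 : 2 * μ * (ε * ‖x' - x''‖) ≤ 2 * (μ + 1) * (ε * ((Cs + 1) * ‖Ξ (x' - x'')‖)) := by
      have : ‖x' - x''‖ ≤ (Cs + 1) * ‖Ξ (x' - x'')‖ := by nlinarith [norm_nonneg (Ξ (x' - x''))]
      gcongr
      linarith
    refine h3.trans (le_of_eq ?_)
    have hc1 : Cs + 1 ≠ 0 := by positivity
    have hm1 : μ + 1 ≠ 0 := by positivity
    rw [hε]; field_simp; ring

end PIECE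
end SSM

namespace SSM

section AREA
variable {d : ℕ}
open Filter

lemma area {J : Type} [Fintype J] {π : EuclideanSpace ℝ (Fin d) → (J → ℝ)} (hπ : Continuous π) {S : Set (EuclideanSpace ℝ (Fin d))} (hS : MeasurableSet S)
    {X : ℕ → Set (EuclideanSpace ℝ (Fin d))} (hX : ∀ m, MeasurableSet (X m)) (hcov : S ⊆ ⋃ m, X m) {C : ℝ≥0}
    (hC : ∀ m, ∀ x ∈ S ∩ X m, ∀ x' ∈ S ∩ X m, dist x x' ≤ C * dist (π x) (π x')) {K : ℕ}
    (hK : ∀ (Z : Finset (EuclideanSpace ℝ (Fin d))) (y : J → ℝ), (∀ z ∈ Z, z ∈ S ∧ π z = y) → Z.card ≤ K)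
    {Y : Set (J → ℝ)} (hY : MeasurableSet Y) (hSY : ∀ x ∈ S, π x ∈ Y) :
    μH[(Fintype.card J : ℝ)] S ≤ (C : ℝ≥0∞) ^ (Fintype.card J : ℝ) * (K * volume Y) := by
  classical
  set T : ℕ → Set (EuclideanSpace ℝ (Fin d)) := fun m => S ∩ disjointed X m with hT
  have hTm : ∀ m, MeasurableSet (T m) := fun m => hS.inter (MeasurableSet.disjointed hX m)
  have hTX : ∀ m, T m ⊆ S ∩ X m := fun m => inter_subset_inter_right _ (disjointed_subset X m)
  have hTd : ∀ m m' x, x ∈ T m → x ∈ T m' → m = m' := by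
    intro m m' x h1 h2
    by_contra hne
    exact (Set.disjoint_left.1 (disjoint_disjointed X hne)) h1.2 h2.2
  have hcov2 : S ⊆ ⋃ m, T m := by
    intro x hx
    have := hcov hx
    rw [← iUnion_disjointed] at this
    obtain ⟨m, hm⟩ := mem_iUnion.1 this
    exact mem_iUnion.2 ⟨m, hx, hm⟩
  have hinj : ∀ m, InjOn π (T m) := by
    intro m x hx x' hx' h
    have := hC m x (hTX m hx) x' (hTX m hx')
    rw [h, dist_self, mul_zero] at this
    exact dist_le_zero.1 this
  have hpm : ∀ m, MeasurableSet (π '' T m) := fun m => (hTm m).image_of_continuousOn_injOn hπ.continuousOn (hinj m)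
  have hpiece : ∀ m, μH[(Fintype.card J : ℝ)] (T m) ≤ (C : ℝ≥0∞) ^ (Fintype.card J : ℝ) * volume (π '' T m) := by
    intro m
    by_cases hne : (T m).Nonempty
    swap
    · rw [not_nonempty_iff_eq_empty.1 hne]; simp
    haveI : Nonempty (EuclideanSpace ℝ (Fin d)) := ⟨0⟩
    set g := Function.invFunOn π (T m) with hg
    have hgl : ∀ x ∈ T m, g (π x) = x := fun x hx => (hinj m).leftInvOn_invFunOn hx
    have hL : LipschitzOnWith C g (π '' T m) := by
      apply LipschitzOnWith.of_dist_le_mul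
      rintro _ ⟨x, hx, rfl⟩ _ ⟨x', hx', rfl⟩
      rw [hgl x hx, hgl x' hx']
      exact hC m x (hTX m hx) x' (hTX m hx')
    have h1 := hL.hausdorffMeasure_image_le (d := (Fintype.card J : ℝ)) (by positivity)
    have h2 : g '' (π '' T m) = T m := by
      ext x
      constructor
      · rintro ⟨_, ⟨x', hx', rfl⟩, rfl⟩
        rw [hgl x' hx']; exact hx'
      · intro hx
        exact ⟨π x, ⟨x, hx, rfl⟩, hgl x hx⟩
    rw [h2, hausdorffMeasure_pi_real] at h1
    exact h1
  have hcount : ∀ y, ∑' m, (π '' T m).indicator (fun _ => (1 : ℝ≥0∞)) y ≤ Y.indicator (fun _ => (K : ℝ≥0∞)) y := by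
    intro y
    by_cases hy : y ∈ Y
    swap
    · rw [indicator_of_notMem hy]
      have : ∀ m, (π '' T m).indicator (fun _ => (1 : ℝ≥0∞)) y = 0 := by
        intro m
        refine indicator_of_notMem ?_ _
        rintro ⟨x, hx, rfl⟩
        exact hy (hSY x hx.1)
      simp [this]
    rw [indicator_of_mem hy, ENNReal.tsum_eq_iSup_sum]
    refine iSup_le fun F => ?_
    have h1 : ∑ m ∈ F, (π '' T m).indicator (fun _ => (1 : ℝ≥0∞)) y = ((F.filter fun m => y ∈ π '' T m).card : ℝ≥0∞) := by
      simp only [indicator_apply]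
      rw [← Finset.sum_filter, Finset.sum_const, nsmul_eq_mul, mul_one]
    rw [h1]
    norm_cast
    have hch : ∀ m, ∃ x, y ∈ π '' T m → x ∈ T m ∧ π x = y := by
      intro m
      by_cases h : y ∈ π '' T m
      · obtain ⟨x, hx⟩ := h; exact ⟨x, fun _ => hx⟩
      · exact ⟨0, fun h' => absurd h' h⟩
    choose f hf using hch
    have h2 := hK ((F.filter fun m => y ∈ π '' T m).image f) y (by
      intro z hz
      obtain ⟨m, hm, rfl⟩ := Finset.mem_image.1 hz
      have := hf m (Finset.mem_filter.1 hm).2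
      exact ⟨this.1.1, this.2⟩)
    rwa [Finset.card_image_of_injOn] at h2
    intro m hm m' hm' h
    have e1 := hf m (Finset.mem_filter.1 (Finset.mem_coe.1 hm)).2
    have e2 := hf m' (Finset.mem_filter.1 (Finset.mem_coe.1 hm')).2
    rw [← h] at e2
    exact hTd m m' _ e1.1 e2.1
  calc μH[(Fintype.card J : ℝ)] S ≤ μH[(Fintype.card J : ℝ)] (⋃ m, T m) := measure_mono hcov2
    _ ≤ ∑' m, μH[(Fintype.card J : ℝ)] (T m) := measure_iUnion_le _
    _ ≤ ∑' m, (C : ℝ≥0∞) ^ (Fintype.card J : ℝ) * volume (π '' T m) := ENNReal.tsum_le_tsum hpiece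
    _ = (C : ℝ≥0∞) ^ (Fintype.card J : ℝ) * ∑' m, volume (π '' T m) := ENNReal.tsum_mul_left
    _ ≤ (C : ℝ≥0∞) ^ (Fintype.card J : ℝ) * (K * volume Y) := by
        gcongr
        calc ∑' m, volume (π '' T m) = ∑' m, ∫⁻ y, (π '' T m).indicator (fun _ => (1 : ℝ≥0∞)) y := by
              refine tsum_congr fun m => ?_
              rw [lintegral_indicator_const (hpm m), one_mul]
          _ = ∫⁻ y, ∑' m, (π '' T m).indicator (fun _ => (1 : ℝ≥0∞)) y := by
              rw [lintegral_tsum]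
              exact fun m => (measurable_const.indicator (hpm m)).aemeasurable
          _ ≤ ∫⁻ y, Y.indicator (fun _ => (K : ℝ≥0∞)) y := lintegral_mono hcount
          _ = K * volume Y := lintegral_indicator_const hY _

end AREA
end SSM

namespace SSM

section LOCAL
variable {d : ℕ} {lam M : ℝ}
open Filter

lemma meas_zero {W : Set (EuclideanSpace ℝ (Fin d))} (hW : IsOpen W) {Y : Type*} [TopologicalSpace Y] [T1Space Y] [Zero Y] {g : EuclideanSpace ℝ (Fin d) → Y}
    (hg : ContinuousOn g W) : MeasurableSet {x | x ∈ W ∧ g x = 0} := by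
  have h1 : IsOpen (W ∩ g ⁻¹' {0}ᶜ) := hg.isOpen_inter_preimage hW isOpen_compl_singleton
  have : {x | x ∈ W ∧ g x = 0} = W \ (W ∩ g ⁻¹' {0}ᶜ) := by
    ext x
    simp only [Set.mem_sdiff, mem_inter_iff, mem_preimage, mem_compl_iff, mem_singleton_iff, mem_ofPred_eq]
    tauto
  rw [this]
  exact hW.measurableSet.diff h1.measurableSet

lemma meas_zero' {W : Set (EuclideanSpace ℝ (Fin d))} (hW : IsOpen W) {Y : Type*} [TopologicalSpace Y] [T1Space Y] [Zero Y] {g : Fin d → EuclideanSpace ℝ (Fin d) → Y}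
    (hg : ∀ q, ContinuousOn (g q) W) : MeasurableSet {x | x ∈ W ∧ ∀ q, g q x = 0} := by
  have : {x | x ∈ W ∧ ∀ q, g q x = 0} = W ∩ ⋂ q, {x | x ∈ W ∧ g q x = 0} := by
    ext x
    simp only [mem_inter_iff, mem_iInter, mem_ofPred_eq]
    exact ⟨fun h => ⟨h.1, fun q => ⟨h.1, h.2 q⟩⟩, fun h => ⟨h.1, fun q => (h.2 q).2⟩⟩
  rw [this]
  exact hW.measurableSet.inter (MeasurableSet.iInter fun q => meas_zero hW (hg q))

def Sg (U : (Fin d → ℂ) → ℂ) (W : Set (EuclideanSpace ℝ (Fin d))) : Set (EuclideanSpace ℝ (Fin d)) :=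
  {x | x ∈ W ∧ U (io x) = 0 ∧ ∀ i, Gl U [i] (io x) = 0}

lemma card_J {i j : Fin d} (h : i < j) : Fintype.card {k : Fin d // k ≠ i ∧ k ≠ j} = d - 2 := by
  classical
  rw [Fintype.card_subtype]
  have : (Finset.univ.filter fun k : Fin d => k ≠ i ∧ k ≠ j) = ({i, j} : Finset (Fin d))ᶜ := by
    ext k; simp
  rw [this, Finset.card_compl, Finset.card_pair h.ne, Fintype.card_fin]

def cLoc (Ξ : EuclideanSpace ℝ (Fin d) ≃L[ℝ] (Fin d → ℝ)) (K : ℕ) : ℝ :=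
  (‖(Ξ.symm : (Fin d → ℝ) →L[ℝ] EuclideanSpace ℝ (Fin d))‖ * (2 * d)) ^ (d - 2) * (K * (2 * ‖(Ξ : EuclideanSpace ℝ (Fin d) →L[ℝ] (Fin d → ℝ))‖) ^ (d - 2))

lemma pair_bound (hd : 2 ≤ d) {A : Matrix (Fin d) (Fin d) ℝ} {U} (hS : Sol d lam M A U) {W : Set (EuclideanSpace ℝ (Fin d))}
    (hW : IsOpen W) (hWO : ∀ x ∈ W, io x ∈ Om d (eta d lam)) (Ξ : EuclideanSpace ℝ (Fin d) ≃L[ℝ] (Fin d → ℝ)) {K : ℕ} {i j : Fin d} (hij : i < j)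
    (hK : ∀ Z : Finset (EuclideanSpace ℝ (Fin d)), (∀ z ∈ Z, z ∈ Sg U W) →
      (∀ z ∈ Z, ∀ z' ∈ Z, ∀ k, k ≠ i → k ≠ j → Ξ z k = Ξ z' k) → Z.card ≤ K)
    {r : ℝ} (hr : 0 < r) (hWr : W ⊆ ball 0 r) :
    ∃ T : Set (EuclideanSpace ℝ (Fin d)), μH[(d : ℝ) - 2] T ≤ ENNReal.ofReal (cLoc Ξ K * r ^ (d - 2)) ∧
      ∀ x ∈ Sg U W, ∀ l, (∀ q, reG (Gl U (q :: l)) x = 0) → ∀ V ∈ nhds x, (∀ x' ∈ V, ∀ x'' ∈ V,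
      (∀ q, reG (Gl U (q :: l)) x' = 0) → (∀ q, reG (Gl U (q :: l)) x'' = 0) →
      ‖Ξ (x' - x'')‖ ≤ 2 * d * ‖fun k : {k // k ≠ i ∧ k ≠ j} => Ξ (x' - x'') k.1‖) → x ∈ T := by
  classical
  have hΩ := Om_open (d := d) (eta d lam)
  have hcont : ∀ l, ContinuousOn (fun x => Gl U l (io x)) W := fun l =>
    ((Gl_diff hΩ hS.diff l).continuousOn).comp io_cont.continuousOn hWO
  have hcontr : ∀ l, ContinuousOn (reG (Gl U l)) W := fun l => Complex.continuous_re.comp_continuousOn (hcont l)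
  have hSm : MeasurableSet (Sg U W) := by
    have : Sg U W = {x | x ∈ W ∧ U (io x) = 0} ∩ {x | x ∈ W ∧ ∀ q, Gl U [q] (io x) = 0} := by
      ext x; simp only [Sg, mem_inter_iff, mem_ofPred_eq]; tauto
    rw [this]
    exact (meas_zero hW (hcont [])).inter (meas_zero' hW fun q => hcont [q])
  set E : List (Fin d) → Set (EuclideanSpace ℝ (Fin d)) := fun l => {x | x ∈ W ∧ ∀ q, reG (Gl U (q :: l)) x = 0} with hE
  have hEm : ∀ l, MeasurableSet (E l) := fun l => meas_zero' hW fun q => hcontr (q :: l)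
  set good : List (Fin d) → Set (Set (EuclideanSpace ℝ (Fin d))) := fun l => {V | IsOpen V ∧ ∀ x' ∈ V, ∀ x'' ∈ V,
      (∀ q, reG (Gl U (q :: l)) x' = 0) → (∀ q, reG (Gl U (q :: l)) x'' = 0) →
      ‖Ξ (x' - x'')‖ ≤ 2 * d * ‖fun k : {k // k ≠ i ∧ k ≠ j} => Ξ (x' - x'') k.1‖} with hgood
  have hlin : ∀ l, ∃ T : Set (Set (EuclideanSpace ℝ (Fin d))), T.Countable ∧ T ⊆ good l ∧ ⋃₀ T = ⋃₀ (good l) := fun l =>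
    TopologicalSpace.isOpen_sUnion_countable (good l) fun V hV => hV.1
  choose T hTc hTg hTu using hlin
  set XX : Set (Set (EuclideanSpace ℝ (Fin d))) := insert ∅ (⋃ l, (fun V => E l ∩ V) '' T l) with hXX
  have hXXc : XX.Countable := (countable_iUnion fun l => (hTc l).image _).insert _
  obtain ⟨X, hX⟩ := hXXc.exists_eq_range (insert_nonempty _ _)
  have hXp : ∀ m, X m = ∅ ∨ ∃ l, ∃ V ∈ good l, X m = E l ∩ V := by
    intro m
    have : X m ∈ XX := hX ▸ mem_range_self m
    rcases this with h | h
    · exact Or.inl h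
    · right
      obtain ⟨l, V, hV, h⟩ := mem_iUnion.1 h
      exact ⟨l, V, hTg l hV, h.symm⟩
  have hXm : ∀ m, MeasurableSet (X m) := by
    intro m
    rcases hXp m with h | ⟨l, V, hV, h⟩
    · rw [h]; exact MeasurableSet.empty
    · rw [h]; exact (hEm l).inter hV.1.measurableSet
  set π : EuclideanSpace ℝ (Fin d) → ({k : Fin d // k ≠ i ∧ k ≠ j} → ℝ) := fun x k => Ξ x k.1 with hπ
  have hπc : Continuous π := continuous_pi fun k => (continuous_apply k.1).comp Ξ.continuous
  set Cs := ‖(Ξ.symm : (Fin d → ℝ) →L[ℝ] EuclideanSpace ℝ (Fin d))‖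
  set Cx := ‖(Ξ : EuclideanSpace ℝ (Fin d) →L[ℝ] (Fin d → ℝ))‖
  have hcJ := card_J hij
  have hcR : ((Fintype.card {k : Fin d // k ≠ i ∧ k ≠ j} : ℕ) : ℝ) = (d : ℝ) - 2 := by
    rw [hcJ, Nat.cast_sub hd]; norm_num
  have hC0 : 0 ≤ Cs * (2 * d) := by positivity
  have key := area (J := {k : Fin d // k ≠ i ∧ k ≠ j}) hπc (S := Sg U W ∩ ⋃ m, X m) (hSm.inter (MeasurableSet.iUnion hXm)) hXm inter_subset_right
    (C := Real.toNNReal (Cs * (2 * d))) (K := K) (Y := closedBall 0 (Cx * r)) ?_ ?_ isClosed_closedBall.measurableSet ?_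
  · refine ⟨Sg U W ∩ ⋃ m, X m, ?_, ?_⟩
    · rw [← hcR]
      refine key.trans (le_of_eq ?_)
      rw [ENNReal.rpow_natCast, Real.volume_pi_closedBall _ (by positivity), hcJ]
      have e1 : ((Real.toNNReal (Cs * (2 * d)) : ℝ≥0) : ℝ≥0∞) = ENNReal.ofReal (Cs * (2 * d)) := rfl
      rw [e1, ← ENNReal.ofReal_pow hC0, ← ENNReal.ofReal_natCast, ← ENNReal.ofReal_mul (by positivity), ← ENNReal.ofReal_mul (by positivity)]
      congr 1
      unfold cLoc
      rw [← mul_assoc 2 Cx r, mul_pow (2 * Cx) r]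
      ring
    · intro x hx l hxl V hV hVg
      refine ⟨hx, ?_⟩
      have hx2 : x ∈ ⋃₀ T l := by
        rw [hTu l]
        exact ⟨interior V, ⟨isOpen_interior, fun x' h' x'' h'' => hVg x' (interior_subset h') x'' (interior_subset h'')⟩, mem_interior_iff_mem_nhds.2 hV⟩
      obtain ⟨V', hV', hxV⟩ := hx2
      have : E l ∩ V' ∈ XX := Or.inr (mem_iUnion.2 ⟨l, V', hV', rfl⟩)
      rw [hX] at this
      obtain ⟨m, hm⟩ := this
      refine mem_iUnion.2 ⟨m, ?_⟩
      rw [hm]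
      exact ⟨⟨hx.1, hxl⟩, hxV⟩
  · intro m x hx x' hx'
    rcases hXp m with h | ⟨l, V, hV, h⟩
    · rw [h] at hx; exact hx.2.elim
    · rw [h] at hx hx'
      have h1 := hV.2 x hx.2.2 x' hx'.2.2 hx.2.1.2 hx'.2.1.2
      have h2 : (fun k : {k : Fin d // k ≠ i ∧ k ≠ j} => Ξ (x - x') k.1) = π x - π x' := by
        ext k; simp [hπ]
      rw [h2, ← dist_eq_norm] at h1
      have h3 : x - x' = Ξ.symm (Ξ (x - x')) := by simp
      rw [dist_eq_norm, h3]
      calc _ ≤ Cs * ‖Ξ (x - x')‖ := (Ξ.symm : (Fin d → ℝ) →L[ℝ] EuclideanSpace ℝ (Fin d)).le_opNorm _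
        _ ≤ Cs * (2 * d * dist (π x) (π x')) := by gcongr
        _ = _ := by rw [Real.coe_toNNReal _ hC0]; ring
  · intro Z y hZ
    refine hK Z (fun z hz => (hZ z hz).1.1) ?_
    intro z hz z' hz' k hki hkj
    have := congrFun ((hZ z hz).2.trans (hZ z' hz').2.symm) ⟨k, hki, hkj⟩
    exact this
  · intro x hx
    have hxr : ‖x‖ < r := by simpa using hWr hx.1.1
    rw [mem_closedBall_zero_iff]
    refine (pi_norm_le_iff_of_nonneg (by positivity)).2 fun k => ?_
    calc _ ≤ ‖Ξ x‖ := norm_le_pi_norm (Ξ x) k.1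
      _ ≤ Cx * ‖x‖ := (Ξ : EuclideanSpace ℝ (Fin d) →L[ℝ] (Fin d → ℝ)).le_opNorm _
      _ ≤ _ := by gcongr

theorem local_bound (hd : 2 ≤ d) (hl : 0 < lam) {A : Matrix (Fin d) (Fin d) ℝ} {U} (hS : Sol d lam M A U) {W : Set (EuclideanSpace ℝ (Fin d))}
    (hW : IsOpen W) (hWO : ∀ x ∈ W, io x ∈ Om d (eta d lam)) (hnf : ∀ x ∈ W, ∃ l, Gl U l (io x) ≠ 0) (Ξ : EuclideanSpace ℝ (Fin d) ≃L[ℝ] (Fin d → ℝ)) {K : ℕ}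
    (hK : ∀ i j : Fin d, i < j → ∀ Z : Finset (EuclideanSpace ℝ (Fin d)), (∀ z ∈ Z, z ∈ Sg U W) →
      (∀ z ∈ Z, ∀ z' ∈ Z, ∀ k, k ≠ i → k ≠ j → Ξ z k = Ξ z' k) → Z.card ≤ K)
    {r : ℝ} (hr : 0 < r) (hWr : W ⊆ ball 0 r) :
    μH[(d : ℝ) - 2] (Sg U W) ≤ ENNReal.ofReal (d * d * cLoc Ξ K * r ^ (d - 2)) := by
  classical
  have h1 : ∀ p : Fin d × Fin d, ∃ T : Set (EuclideanSpace ℝ (Fin d)), μH[(d : ℝ) - 2] T ≤ ENNReal.ofReal (cLoc Ξ K * r ^ (d - 2)) ∧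
      (p.1 < p.2 → ∀ x ∈ Sg U W, ∀ l, (∀ q, reG (Gl U (q :: l)) x = 0) → ∀ V ∈ nhds x, (∀ x' ∈ V, ∀ x'' ∈ V,
      (∀ q, reG (Gl U (q :: l)) x' = 0) → (∀ q, reG (Gl U (q :: l)) x'' = 0) →
      ‖Ξ (x' - x'')‖ ≤ 2 * d * ‖fun k : {k // k ≠ p.1 ∧ k ≠ p.2} => Ξ (x' - x'') k.1‖) → x ∈ T) := by
    intro p
    by_cases h : p.1 < p.2
    · obtain ⟨T, hT1, hT2⟩ := pair_bound hd hS hW hWO Ξ h (hK p.1 p.2 h) hr hWr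
      exact ⟨T, hT1, fun _ => hT2⟩
    · exact ⟨∅, by simp, fun h' => absurd h' h⟩
  choose T hT1 hT2 using h1
  have hsub : Sg U W ⊆ ⋃ p, T p := by
    intro x hx
    obtain ⟨l, i, j, hij, hl1, V, hV, hVg⟩ := piece hl hS (hWO x hx.1) hx.2.1 hx.2.2 (hnf x hx.1) Ξ
    exact mem_iUnion.2 ⟨(i, j), hT2 (i, j) hij x hx l hl1 V hV hVg⟩
  calc _ ≤ μH[(d : ℝ) - 2] (⋃ p, T p) := measure_mono hsub
    _ ≤ ∑ p : Fin d × Fin d, μH[(d : ℝ) - 2] (T p) := measure_iUnion_fintype_le _ _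
    _ ≤ ∑ p : Fin d × Fin d, ENNReal.ofReal (cLoc Ξ K * r ^ (d - 2)) := Finset.sum_le_sum fun p _ => hT1 p
    _ = _ := by
      rw [Finset.sum_const, Finset.card_univ, Fintype.card_prod, Fintype.card_fin, nsmul_eq_mul, ← ENNReal.ofReal_natCast, ← ENNReal.ofReal_mul (by positivity)]
      congr 1
      push_cast; ring

end LOCAL
end SSM

namespace SSM

section FIBRE
variable {d : ℕ} {lam M : ℝ}
open Filter MvPolynomial

def cv (b : Fin d → ℝ) : Fin d → ℂ := fun k => (b k : ℂ)

lemma norm_cv (b : Fin d → ℝ) : ‖cv b‖ ≤ ‖b‖ := by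
  refine (pi_norm_le_iff_of_nonneg (norm_nonneg _)).2 fun k => ?_
  rw [cv, Complex.norm_real]
  exact norm_le_pi_norm b k

lemma xi_exists {b : Fin d → (Fin d → ℝ)} (hb : LinearIndependent ℝ b) :
    ∃ Ξ : EuclideanSpace ℝ (Fin d) ≃L[ℝ] (Fin d → ℝ), ∀ x k, x k = ∑ i, Ξ x i * b i k := by
  classical
  let Bs := basisOfPiSpaceOfLinearIndependent hb
  refine ⟨(EuclideanSpace.equiv (Fin d) ℝ).trans Bs.equivFunL, ?_⟩
  intro x k
  have h := Bs.sum_equivFun (EuclideanSpace.equiv (Fin d) ℝ x)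
  have h2 := congrFun h k
  have h3 : ∀ i, Bs i = b i := fun i => by simp [Bs]
  simp only [Finset.sum_apply, Pi.smul_apply, smul_eq_mul, h3] at h2
  exact h2.symm

lemma unif_cont (P : MvPolynomial (Fin d) ℝ) (R : ℝ) {ε : ℝ} (hε : 0 < ε) : ∃ δ, 0 < δ ∧ ∀ z z' : Fin d → ℂ, ‖z‖ ≤ R → ‖z'‖ ≤ R → ‖z - z'‖ ≤ δ →
    ‖aeval z P - aeval z' P‖ ≤ ε := by
  have hc : Continuous fun z : Fin d → ℂ => aeval z P := by
    have : (fun z : Fin d → ℂ => aeval z P) = fun z : Fin d → ℂ => eval z (map (algebraMap ℝ ℂ) P) := by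
      ext z; rw [eval_map, aeval_def]
    rw [this]
    exact MvPolynomial.continuous_eval _
  have hu := (isCompact_closedBall (0 : Fin d → ℂ) R).uniformContinuousOn_of_continuous hc.continuousOn
  obtain ⟨δ, hδ, h⟩ := Metric.uniformContinuousOn_iff.1 hu ε hε
  refine ⟨δ / 2, by positivity, fun z z' hz hz' hd => ?_⟩
  have := h z (by simpa using hz) z' (by simpa using hz') (by rw [dist_eq_norm]; linarith)
  rw [dist_eq_norm] at this
  exact this.le

lemma fibre {m : ℕ} {P : MvPolynomial (Fin d) ℝ} (hP : P.IsHomogeneous m) {b : Fin d → (Fin d → ℝ)}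
    (Ξ : EuclideanSpace ℝ (Fin d) ≃L[ℝ] (Fin d → ℝ)) (hΞ : ∀ x k, x k = ∑ i, Ξ x i * b i k) {i j : Fin d} (hij : i < j)
    (hi : eval (b i) P ≠ 0) (hs : (pl P (b j) (b i)).Separable) {R : ℝ} (hR : 4 * ∑ k, ‖b k‖ + 1 ≤ R) :
    ∃ ε, 0 < ε ∧ ∃ δ, 0 < δ ∧ ∃ K : ℕ, ∀ (U : (Fin d → ℂ) → ℂ) (Ω : Set (Fin d → ℂ)) (x0 : EuclideanSpace ℝ (Fin d)) (ρ : ℝ), 0 < ρ → IsOpen Ω → DifferentiableOn ℂ U Ω →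
      (∀ z, ‖z‖ ≤ R → io x0 + (ρ : ℂ) • z ∈ Ω) →
      (∀ z, ‖z‖ ≤ R → ‖((ρ : ℂ) ^ m)⁻¹ * U (io x0 + (ρ : ℂ) • z) - aeval z P‖ ≤ ε) →
      ∀ Z : Finset (EuclideanSpace ℝ (Fin d)), (∀ z ∈ Z, z ∈ Sg U (ball x0 (ρ * δ))) →
      (∀ z ∈ Z, ∀ z' ∈ Z, ∀ k, k ≠ i → k ≠ j → Ξ z k = Ξ z' k) → Z.card ≤ K := by
  classical
  obtain ⟨κ, hκ0, hκ1, a, ha, ha2, hfac⟩ := line_roots hP (b j) (b i) hi hs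
  obtain ⟨ε0, hε0, K, hK⟩ := two_var_count a ha ha2 (((eval (b i) P : ℝ)) : ℂ) (by exact_mod_cast hi)
  set β := ∑ k, ‖b k‖ with hβ
  have hβ0 : 0 ≤ β := Finset.sum_nonneg fun k _ => norm_nonneg _
  have hbβ : ∀ k, ‖cv (b k)‖ ≤ β := fun k => (norm_cv _).trans (Finset.single_le_sum (f := fun k => ‖b k‖) (fun k _ => norm_nonneg _) (Finset.mem_univ k))
  obtain ⟨δ', hδ', huc⟩ := unif_cont P R (show 0 < ε0 / 2 by positivity)
  set Cx := ‖(Ξ : EuclideanSpace ℝ (Fin d) →L[ℝ] (Fin d → ℝ))‖ with hCx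
  have hCx0 : 0 ≤ Cx := norm_nonneg _
  set τ := min (κ / 8) (min δ' 1 / (β + 1)) with hτ
  have hτ0 : 0 < τ := by
    have : 0 < min δ' 1 := lt_min hδ' one_pos
    exact lt_min (by positivity) (by positivity)
  have hτβ : τ * β ≤ min δ' 1 := by
    have h1 : τ ≤ min δ' 1 / (β + 1) := min_le_right _ _
    rw [le_div_iff₀ (by positivity)] at h1
    nlinarith
  have hτκ : τ ≤ κ / 8 := min_le_left _ _
  refine ⟨ε0 / 2, by positivity, τ / (Cx + 1), by positivity, K, ?_⟩
  intro U Ω x0 ρ hρ hΩ hU hin happ Z hZ hZeq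
  rcases Z.eq_empty_or_nonempty with rfl | ⟨z1, hz1⟩
  · simp
  have hξ : ∀ z ∈ Z, ∀ k, ‖ρ⁻¹ * Ξ (z - x0) k‖ ≤ τ := by
    intro z hz k
    have h1 : ‖z - x0‖ ≤ ρ * (τ / (Cx + 1)) := by
      have := (hZ z hz).1
      rw [mem_ball_iff_norm] at this
      exact this.le
    rw [norm_mul, norm_inv, Real.norm_of_nonneg hρ.le]
    have h2 : ‖Ξ (z - x0) k‖ ≤ Cx * ‖z - x0‖ := (norm_le_pi_norm (Ξ (z - x0)) k).trans ((Ξ : EuclideanSpace ℝ (Fin d) →L[ℝ] (Fin d → ℝ)).le_opNorm _)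
    rw [inv_mul_le_iff₀ hρ]
    calc _ ≤ Cx * (ρ * (τ / (Cx + 1))) := h2.trans (by gcongr)
      _ = ρ * τ * (Cx / (Cx + 1)) := by ring
      _ ≤ ρ * τ * 1 := by
        gcongr
        rw [div_le_one (by positivity)]; linarith
      _ = _ := by ring
  set y' : Fin d → ℂ := ∑ k ∈ Finset.univ.filter (fun k => k ≠ i ∧ k ≠ j), ((ρ⁻¹ * Ξ (z1 - x0) k : ℝ) : ℂ) • cv (b k) with hy'
  have hy'n : ‖y'‖ ≤ min δ' 1 := by
    calc ‖y'‖ ≤ ∑ k ∈ Finset.univ.filter (fun k => k ≠ i ∧ k ≠ j), τ * ‖b k‖ := by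
          refine (norm_sum_le _ _).trans (Finset.sum_le_sum fun k _ => ?_)
          rw [norm_smul, Complex.norm_real]
          exact mul_le_mul (hξ z1 hz1 k) (norm_cv _) (norm_nonneg _) hτ0.le
      _ ≤ ∑ k, τ * ‖b k‖ := Finset.sum_le_sum_of_subset_of_nonneg (Finset.filter_subset _ _) fun k _ _ => by positivity
      _ = τ * β := by rw [← Finset.mul_sum]
      _ ≤ _ := hτβ
  -- the slice
  set w : ℂ × ℂ → (Fin d → ℂ) := fun p => ((κ : ℂ) * p.1) • cv (b j) + p.2 • cv (b i) with hw
  have hwn : ∀ p ∈ ball (0 : ℂ × ℂ) 2, ‖w p‖ ≤ 4 * β := by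
    intro p hp
    rw [mem_ball_zero_iff] at hp
    have h1 : ‖p.1‖ ≤ 2 := (norm_fst_le p).trans hp.le
    have h2 : ‖p.2‖ ≤ 2 := (norm_snd_le p).trans hp.le
    calc ‖w p‖ ≤ ‖((κ : ℂ) * p.1) • cv (b j)‖ + ‖p.2 • cv (b i)‖ := norm_add_le _ _
      _ = κ * ‖p.1‖ * ‖cv (b j)‖ + ‖p.2‖ * ‖cv (b i)‖ := by
        rw [norm_smul, norm_smul, norm_mul, Complex.norm_real, Real.norm_of_nonneg hκ0.le]
      _ ≤ 1 * 2 * β + 2 * β := by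
        gcongr <;> exact hbβ _
      _ = _ := by ring
  have hyw : ∀ p ∈ ball (0 : ℂ × ℂ) 2, ‖y' + w p‖ ≤ R := by
    intro p hp
    have := norm_add_le y' (w p)
    have := hwn p hp
    have := hy'n.trans (min_le_right _ _)
    linarith
  set F : ℂ × ℂ → ℂ := fun p => ((ρ : ℂ) ^ m)⁻¹ * U (io x0 + (ρ : ℂ) • (y' + w p)) with hF
  have hFd : DifferentiableOn ℂ F (ball 0 2) := by
    refine DifferentiableOn.const_mul ?_ _
    refine hU.comp (t := Ω) ?_ fun p hp => hin _ (hyw p hp)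
    apply Differentiable.differentiableOn
    simp only [hw]
    fun_prop
  have hFa : ∀ p ∈ ball (0 : ℂ × ℂ) 2, ‖F p - ((eval (b i) P : ℝ) : ℂ) * ∏ r, (p.2 - a r * p.1)‖ ≤ ε0 := by
    intro p hp
    have h1 := happ _ (hyw p hp)
    have h2 := huc (y' + w p) (w p) (hyw p hp) ((hwn p hp).trans (by linarith)) (by simpa using hy'n.trans (min_le_left _ _))
    have h3 : aeval (w p) P = ((eval (b i) P : ℝ) : ℂ) * ∏ r, (p.2 - a r * p.1) := by
      rw [← hfac p.1 p.2]
      rfl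
    rw [← h3]
    calc _ = ‖(F p - aeval (y' + w p) P) + (aeval (y' + w p) P - aeval (w p) P)‖ := by congr 1; ring
      _ ≤ ε0 / 2 + ε0 / 2 := norm_add_le_of_le h1 h2
      _ = _ := by ring
  set g : EuclideanSpace ℝ (Fin d) → ℂ × ℂ := fun z => (((ρ⁻¹ * Ξ (z - x0) j / κ : ℝ) : ℂ), ((ρ⁻¹ * Ξ (z - x0) i : ℝ) : ℂ)) with hg
  have hexp : ∀ z ∈ Z, io x0 + (ρ : ℂ) • (y' + w (g z)) = io z := by
    intro z hz
    have e1 : y' = ∑ k ∈ Finset.univ.filter (fun k => k ≠ i ∧ k ≠ j), ((ρ⁻¹ * Ξ (z - x0) k : ℝ) : ℂ) • cv (b k) := by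
      refine Finset.sum_congr rfl fun k hk => ?_
      simp only [Finset.mem_filter, Finset.mem_univ, true_and] at hk
      rw [map_sub, map_sub, Pi.sub_apply, Pi.sub_apply, hZeq z1 hz1 z hz k hk.1 hk.2]
    have e2 : y' + w (g z) = ∑ k, ((ρ⁻¹ * Ξ (z - x0) k : ℝ) : ℂ) • cv (b k) := by
      rw [← Finset.sum_filter_add_sum_filter_not Finset.univ (fun k => k ≠ i ∧ k ≠ j), ← e1]
      congr 1
      have : (Finset.univ.filter fun k : Fin d => ¬ (k ≠ i ∧ k ≠ j)) = {j, i} := by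
        ext k; simp; tauto
      rw [this, Finset.sum_pair hij.ne']
      simp only [hw, hg]
      congr 2
      push_cast
      have : (κ : ℂ) ≠ 0 := by exact_mod_cast hκ0.ne'
      field_simp
    rw [e2]
    funext k
    have h3 := hΞ (z - x0) k
    have h4 : z k = x0 k + ∑ l, Ξ (z - x0) l * b l k := by
      rw [← h3]; simp
    have hρc : (ρ : ℂ) ≠ 0 := by exact_mod_cast hρ.ne'
    simp only [io, Pi.add_apply, Pi.smul_apply, Finset.sum_apply, smul_eq_mul, cv]
    rw [h4]
    push_cast
    rw [Finset.mul_sum]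
    congr 1
    refine Finset.sum_congr rfl fun l _ => ?_
    field_simp
  have hgn : ∀ z ∈ Z, ‖(g z).1‖ ≤ 1 / 8 ∧ ‖(g z).2‖ < 1 := by
    intro z hz
    have h1 := hξ z hz j
    have h2 := hξ z hz i
    simp only [hg]
    rw [Complex.norm_real, Complex.norm_real, norm_div, Real.norm_of_nonneg hκ0.le, div_le_iff₀ hκ0]
    exact ⟨by linarith, by linarith⟩
  have hinj : Set.InjOn g (Z : Set (EuclideanSpace ℝ (Fin d))) := by
    intro z hz z' hz' h
    have h1 := hexp z hz
    rw [h, hexp z' hz'] at h1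
    ext k
    have := congrFun h1 k
    simp only [io] at this
    exact_mod_cast this.symm
  rw [← Finset.card_image_of_injOn hinj]
  refine hK F hFd hFa _ ?_
  intro p hp
  obtain ⟨z, hz, rfl⟩ := Finset.mem_image.1 hp
  refine ⟨(hgn z hz).1, (hgn z hz).2, ?_, ?_⟩
  · simp only [hF]
    rw [hexp z hz, (hZ z hz).2.1, mul_zero]
  · have hmem : io z ∈ Ω := by
      rw [← hexp z hz]
      refine hin _ (hyw _ ?_)
      rw [mem_ball_zero_iff, Prod.norm_def]
      have := hgn z hz
      exact max_lt (by linarith) (by linarith)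
    set z0 := io x0 + (ρ : ℂ) • (y' + ((κ : ℂ) * (g z).1) • cv (b j)) with hz0
    set v : Fin d → ℂ := (ρ : ℂ) • cv (b i) with hv
    have e3 : ∀ t : ℂ, io x0 + (ρ : ℂ) • (y' + w ((g z).1, t)) = z0 + t • v := by
      intro t
      simp only [hw, hz0, hv, smul_add, smul_smul]
      rw [mul_comm t]
      abel
    have e4 : z0 + (g z).2 • v = io z := by rw [← e3, ← hexp z hz]
    have h5 := line_deriv hΩ hU (z0 := z0) (w := v) (ζ := (g z).2) (by rw [e4]; exact hmem)
    have h6 : (fun t => F ((g z).1, t)) = fun t => ((ρ : ℂ) ^ m)⁻¹ * U (z0 + t • v) := by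
      funext t
      simp only [hF, e3]
    rw [h6, (h5.const_mul _).deriv, e4]
    have : ∀ k, cd k U (io z) = 0 := fun k => (hZ z hz).2.2 k
    simp [this]

lemma min_pos {ι : Type*} [Finite ι] (f : ι → ℝ) (hf : ∀ i, 0 < f i) : ∃ e, 0 < e ∧ ∀ i, e ≤ f i := by
  rcases isEmpty_or_nonempty ι with h | h
  · exact ⟨1, one_pos, fun i => (h.false i).elim⟩
  · obtain ⟨i, hi⟩ := Finite.exists_min f
    exact ⟨f i, hf i, hi⟩

lemma fibre_all {m : ℕ} {P : MvPolynomial (Fin d) ℝ} (hP : P.IsHomogeneous m) {b : Fin d → (Fin d → ℝ)}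
    (Ξ : EuclideanSpace ℝ (Fin d) ≃L[ℝ] (Fin d → ℝ)) (hΞ : ∀ x k, x k = ∑ i, Ξ x i * b i k)
    (hi : ∀ k, eval (b k) P ≠ 0) (hs : ∀ i j, i < j → (pl P (b j) (b i)).Separable) :
    ∃ R, 0 < R ∧ ∃ ε, 0 < ε ∧ ∃ δ, 0 < δ ∧ ∃ K : ℕ, ∀ (U : (Fin d → ℂ) → ℂ) (Ω : Set (Fin d → ℂ)) (x0 : EuclideanSpace ℝ (Fin d)) (ρ : ℝ), 0 < ρ → IsOpen Ω → DifferentiableOn ℂ U Ω →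
      (∀ z, ‖z‖ ≤ R → io x0 + (ρ : ℂ) • z ∈ Ω) →
      (∀ z, ‖z‖ ≤ R → ‖((ρ : ℂ) ^ m)⁻¹ * U (io x0 + (ρ : ℂ) • z) - aeval z P‖ ≤ ε) →
      ∀ i j : Fin d, i < j → 
      ∀ Z : Finset (EuclideanSpace ℝ (Fin d)), (∀ z ∈ Z, z ∈ Sg U (ball x0 (ρ * δ))) →
      (∀ z ∈ Z, ∀ z' ∈ Z, ∀ k, k ≠ i → k ≠ j → Ξ z k = Ξ z' k) → Z.card ≤ K := by
  classical
  set R := 4 * ∑ k, ‖b k‖ + 1 with hR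
  have hR0 : 0 < R := by
    have : 0 ≤ ∑ k, ‖b k‖ := Finset.sum_nonneg fun k _ => norm_nonneg _
    linarith
  have h := fun p : {p : Fin d × Fin d // p.1 < p.2} => fibre hP Ξ hΞ p.2 (hi p.1.1) (hs _ _ p.2) (R := R) le_rfl
  choose ε hε δ hδ K h using h
  obtain ⟨ε0, hε0, hε1⟩ := min_pos ε hε
  obtain ⟨δ0, hδ0, hδ1⟩ := min_pos δ hδ
  refine ⟨R, hR0, ε0, hε0, δ0, hδ0, ∑ p, K p, ?_⟩
  intro U Ω x0 ρ hρ hΩ hU hin happ i j hij Z hZ hZeq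
  refine (h ⟨(i, j), hij⟩ U Ω x0 ρ hρ hΩ hU hin (fun z hz => (happ z hz).trans (hε1 _)) Z (fun z hz => ?_) hZeq).trans
    (Finset.single_le_sum (f := K) (fun _ _ => Nat.zero_le _) (Finset.mem_univ (⟨(i, j), hij⟩ : {p : Fin d × Fin d // p.1 < p.2})))
  have h1 := hZ z hz
  exact ⟨ball_subset_ball (mul_le_mul_of_nonneg_left (hδ1 _) hρ.le) h1.1, h1.2⟩

end FIBRE
end SSM

namespace SSM

section NEAR
variable {d : ℕ} {lam M : ℝ}
open Filter MvPolynomial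

lemma good_basis {A B : Matrix (Fin d) (Fin d) ℝ} (hE : Ell d lam A B) {m : ℕ} {P : MvPolynomial (Fin d) ℝ} (hP : P.IsHomogeneous m) (hP0 : P ≠ 0)
    (hL : ∑ i, ∑ j, C (A i j) * pderiv j (pderiv i P) = 0) :
    ∃ b : Fin d → (Fin d → ℝ), LinearIndependent ℝ b ∧
      (∀ k, MvPolynomial.eval (b k) P ≠ 0) ∧ ∀ i j, i < j → (pl P (b j) (b i)).Separable := by
  classical
  refine exists_basis hP0 (fun e he => ?_) d le_rfl
  set Qp : MvPolynomial (Fin d) ℝ := ∑ i, ∑ j, C (B i j) * X j * X i with hQp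
  have hev : ∀ x, ev Qp x = bform B x x := by
    intro x
    simp only [hQp, ev_sum, ev_mul, ev_C, ev_X, bform]
  refine sep_generic Qp A one_pos (fun x => ?_) ?_ (fun i => ?_) hP hL e he
  · rw [hev, one_mul]; exact hE.qlo x
  · rw [hev]; simp [bform]
  · have hp : ∀ j, pderiv j Qp = 2 * ∑ k, C (B j k) * X k := by
      intro j
      have e1 : ∀ i k : Fin d, pderiv j (C (B i k) * X k * X i : MvPolynomial (Fin d) ℝ) = (if k = j then C (B i k) * X i else 0) + (if i = j then C (B i k) * X k else 0) := by
        intro i k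
        rw [pderiv_mul, pderiv_C_mul, pderiv_X, pderiv_X]
        by_cases h1 : k = j <;> by_cases h2 : i = j <;> simp [h1, h2]
      simp only [hQp, map_sum, e1, Finset.sum_add_distrib]
      simp only [Finset.sum_ite_eq', Finset.mem_univ, if_true]
      rw [Finset.sum_comm]
      simp only [Finset.sum_ite_eq', Finset.mem_univ, if_true]
      rw [two_mul]
      congr 1
      exact Finset.sum_congr rfl fun k _ => by rw [hE.bS]
    simp only [hp]
    calc _ = 2 * ∑ k, (∑ j, C (A i j * B j k)) * X k := by
          simp only [Finset.mul_sum, Finset.sum_mul]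
          rw [Finset.sum_comm]
          refine Finset.sum_congr rfl fun k _ => Finset.sum_congr rfl fun j _ => ?_
          rw [C_mul]; ring
      _ = 2 * ∑ k, C (if i = k then 1 else 0) * X k := by
          congr 1
          refine Finset.sum_congr rfl fun k _ => ?_
          rw [← map_sum, hE.ab]
      _ = _ := by
          congr 1
          rw [Finset.sum_eq_single i]
          · simp
          · intro k _ hk; simp [hk.symm]
          · simp

variable {ι : Type*}

lemma ulim (𝒰 : Ultrafilter ι) {f : ι → ℝ} {B : ℝ} (h : ∀ n, |f n| ≤ B) : ∃ c, Tendsto f 𝒰 (nhds c) := by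
  have hm : ((𝒰.map f : Ultrafilter ℝ) : Filter ℝ) ≤ 𝓟 (Icc (-B) B) := by
    rw [le_principal_iff]
    refine Filter.mem_map.2 (Filter.univ_mem' fun n => ?_)
    exact abs_le.1 (h n)
  obtain ⟨c, _, hc⟩ := (isCompact_Icc (a := -B) (b := B)).ultrafilter_le_nhds (𝒰.map f) hm
  exact ⟨c, hc⟩

lemma ell_lim (𝒰 : Ultrafilter ι) {An Bn : ι → Matrix (Fin d) (Fin d) ℝ} {A B : Matrix (Fin d) (Fin d) ℝ} (h : ∀ n, Ell d lam (An n) (Bn n))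
    (hA : ∀ i j, Tendsto (fun n => An n i j) 𝒰 (nhds (A i j))) (hB : ∀ i j, Tendsto (fun n => Bn n i j) 𝒰 (nhds (B i j))) : Ell d lam A B := by
  have hbf : ∀ {Xn : ι → Matrix (Fin d) (Fin d) ℝ} {X : Matrix (Fin d) (Fin d) ℝ}, (∀ i j, Tendsto (fun n => Xn n i j) 𝒰 (nhds (X i j))) →
      ∀ x, Tendsto (fun n => bform (Xn n) x x) 𝒰 (nhds (bform X x x)) := by
    intro Xn X hX x
    unfold bform
    exact tendsto_finsetSum _ fun i _ => tendsto_finsetSum _ fun j _ => ((hX i j).mul_const _).mul_const _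
  refine ⟨fun i j => ?_, fun i j => ?_, fun i k => ?_, fun x => ?_, fun x => ?_, fun i j => ?_, fun i j => ?_, fun x => ?_⟩
  · exact tendsto_nhds_unique (hA i j) (by simpa only [(h _).aS i j] using hA j i)
  · exact tendsto_nhds_unique (hB i j) (by simpa only [(h _).bS i j] using hB j i)
  · have h1 : Tendsto (fun n => ∑ j, An n i j * Bn n j k) 𝒰 (nhds (∑ j, A i j * B j k)) := tendsto_finsetSum _ fun j _ => (hA i j).mul (hB j k)
    simp only [(h _).ab i k] at h1
    exact tendsto_nhds_unique h1 tendsto_const_nhds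
  · exact ge_of_tendsto' (hbf hB x) fun n => (h n).qlo x
  · exact le_of_tendsto' (hbf hB x) fun n => (h n).qhi x
  · exact le_of_tendsto' (hA i j).abs fun n => (h n).aB i j
  · exact le_of_tendsto' (hB i j).abs fun n => (h n).bB i j
  · exact ge_of_tendsto' (hbf hA x) fun n => (h n).low x

lemma nonflat_one (hd : 2 ≤ d) (hl : 0 < lam) (hM : 0 < M) {A : Matrix (Fin d) (Fin d) ℝ} {U : (Fin d → ℂ) → ℂ} (hS : Sol d lam M A U)
    {xn : EuclideanSpace ℝ (Fin d)} (hxn : xn ∈ closedBall (0 : EuclideanSpace ℝ (Fin d)) (1/2)) {ε : ℝ} (hε : 0 < ε) (hb : ε ≤ ‖U (io xn)‖)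
    {x : EuclideanSpace ℝ (Fin d)} (hx : x ∈ closedBall (0 : EuclideanSpace ℝ (Fin d)) (1/2)) : ∃ l, Gl U l (io x) ≠ 0 := by
  by_contra hcon
  push Not at hcon
  refine not_flat (ι := Unit) hd hl hM (pure ()) (An := fun _ => A) (Un := fun _ => U) (fun _ => hS) (xn := fun _ => xn) (fun _ => hxn) hε (fun _ => hb) hx ?_
  intro l
  simp only [hcon l]
  exact tendsto_const_nhds

theorem near_point (hd : 2 ≤ d) (hl : 0 < lam) (hM : 0 < M) (𝒰 : Ultrafilter ι) {An : ι → Matrix (Fin d) (Fin d) ℝ} {Un : ι → (Fin d → ℂ) → ℂ}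
    (hS : ∀ n, Sol d lam M (An n) (Un n))
    {xn : ι → EuclideanSpace ℝ (Fin d)} (hxn : ∀ n, xn n ∈ closedBall (0 : EuclideanSpace ℝ (Fin d)) (1/2)) {ε : ℝ} (hε : 0 < ε) (hb : ∀ n, ε ≤ ‖Un n (io (xn n))‖)
    {x : EuclideanSpace ℝ (Fin d)} (hx : x ∈ closedBall (0 : EuclideanSpace ℝ (Fin d)) (1/2)) :
    ∃ δ, 0 < δ ∧ ∃ Cc : ℝ, 0 ≤ Cc ∧ ∀ᶠ n in (𝒰 : Filter ι), ∀ r, 0 < r → r ≤ 1 / 2 →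
      μH[(d : ℝ) - 2] (Sg (Un n) (ball 0 r ∩ ball x δ)) ≤ ENNReal.ofReal (Cc * r ^ (d - 2)) := by
  classical
  have hη := eta_pos hd hl
  have hΩ := Om_open (d := d) (eta d lam)
  have hmem : io x ∈ Om d (eta d lam) := ball_Om hx (mem_ball_self hη)
  have hnf := not_flat hd hl hM 𝒰 hS hxn hε hb hx
  set cn : ι → List (Fin d) → ℝ := fun n l => (Gl (Un n) l (io x)).re with hcn
  have hcv : ∀ n l, Gl (Un n) l (io x) = cn n l := fun n l => (hS n).re_eq hmem l
  have hlim : ∀ l, ∃ c, Tendsto (fun n => cn n l) 𝒰 (nhds c) := by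
    intro l
    obtain ⟨C, hC, h⟩ := Gl_bound l (eta d lam) hη
    refine ulim 𝒰 (B := C * M) fun n => ?_
    exact (Complex.abs_re_le_norm _).trans (h (Un n) (io x) M ((hS n).diff.mono (ball_Om hx)) fun z hz => (hS n).bd z (ball_Om hx hz))
  choose c hc using hlim
  have hEn := fun n => (hS n).ell
  choose Bn hBn using hEn
  have hA := fun i j => ulim 𝒰 (f := fun n => An n i j) fun n => (hBn n).aB i j
  have hB := fun i j => ulim 𝒰 (f := fun n => Bn n i j) fun n => (hBn n).bB i j
  choose A hA using hA
  choose B hB using hB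
  have hE : Ell d lam A B := ell_lim 𝒰 hBn hA hB
  have hperm : ∀ l l' : List (Fin d), l.Perm l' → c l = c l' := by
    intro l l' h
    refine tendsto_nhds_unique (hc l) ?_
    have : (fun n => cn n l) = fun n => cn n l' := by
      funext n
      simp only [hcn, Gl_perm hΩ (hS n).diff h _ hmem]
    rw [this]; exact hc l'
  have hpde : ∀ l, ∑ i, ∑ j, A i j * c (i :: j :: l) = 0 := by
    intro l
    have h1 : Tendsto (fun n => ∑ i, ∑ j, An n i j * cn n (i :: j :: l)) 𝒰 (nhds (∑ i, ∑ j, A i j * c (i :: j :: l))) :=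
      tendsto_finsetSum _ fun i _ => tendsto_finsetSum _ fun j _ => (hA i j).mul (hc _)
    have h2 : ∀ n, ∑ i, ∑ j, An n i j * cn n (i :: j :: l) = 0 := by
      intro n
      have := (hS n).pde l x hmem
      simp only [hcv] at this
      exact_mod_cast this
    simp only [h2] at h1
    exact tendsto_nhds_unique h1 tendsto_const_nhds
  have hex : ∃ k, Sp c k [] ≠ 0 := by
    by_contra hcon
    push Not at hcon
    apply hnf
    intro l
    have h0 : c l = 0 := by
      have := Sp_zero hperm [] (hcon l.length) l rfl
      simpa using this
    have h1 := hc l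
    rw [h0] at h1
    simp only [hcv]
    have := (Complex.continuous_ofReal.tendsto 0).comp h1
    simpa using! this
  set m := Nat.find hex with hm
  have hm0 : Sp c m [] ≠ 0 := Nat.find_spec hex
  have hmz : ∀ k < m, Sp c k [] = 0 := fun k hk => by
    by_contra h
    exact Nat.find_min hex hk h
  have hfac : ((m.factorial : ℝ))⁻¹ ≠ 0 := inv_ne_zero (by exact_mod_cast m.factorial_ne_zero)
  set P : MvPolynomial (Fin d) ℝ := C ((m.factorial : ℝ))⁻¹ * Sp c m [] with hPdef
  have hP0 : P ≠ 0 := mul_ne_zero (by simpa using hfac) hm0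
  have hPh : P.IsHomogeneous m := by
    have := (isHomogeneous_C (Fin d) ((m.factorial : ℝ))⁻¹).mul (Sp_hom (c := c) m [])
    simpa using this
  have hPL : ∑ i, ∑ j, C (A i j) * pderiv j (pderiv i P) = 0 := by
    have h1 := Sp_pde hperm hpde m []
    have : ∑ i, ∑ j, C (A i j) * pderiv j (pderiv i P) = C ((m.factorial : ℝ))⁻¹ * ∑ i, ∑ j, C (A i j) * pderiv j (pderiv i (Sp c m [])) := by
      simp only [Finset.mul_sum, hPdef]
      refine Finset.sum_congr rfl fun i _ => Finset.sum_congr rfl fun j _ => ?_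
      rw [pderiv_C_mul, pderiv_C_mul]
      ring
    rw [this, h1, mul_zero]
  have hPa : ∀ z : Fin d → ℂ, aeval z P = (m.factorial : ℂ)⁻¹ * aeval z (Sp c m []) := by
    intro z
    rw [hPdef, map_mul, aeval_C]
    simp
  obtain ⟨b, hb1, hb2, hb3⟩ := good_basis hE hPh hP0 hPL
  obtain ⟨Ξ, hΞ⟩ := xi_exists hb1
  obtain ⟨R, hR, ε1, hε1, δ, hδ, K, hfib⟩ := fibre_all hPh Ξ hΞ hb2 hb3
  obtain ⟨ρ, hρ, hρR, hev⟩ := blowup (𝓕 := (𝒰 : Filter ι)) hη hM (fun n => (hS n).diff.mono (ball_Om hx)) (fun n z hz => (hS n).bd z (ball_Om hx hz)) hcv hc hmz hR hε1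
  refine ⟨ρ * δ, by positivity, d * d * cLoc Ξ K, ?_, ?_⟩
  · unfold cLoc; positivity
  filter_upwards [hev] with n hn r hr hr2
  have hW : ∀ y ∈ ball (0 : EuclideanSpace ℝ (Fin d)) r ∩ ball x (ρ * δ), y ∈ closedBall (0 : EuclideanSpace ℝ (Fin d)) (1/2) := fun y hy =>
    ball_subset_closedBall (ball_subset_ball hr2 hy.1)
  refine local_bound hd hl (hS n) (isOpen_ball.inter isOpen_ball) (fun y hy => ball_Om (hW y hy) (mem_ball_self hη))
    (fun y hy => nonflat_one hd hl hM (hS n) (hxn n) hε (hb n) (hW y hy)) Ξ (fun i j hij Z hZ hZe => ?_) hr inter_subset_left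
  refine hfib (Un n) (Om d (eta d lam)) x ρ hρ hΩ (hS n).diff (fun z hz => ball_Om hx ?_) (fun z hz => ?_) i j hij Z (fun z hz => ⟨(hZ z hz).1.2, (hZ z hz).2⟩) hZe
  · rw [mem_ball_iff_norm, add_sub_cancel_left, norm_smul, Complex.norm_real, Real.norm_of_nonneg hρ.le]
    exact lt_of_le_of_lt (by gcongr) hρR
  · rw [hPa]; exact hn z hz

theorem main_bound
    (d : ℕ) (hd : 2 ≤ d) (lam N : ℝ) (hlam0 : 0 < lam) (hlam1 : lam ≤ 1) (hN : 1 < N) :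
    ∃ C : ℝ, 0 < C ∧
      ∀ u : EuclideanSpace ℝ (Fin d) → ℝ, MemF d lam N u →
        ∀ r : ℝ, 0 < r → r ≤ 1 / 2 →
          μH[(d : ℝ) - 2]
              ({x ∈ ball (0 : EuclideanSpace ℝ (Fin d)) 1 | u x = 0 ∧ gradient u x = 0} ∩ ball (0 : EuclideanSpace ℝ (Fin d)) r)
            ≤ ENNReal.ofReal (C * r ^ (d - 2)) := by
  classical
  by_contra hcon
  push Not at hcon
  have h0 := fun n : ℕ => hcon ((n : ℝ) + 1) (by positivity)
  choose u hu r hr hr2 hbig using h0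
  obtain ⟨M, hM, hsol⟩ := sol_exists hd hlam0 hlam1 hN
  have h1 := fun n => hsol (u n) (hu n)
  choose A U hS hUu x hx hxb using h1
  have hε : 0 < Real.sqrt (1 / N) := Real.sqrt_pos.2 (by positivity)
  set 𝒰 : Ultrafilter ℕ := hyperfilter ℕ
  have h2 := fun y : closedBall (0 : EuclideanSpace ℝ (Fin d)) (1/2) => near_point hd hlam0 hM 𝒰 hS hx hε hxb y.2
  choose δ hδ Cc hCc hev using h2
  obtain ⟨t, ht⟩ := (isCompact_closedBall (0 : EuclideanSpace ℝ (Fin d)) (1/2)).elim_finite_subcover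
    (fun y : closedBall (0 : EuclideanSpace ℝ (Fin d)) (1/2) => ball y.1 (δ y)) (fun y => isOpen_ball)
    (fun y hy => mem_iUnion.2 ⟨⟨y, hy⟩, mem_ball_self (hδ _)⟩)
  have hall : ∀ᶠ n in (𝒰 : Filter ℕ), ∀ y ∈ t, ∀ r, 0 < r → r ≤ 1 / 2 →
      μH[(d : ℝ) - 2] (Sg (U n) (ball 0 r ∩ ball y.1 (δ y))) ≤ ENNReal.ofReal (Cc y * r ^ (d - 2)) :=
    (Finset.eventually_all t).2 fun y _ => hev y
  have hlarge : ∀ᶠ n : ℕ in (𝒰 : Filter ℕ), ∑ y ∈ t, Cc y ≤ (n : ℝ) := by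
    have h3 : ∀ᶠ n : ℕ in atTop, ∑ y ∈ t, Cc y ≤ (n : ℝ) := tendsto_natCast_atTop_atTop.eventually_ge_atTop _
    rw [← Nat.cofinite_eq_atTop] at h3
    exact h3.filter_mono (hyperfilter_le_cofinite)
  obtain ⟨n, hn1, hn2⟩ := (hall.and hlarge).exists
  refine absurd (hbig n) (not_lt.2 ?_)
  have hsub : ({x ∈ ball (0 : EuclideanSpace ℝ (Fin d)) 1 | u n x = 0 ∧ gradient (u n) x = 0} ∩ ball (0 : EuclideanSpace ℝ (Fin d)) (r n))
      ⊆ ⋃ y ∈ t, Sg (U n) (ball 0 (r n) ∩ ball y.1 (δ y)) := by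
    intro z hz
    have hz2 : z ∈ ball (0 : EuclideanSpace ℝ (Fin d)) (1/2) := ball_subset_ball (hr2 n) hz.2
    obtain ⟨y, hy, hzy⟩ := mem_iUnion₂.1 (ht (ball_subset_closedBall hz2))
    refine mem_iUnion₂.2 ⟨y, hy, ⟨hz.2, hzy⟩, ?_, fun i => ?_⟩
    · rw [(hUu n z hz2).1, hz.1.2.1]; simp
    · rw [(hUu n z hz2).2 i, hz.1.2.2]; simp
  calc _ ≤ μH[(d : ℝ) - 2] (⋃ y ∈ t, Sg (U n) (ball 0 (r n) ∩ ball y.1 (δ y))) := measure_mono hsub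
    _ ≤ ∑ y ∈ t, μH[(d : ℝ) - 2] (Sg (U n) (ball 0 (r n) ∩ ball y.1 (δ y))) := measure_biUnion_finset_le _ _
    _ ≤ ∑ y ∈ t, ENNReal.ofReal (Cc y * r n ^ (d - 2)) := Finset.sum_le_sum fun y hy => hn1 y hy _ (hr n) (hr2 n)
    _ = ENNReal.ofReal ((∑ y ∈ t, Cc y) * r n ^ (d - 2)) := by
      rw [← ENNReal.ofReal_sum_of_nonneg fun y _ => mul_nonneg (hCc y) (pow_nonneg (hr n).le _), Finset.sum_mul]
    _ ≤ _ := by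
      apply ENNReal.ofReal_le_ofReal
      have := pow_nonneg (hr n).le (d - 2)
      gcongr
      linarith

end NEAR
end SSM

/-- **Estimate (4.8)** (Han–Lin). Uniform bound on the `(d-2)`-dimensional Hausdorff
measure of the singular set `S(u) = {u = |∇u| = 0}` for `u ∈ ℱ(N)`. -/
theorem singular_set_measure_bound
    (d : ℕ) (hd : 2 ≤ d) (lam N : ℝ) (hlam0 : 0 < lam) (hlam1 : lam ≤ 1) (hN : 1 < N) :
    ∃ C : ℝ, 0 < C ∧
      ∀ u : EuclideanSpace ℝ (Fin d) → ℝ, MemF d lam N u →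
        ∀ r : ℝ, 0 < r → r ≤ 1 / 2 →
          μH[(d : ℝ) - 2]
              ({x ∈ ball (0 : EuclideanSpace ℝ (Fin d)) 1 | u x = 0 ∧ gradient u x = 0} ∩ ball (0 : EuclideanSpace ℝ (Fin d)) r)
            ≤ ENNReal.ofReal (C * r ^ (d - 2)) := by
  exact SSM.main_bound d hd lam N hlam0 hlam1 hN

end
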